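/- There exists an infinite-dimensional separable real Banach space P such that: (a) P is hereditarily indecomposable; (b) no infinite-dimensional closed subspace of P is reflexive; and (c) every bounded linear operator T : P → P has the form T = λ·id_P + W for some scalar λ ∈ ℝ and some weakly compact operator W : P → P. -/

import Mathlib

open TopologicalSpace

noncomputable section

/-- A packaged real Banach space: a type together with a complete norm and
an `ℝ`-vector space structure. -/
structure BanachSpacePkg : Type 1 where
  carrier : Type
  [iGroup : NormedAddCommGroup carrier]
  [iSpace : NormedSpace ℝ carrier]
  [iComplete : CompleteSpace carrier]

attribute [instance] BanachSpacePkg.iGroup BanachSpacePkg.iSpace BanachSpacePkg.iComplete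

variable (X : Type*) [SeminormedAddCommGroup X] [NormedSpace ℝ X]

/-- `Y` is an infinite-dimensional closed subspace of `X`. -/
def IsInfDimClosedSubspace (Y : Subspace ℝ X) : Prop :=
  IsClosed (Y : Set X) ∧ ¬ FiniteDimensional ℝ Y

/-- `X` is hereditarily indecomposable: for every pair of infinite-dimensional closed
subspaces `Y, Z` and every `ε > 0` there are norm-one vectors `y ∈ Y`, `z ∈ Z` with
`‖y - z‖ < ε`. -/
def IsHI : Prop :=
  ∀ Y Z : Subspace ℝ X, IsInfDimClosedSubspace X Y → IsInfDimClosedSubspace X Z →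
    ∀ ε : ℝ, 0 < ε → ∃ y ∈ Y, ∃ z ∈ Z, ‖y‖ = 1 ∧ ‖z‖ = 1 ∧ ‖y - z‖ < ε

/-- `X` is reflexive: the canonical embedding into the bidual is surjective. -/
def IsReflexiveBanach : Prop :=
  Function.Surjective (NormedSpace.inclusionInDoubleDual ℝ X)

/-- No infinite-dimensional closed subspace of `X` is reflexive. -/
def HasNoReflexiveSubspace : Prop :=
  ∀ Y : Subspace ℝ X, IsInfDimClosedSubspace X Y → ¬ IsReflexiveBanach Y

/-- Every infinite-dimensional closed subspace of `X` contains a further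
infinite-dimensional closed subspace which is reflexive. -/
def IsReflexivelySaturated : Prop :=
  ∀ Y : Subspace ℝ X, IsInfDimClosedSubspace X Y →
    ∃ Z : Subspace ℝ X, Z ≤ Y ∧ IsInfDimClosedSubspace X Z ∧ IsReflexiveBanach Z

/-- The weak topology on `X`: the topology induced by all continuous linear functionals. -/
def weakTopology : TopologicalSpace X :=
  ⨅ f : X →L[ℝ] ℝ, TopologicalSpace.induced f inferInstance

/-- A bounded operator `W : X → X` is weakly compact when the image of the closed unit
ball under `W` is relatively compact in the weak topology of `X`. -/
def IsWeaklyCompactOperator {X : Type*} [SeminormedAddCommGroup X] [NormedSpace ℝ X]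
    (W : X →L[ℝ] X) : Prop :=
  @IsCompact X (weakTopology X) (@closure X (weakTopology X) (W '' Metric.closedBall 0 1))

namespace HJT
open Finset

/-! Parameters -/

def mm (j : ℕ) : ℕ := 2 ^ (2 ^ (j + 3))

def Qr (a b : ℕ) : ℕ → ℕ
  | 0 => 0
  | r + 1 => a * (16 + Qr a b r) + b

def QQ (j a : ℕ) : ℕ := Qr a (2 * mm j + 30) (2 ^ (j + 2) - 2)

def GG (j a : ℕ) : ℕ :=
  a + mm j * a * (QQ j a + 64) + (mm j) ^ 2 * (20 * (mm j) ^ 2 + 100) + j ^ (2 ^ (j + 3) + 2)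

def nn : ℕ → ℕ
  | 0 => GG 0 1
  | j + 1 => GG (j + 1) (nn j)

def pv : ℕ → ℕ
  | 0 => 1
  | j + 1 => nn j

lemma nn_eq (j : ℕ) : nn j = GG j (pv j) := by cases j <;> rfl

lemma pv_le_nn (j : ℕ) : pv j ≤ nn j := by
  rw [nn_eq]; unfold GG; omega

lemma one_le_pv (j : ℕ) : 1 ≤ pv j := by
  induction j with
  | zero => exact le_rfl
  | succ j ih => exact ih.trans (pv_le_nn j)

lemma pv_mono : Monotone pv := monotone_nat_of_le_succ fun j => pv_le_nn j

lemma nn_le_pv {w j : ℕ} (h : w < j) : nn w ≤ pv j := pv_mono (show w + 1 ≤ j from h)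

lemma nn_mono : Monotone nn := fun a b h => pv_mono (Nat.succ_le_succ h)

lemma nn_pos (j : ℕ) : 1 ≤ nn j := (one_le_pv j).trans (pv_le_nn j)

lemma mm_succ (j : ℕ) : mm (j + 1) = mm j ^ 2 := by
  unfold mm; rw [← pow_mul]; congr 1

lemma mm_ge (j : ℕ) : 256 ≤ mm j := by
  unfold mm
  calc 256 = 2 ^ 8 := by norm_num
    _ ≤ _ := Nat.pow_le_pow_right (by norm_num) (by
      calc 8 = 2 ^ 3 := by norm_num
        _ ≤ _ := Nat.pow_le_pow_right (by norm_num) (by omega))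

lemma mm_pos (j : ℕ) : (0 : ℝ) < mm j := by
  have := mm_ge j; exact_mod_cast (by omega : 0 < mm j)

lemma mm_ge' (j : ℕ) : (256 : ℝ) ≤ mm j := by exact_mod_cast mm_ge j

lemma mm_mono : Monotone mm := fun a b h =>
  Nat.pow_le_pow_right (by norm_num) (Nat.pow_le_pow_right (by norm_num) (by omega))

lemma mm_mono' {a b : ℕ} (h : a ≤ b) : (mm a : ℝ) ≤ mm b := by exact_mod_cast mm_mono h

lemma inv_mm_le {a b : ℕ} (h : a ≤ b) : (1 : ℝ) / mm b ≤ 1 / mm a :=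
  one_div_le_one_div_of_le (mm_pos a) (mm_mono' h)

lemma mm_gt (j : ℕ) : j < mm j :=
  calc j < 2 ^ j := Nat.lt_two_pow_self
    _ ≤ mm j := Nat.pow_le_pow_right (by norm_num)
      ((by omega : j ≤ j + 3).trans Nat.lt_two_pow_self.le)

/-- Tail sums of `1/mm`. -/
lemma sum_inv_mm (J B : ℕ) : ∑ w ∈ Ico J B, (1 : ℝ) / mm w ≤ 2 / mm J := by
  rcases le_total B J with h | h
  · rw [Ico_eq_empty_of_le h, sum_empty]; have := mm_pos J; positivity
  · have key : ∀ B, J ≤ B → ∑ w ∈ Ico J B, (1 : ℝ) / mm w ≤ 2 / mm J - 2 / mm B := by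
      intro B hB
      induction B, hB using Nat.le_induction with
      | base => simp
      | succ B hB ih =>
        rw [sum_Ico_succ_top hB]
        have h1 := mm_pos B
        have h2 := mm_ge' B
        have h3 : (mm (B + 1) : ℝ) = mm B ^ 2 := by exact_mod_cast mm_succ B
        have : (1 : ℝ) / mm B + 2 / mm (B + 1) ≤ 2 / mm B := by
          rw [h3]
          rw [div_add_div _ _ h1.ne' (by positivity), div_le_div_iff₀ (by positivity) h1]
          nlinarith [pow_pos h1 2, pow_pos h1 3]
        linarith
    have := key B h
    have h1 := mm_pos B
    have : (0:ℝ) ≤ 2 / mm B := by positivity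
    linarith [key B h]

lemma nn_ge1 (j : ℕ) : mm j * pv j * (QQ j (pv j) + 64) ≤ nn j := by
  rw [nn_eq]; unfold GG; omega
lemma nn_ge2 (j : ℕ) : (mm j) ^ 2 * (20 * (mm j) ^ 2 + 100) ≤ nn j := by
  rw [nn_eq]; unfold GG; omega
lemma nn_ge3 (j : ℕ) : j ^ (2 ^ (j + 3) + 2) ≤ nn j := by
  rw [nn_eq]; unfold GG; omega

lemma nn_gt (j : ℕ) : mm j ≤ nn j := by
  refine le_trans ?_ (nn_ge2 j)
  have := mm_ge j
  nlinarith [Nat.zero_le (mm j ^2)]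

/-! Functionals and coding -/

abbrev Fn := ℕ →₀ ℚ

instance : Encodable Fn := Encodable.ofCountable Fn

def sg (t : List Fn) : ℕ := Encodable.encode t + 1

lemma sg_inj {s t : List Fn} (h : sg s = sg t) : s = t :=
  Encodable.encode_injective (by unfold sg at h; omega)

lemma sg_cons (b : Fn) (t : List Fn) : sg t < sg (b :: t) := by
  unfold sg
  rw [Encodable.encode_list_cons]
  have := Nat.right_le_pair (Encodable.encode b) (Encodable.encode t)
  omega

lemma sg_pos (t : List Fn) : 1 ≤ sg t := by unfold sg; omega

lemma sg_suffix {s t : List Fn} (h : s <:+ t) : sg s ≤ sg t := by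
  induction t with
  | nil => rw [List.suffix_nil.mp h]
  | cons b t ih =>
    rcases List.suffix_cons_iff.mp h with h | h
    · rw [h]
    · exact (ih h).trans (sg_cons b t).le

def HasNode (t : List Fn) (w : ℕ) : Prop := ∃ b r, (b :: r) <:+ t ∧ sg r = w

/-- The node of `t` with weight `w` (zero if none). -/
def Nd : List Fn → ℕ → Fn
  | [], _ => 0
  | b :: r, w => if sg r = w then b else Nd r w

lemma Nd_eq {b : Fn} {r t : List Fn} (h : (b :: r) <:+ t) : Nd t (sg r) = b := by
  induction t with
  | nil => simp at h
  | cons c t ih =>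
    rcases List.suffix_cons_iff.mp h with h | h
    · obtain ⟨rfl, rfl⟩ := List.cons_eq_cons.mp h
      simp [Nd]
    · have h1 := sg_suffix h
      have h2 := sg_cons b r
      simp only [Nd]
      rw [if_neg (by omega), ih h]

lemma Nd_zero {t : List Fn} {w : ℕ} (h : ¬ HasNode t w) : Nd t w = 0 := by
  induction t with
  | nil => rfl
  | cons c t ih =>
    have h1 : sg t ≠ w := fun hh => h ⟨c, t, List.suffix_rfl, hh⟩
    simp only [Nd, if_neg h1]
    exact ih fun ⟨b, r, hb, hr⟩ => h ⟨b, r, hb.trans (List.suffix_cons c t), hr⟩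

lemma Nd_suffix {b : Fn} {r t : List Fn} (h : (b :: r) <:+ t) {w : ℕ} (hw : w < sg r) :
    Nd t w = Nd r w := by
  induction t with
  | nil => simp at h
  | cons c t ih =>
    rcases List.suffix_cons_iff.mp h with h | h
    · obtain ⟨rfl, rfl⟩ := List.cons_eq_cons.mp h
      simp [Nd, hw.ne']
    · have h1 := sg_suffix h
      have h2 := sg_cons b r
      simp only [Nd]
      rw [if_neg (by omega), ih h]

lemma Nd_common {t t' : List Fn} {w w' : ℕ} (h : HasNode t w) (h' : HasNode t' w) (hw : w' < w) :
    Nd t w' = Nd t' w' := by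
  obtain ⟨b, r, hb, hr⟩ := h
  obtain ⟨b', r', hb', hr'⟩ := h'
  obtain rfl : r = r' := sg_inj (hr.trans hr'.symm)
  rw [Nd_suffix hb (by omega), Nd_suffix hb' (by omega)]

lemma Nd_large {t : List Fn} {w : ℕ} (h : sg t ≤ w) : Nd t w = 0 := by
  apply Nd_zero
  rintro ⟨b, r, hb, hr⟩
  have := sg_suffix hb
  have := sg_cons b r
  omega

/-- Interval restriction. -/
def rs {M : Type*} [Zero M] (a b : ℕ) (f : ℕ →₀ M) : ℕ →₀ M := f.filter fun n => a ≤ n ∧ n < b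

lemma rs_apply {M : Type*} [Zero M] (a b : ℕ) (f : ℕ →₀ M) (n : ℕ) :
    rs a b f n = if a ≤ n ∧ n < b then f n else 0 := by
  unfold rs; rw [Finsupp.filter_apply]

lemma rs_add {M : Type*} [AddCommGroup M] (a b : ℕ) (f g : ℕ →₀ M) :
    rs a b (f + g) = rs a b f + rs a b g := by
  ext n; simp only [rs_apply, Finsupp.add_apply]; split_ifs <;> simp

lemma rs_zero {M : Type*} [AddCommGroup M] (a b : ℕ) : rs a b (0 : ℕ →₀ M) = 0 := by
  ext n; simp [rs_apply]

lemma rs_sum {M ι : Type*} [AddCommGroup M] (a b : ℕ) (s : Finset ι) (f : ι → ℕ →₀ M) :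
    rs a b (∑ i ∈ s, f i) = ∑ i ∈ s, rs a b (f i) := by
  classical
  induction s using Finset.induction_on with
  | empty => simp [rs_zero]
  | insert i s hi ih => rw [sum_insert hi, sum_insert hi, rs_add, ih]

lemma rs_smul {R : Type*} [Ring R] (a b : ℕ) (c : R) (f : ℕ →₀ R) :
    rs a b (c • f) = c • rs a b f := by
  ext n; simp only [rs_apply, Finsupp.smul_apply]; split_ifs <;> simp

lemma rs_rs {M : Type*} [AddCommGroup M] (a b c d : ℕ) (f : ℕ →₀ M) :
    rs a b (rs c d f) = rs (max a c) (min b d) f := by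
  ext n; simp only [rs_apply]
  by_cases h1 : a ≤ n ∧ n < b <;> by_cases h2 : c ≤ n ∧ n < d <;>
    simp [h1, h2, max_le_iff, lt_min_iff] <;> intros <;> exfalso <;> tauto

/-- Data of a type II functional. -/
structure T2 where
  L : ℕ
  ι : Finset ℕ
  t : ℕ → List Fn
  lo : ℕ → ℕ
  hi : ℕ → ℕ
  c : ℕ → ℚ
  a : ℕ
  b : ℕ

def T2.pt (T : T2) (w : ℕ) : Fn :=
  (1 / T.L : ℚ) • rs T.a T.b
    (∑ l ∈ T.ι, if T.lo l ≤ w ∧ w < T.hi l then T.c l • Nd (T.t l) w else 0)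

def T2.fn (T : T2) (α β : ℕ) : Fn := ∑ w ∈ Ico α β, T.pt w

structure T2.Good (T : T2) : Prop where
  hL : 1 ≤ T.L
  card : T.ι.card ≤ T.L ^ 2
  hc : ∀ l ∈ T.ι, |T.c l| ≤ 1
  hlo : ∀ l ∈ T.ι, T.L ≤ T.lo l
  disj : ∀ l ∈ T.ι, ∀ l' ∈ T.ι, ∀ w, HasNode (T.t l) w → HasNode (T.t l') w →
    T.lo l ≤ w → w < T.hi l → T.lo l' ≤ w → w < T.hi l' → l = l'

inductive InK : Option ℕ → Fn → Prop
  | single (n : ℕ) (q : ℚ) (hq : |q| ≤ 1) : InK none (Finsupp.single n q)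
  | wt (j d : ℕ) (F : ℕ → Fn) (hd : d ≤ nn j) (hF : ∀ l < d, InK none (F l))
      (hs : ∀ l l', l < l' → l' < d → ∀ n ∈ (F l).support, ∀ n' ∈ (F l').support, n < n') :
      InK (some j) ((1 / mm j : ℚ) • ∑ l ∈ range d, F l)
  | up (j : ℕ) (f : Fn) (h : InK (some j) f) : InK none f
  | t2 (T : T2) (α β : ℕ) (hT : T.Good)
      (hn : ∀ l ∈ T.ι, ∀ b r, (b :: r) <:+ T.t l → InK (some (sg r)) b) :
      InK none (T.fn α β)

abbrev KK (f : Fn) : Prop := InK none f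
abbrev WW (j : ℕ) (f : Fn) : Prop := InK (some j) f

/-- Valid type II data. -/
structure T2.Val (T : T2) : Prop extends T2.Good T where
  hn : ∀ l ∈ T.ι, ∀ b r, (b :: r) <:+ T.t l → WW (sg r) b

lemma T2.Val.mem {T : T2} (h : T.Val) (α β : ℕ) : KK (T.fn α β) := InK.t2 T α β h.toGood h.hn

lemma WW_zero (j : ℕ) : WW j 0 := by
  have := InK.wt j 0 (fun _ => 0) (Nat.zero_le _) (by simp) (by simp)
  simpa using this

def T2.smul (T : T2) (q : ℚ) : T2 := { T with c := fun l => q * T.c l }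
def T2.res (T : T2) (a b : ℕ) : T2 := { T with a := max a T.a, b := min b T.b }

lemma T2.fn_smul (T : T2) (q : ℚ) (α β : ℕ) : (T.smul q).fn α β = q • T.fn α β := by
  unfold T2.fn
  rw [smul_sum]
  refine sum_congr rfl fun w _ => ?_
  simp only [T2.pt, T2.smul]
  rw [smul_comm, ← rs_smul _ _ q, smul_sum]
  congr 2
  refine sum_congr rfl fun l _ => ?_
  by_cases h : T.lo l ≤ w ∧ w < T.hi l
  · rw [if_pos h, smul_smul]; exact if_pos h
  · rw [if_neg h, smul_zero]; exact if_neg h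

lemma T2.fn_res (T : T2) (a b : ℕ) (α β : ℕ) : (T.res a b).fn α β = rs a b (T.fn α β) := by
  unfold T2.fn
  rw [rs_sum]
  refine sum_congr rfl fun w _ => ?_
  simp only [T2.pt, T2.res]
  rw [rs_smul, rs_rs]
  rfl

lemma InK.smul {o : Option ℕ} {f : Fn} (h : InK o f) (q : ℚ) (hq : |q| ≤ 1) : InK o (q • f) := by
  induction h with
  | single n p hp =>
    rw [Finsupp.smul_single]
    exact .single _ _ (by
      rw [smul_eq_mul, abs_mul]; exact mul_le_one₀ hq (abs_nonneg _) hp)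
  | wt j d F hd hF hs ih =>
    rw [smul_comm, smul_sum]
    refine .wt j d (fun l => q • F l) hd ih fun l l' h1 h2 n hn n' hn' => ?_
    exact hs l l' h1 h2 n (Finsupp.support_smul hn) n' (Finsupp.support_smul hn')
  | up j f h ih => exact .up j _ ih
  | t2 T α β hT hn ih =>
    rw [← T2.fn_smul]
    refine .t2 _ α β ⟨hT.hL, hT.card, fun l hl => ?_, hT.hlo, hT.disj⟩ hn
    simp only [T2.smul, abs_mul]
    exact mul_le_one₀ hq (abs_nonneg _) (hT.hc l hl)

lemma InK.neg {o : Option ℕ} {f : Fn} (h : InK o f) : InK o (-f) := by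
  have := h.smul (-1) (by simp)
  simpa using this

lemma rs_support {M : Type*} [Zero M] {a b : ℕ} {f : ℕ →₀ M} {n : ℕ}
    (h : n ∈ (rs a b f).support) : n ∈ f.support ∧ a ≤ n ∧ n < b := by
  rw [Finsupp.mem_support_iff, rs_apply] at h
  split_ifs at h with h1
  · exact ⟨Finsupp.mem_support_iff.mpr h, h1⟩
  · exact absurd rfl h

lemma InK.rs {o : Option ℕ} {f : Fn} (h : InK o f) (a b : ℕ) : InK o (rs a b f) := by
  induction h with
  | single n p hp =>
    by_cases h : a ≤ n ∧ n < b
    · have : HJT.rs a b (Finsupp.single n p) = Finsupp.single n p := by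
        ext m; rw [rs_apply]; split_ifs with h1
        · rfl
        · rw [Finsupp.single_apply, if_neg]; rintro rfl; exact h1 h
      rw [this]; exact .single _ _ hp
    · have : HJT.rs a b (Finsupp.single n p) = Finsupp.single n 0 := by
        ext m; rw [rs_apply]; split_ifs with h1
        · rw [Finsupp.single_apply, if_neg]
          · simp
          · rintro rfl; exact h h1
        · simp
      rw [this]; exact .single _ _ (by simp)
  | wt j d F hd hF hs ih =>
    rw [rs_smul, rs_sum]
    refine .wt j d _ hd ih fun l l' h1 h2 n hn n' hn' => ?_
    exact hs l l' h1 h2 n (rs_support hn).1 n' (rs_support hn').1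
  | up j f h ih => exact .up j _ ih
  | t2 T α β hT hn ih =>
    rw [← T2.fn_res]
    exact .t2 _ α β ⟨hT.hL, hT.card, hT.hc, hT.hlo, hT.disj⟩ hn

lemma T2.Val.res {T : T2} (h : T.Val) (a b : ℕ) : (T.res a b).Val :=
  ⟨⟨h.hL, h.card, h.hc, h.hlo, h.disj⟩, h.hn⟩

lemma T2.fn_split (T : T2) {α γ β : ℕ} (h1 : α ≤ γ) (h2 : γ ≤ β) :
    T.fn α β = T.fn α γ + T.fn γ β := (sum_Ico_consecutive _ h1 h2).symm

lemma T2.fn_succ (T : T2) (w : ℕ) : T.fn w (w + 1) = T.pt w := by simp [T2.fn]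

/-- the piece of weight `w` of a type II functional is in `W_w`. -/
lemma T2.Val.pt_mem {T : T2} (h : T.Val) (w : ℕ) : WW w (T.pt w) := by
  classical
  unfold T2.pt
  have hL : |(1 / T.L : ℚ)| ≤ 1 := by
    have : (1 : ℚ) ≤ T.L := by exact_mod_cast h.hL
    rw [abs_of_nonneg (by positivity)]
    exact (div_le_one (by linarith)).mpr this
  refine InK.smul (InK.rs ?_ _ _) _ hL
  by_cases hx : ∃ l ∈ T.ι, T.lo l ≤ w ∧ w < T.hi l ∧ HasNode (T.t l) w
  · obtain ⟨l, hl, h1, h2, h3⟩ := hx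
    rw [sum_eq_single_of_mem l hl]
    · rw [if_pos ⟨h1, h2⟩]
      obtain ⟨b, r, hb, rfl⟩ := h3
      rw [Nd_eq hb]
      exact (h.hn l hl b r hb).smul _ (h.hc l hl)
    · intro l' hl' hne
      split_ifs with h4
      · rw [Nd_zero, smul_zero]
        intro h5
        exact hne (h.disj l' hl' l hl w h5 h3 h4.1 h4.2 h1 h2)
      · rfl
  · push Not at hx
    rw [sum_eq_zero]
    · exact WW_zero w
    · intro l hl
      split_ifs with h4
      · rw [Nd_zero (hx l hl h4.1 h4.2), smul_zero]
      · rfl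

/-- Coordinates of functionals. -/
lemma InK.coord {o : Option ℕ} {f : Fn} (h : InK o f) :
    ∀ n, |(f n : ℝ)| ≤ (match o with | none => 1 | some j => 1 / (mm j : ℝ)) := by
  induction h with
  | single n p hp =>
    intro m
    rw [Finsupp.single_apply]
    split_ifs
    · show |((p : ℚ) : ℝ)| ≤ 1
      exact_mod_cast hp
    · simp
  | wt j d F hd hF hs ih =>
    intro n
    have h1 : |((∑ l ∈ range d, F l) n : ℝ)| ≤ 1 := by
      by_cases hx : ∃ l < d, F l n ≠ 0
      · obtain ⟨l, hl, h1⟩ := hx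
        rw [Finsupp.finsetSum_apply, sum_eq_single_of_mem l (mem_range.mpr hl)]
        · exact ih l hl n
        · intro l' hl' hne
          by_contra h2
          rcases lt_or_gt_of_ne hne with h3 | h3
          · exact lt_irrefl _ (hs l' l h3 hl n (by simpa using h2) n (by simpa using h1))
          · exact lt_irrefl _ (hs l l' h3 (mem_range.mp hl') n (by simpa using h1) n
              (by simpa using h2))
      · push Not at hx
        rw [Finsupp.finsetSum_apply, sum_eq_zero (fun l hl => hx l (mem_range.mp hl))]
        simp
    simp only [Finsupp.smul_apply, smul_eq_mul]
    push_cast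
    rw [abs_mul, abs_of_nonneg (by positivity)]
    have := mm_pos j
    have h2 : (0:ℝ) ≤ 1 / mm j := by positivity
    simpa using mul_le_mul_of_nonneg_left h1 h2
  | up j f h ih =>
    intro n
    refine (ih n).trans ?_
    have := mm_ge' j
    exact (div_le_one (by linarith)).mpr (by linarith)
  | t2 T α β hT hn ih =>
    intro n
    have key : ∀ w, |(T.pt w n : ℝ)| ≤ 1 / mm w := by
      intro w
      have hw : (0:ℝ) ≤ 1 / mm w := by have := mm_pos w; positivity
      simp only [T2.pt, Finsupp.smul_apply, smul_eq_mul]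
      push_cast
      rw [abs_mul]
      have hL : |(1 / T.L : ℝ)| ≤ 1 := by
        have : (1 : ℝ) ≤ T.L := by exact_mod_cast hT.hL
        rw [abs_of_nonneg (by positivity)]
        exact (div_le_one (by linarith)).mpr this
      suffices h : |((HJT.rs T.a T.b (∑ l ∈ T.ι, if T.lo l ≤ w ∧ w < T.hi l then
          T.c l • Nd (T.t l) w else 0) n : ℚ) : ℝ)| ≤ 1 / mm w by
        calc _ ≤ 1 * (1 / (mm w : ℝ)) := mul_le_mul hL h (abs_nonneg _) zero_le_one
          _ = _ := one_mul _
      rw [rs_apply]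
      split_ifs with h0
      · by_cases hx : ∃ l ∈ T.ι, T.lo l ≤ w ∧ w < T.hi l ∧ HasNode (T.t l) w
        · obtain ⟨l, hl, h1, h2, h3⟩ := hx
          rw [sum_eq_single_of_mem l hl]
          · rw [if_pos ⟨h1, h2⟩]
            obtain ⟨b, r, hb, rfl⟩ := h3
            rw [Nd_eq hb]
            simp only [Finsupp.smul_apply, smul_eq_mul]
            push_cast
            rw [abs_mul]
            calc _ ≤ 1 * (1 / (mm (sg r) : ℝ)) :=
                  mul_le_mul (by exact_mod_cast hT.hc l hl) (ih l hl b r hb n)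
                    (abs_nonneg _) zero_le_one
              _ = _ := one_mul _
          · intro l' hl' hne
            split_ifs with h4
            · rw [Nd_zero, smul_zero]
              intro h5
              exact hne (hT.disj l' hl' l hl w h5 h3 h4.1 h4.2 h1 h2)
            · rfl
        · push Not at hx
          rw [sum_eq_zero]
          · simpa using hw
          · intro l hl
            split_ifs with h4
            · rw [Nd_zero (hx l hl h4.1 h4.2), smul_zero]
            · rfl
      · simpa using hw
    unfold T2.fn
    rw [Finsupp.finsetSum_apply]
    push_cast
    calc |∑ w ∈ Ico α β, (T.pt w n : ℝ)| ≤ ∑ w ∈ Ico α β, |(T.pt w n : ℝ)| :=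
          abs_sum_le_sum_abs _ _
      _ ≤ ∑ w ∈ Ico α β, 1 / (mm w : ℝ) := sum_le_sum fun w _ => key w
      _ ≤ 2 / mm α := sum_inv_mm _ _
      _ ≤ 1 := by
        have := mm_ge' α
        exact (div_le_one (by linarith)).mpr (by linarith)

end HJT

namespace HJT
open Finset

/-! The space of finitely supported vectors -/

abbrev V := ℕ →₀ ℝ

def ev (f : Fn) : V →ₗ[ℝ] ℝ := Finsupp.linearCombination ℝ (fun n => (f n : ℝ))

lemma ev_apply (f : Fn) (x : V) : ev f x = ∑ n ∈ x.support, x n * f n := rfl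

lemma ev_eq_sum (f : Fn) (x : V) {s : Finset ℕ} (h : x.support ⊆ s) :
    ev f x = ∑ n ∈ s, x n * f n := by
  rw [ev_apply]
  exact sum_subset h fun n _ hn => by simp [Finsupp.notMem_support_iff.mp hn]

lemma ev_add (f g : Fn) (x : V) : ev (f + g) x = ev f x + ev g x := by
  simp only [ev_apply, ← sum_add_distrib, Finsupp.add_apply]
  exact sum_congr rfl fun n _ => by push_cast; ring

lemma ev_smul (q : ℚ) (f : Fn) (x : V) : ev (q • f) x = q * ev f x := by
  simp only [ev_apply, mul_sum, Finsupp.smul_apply, smul_eq_mul]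
  exact sum_congr rfl fun n _ => by push_cast; ring

lemma ev_zero (x : V) : ev 0 x = 0 := by simp [ev_apply]

lemma ev_neg (f : Fn) (x : V) : ev (-f) x = - ev f x := by
  have := ev_smul (-1) f x
  simpa using this

lemma ev_sum {ι : Type*} (s : Finset ι) (F : ι → Fn) (x : V) :
    ev (∑ i ∈ s, F i) x = ∑ i ∈ s, ev (F i) x := by
  classical
  induction s using Finset.induction_on with
  | empty => simp [ev_zero]
  | insert i s hi ih => rw [sum_insert hi, sum_insert hi, ev_add, ih]

lemma ev_single (n : ℕ) (q : ℚ) (x : V) : ev (Finsupp.single n q) x = q * x n := by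
  classical
  rw [ev_eq_sum _ x (subset_insert n x.support), sum_eq_single_of_mem n (mem_insert_self _ _)]
  · simp [mul_comm]
  · intro m _ hm
    simp [Finsupp.single_apply, hm.symm]

lemma ev_rs (a b : ℕ) (f : Fn) (x : V) : ev (rs a b f) x = ev f (rs a b x) := by
  have h : (rs a b x).support ⊆ x.support := fun n hn => (rs_support hn).1
  rw [ev_apply, ev_eq_sum f _ h]
  refine sum_congr rfl fun n _ => ?_
  rw [rs_apply, rs_apply]; split_ifs <;> simp

/-- Supported in `[a,b)`. -/
def Sup {M : Type*} [Zero M] (a b : ℕ) (x : ℕ →₀ M) : Prop := ∀ n, x n ≠ 0 → a ≤ n ∧ n < b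

lemma Sup.mono {M : Type*} [Zero M] {a b a' b' : ℕ} {x : ℕ →₀ M} (h : Sup a b x)
    (ha : a' ≤ a) (hb : b ≤ b') : Sup a' b' x := fun n hn =>
  ⟨ha.trans (h n hn).1, (h n hn).2.trans_le hb⟩

lemma Sup_rs {M : Type*} [Zero M] (a b : ℕ) (x : ℕ →₀ M) : Sup a b (rs a b x) := by
  intro n hn
  rw [rs_apply] at hn
  by_contra h
  simp [h] at hn

lemma Sup.rs_eq {M : Type*} [Zero M] {a b a' b' : ℕ} {x : ℕ →₀ M} (h : Sup a b x)
    (ha : a' ≤ a) (hb : b ≤ b') : rs a' b' x = x := by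
  ext n; rw [rs_apply]
  split_ifs with h1
  · rfl
  · by_contra h2
    exact h1 ((h.mono ha hb) n (Ne.symm h2))

lemma Sup.rs_eq_zero {M : Type*} [Zero M] {a b a' b' : ℕ} {x : ℕ →₀ M} (h : Sup a b x)
    (h' : b ≤ a' ∨ b' ≤ a) : rs a' b' x = 0 := by
  ext n; rw [rs_apply]
  split_ifs with h1
  · by_contra h2
    have := h n h2
    omega
  · rfl

lemma Sup_zero {M : Type*} [Zero M] (a b : ℕ) : Sup a b (0 : ℕ →₀ M) := fun n hn => absurd rfl hn

lemma Sup.add {M : Type*} [AddCommGroup M] {a b : ℕ} {x y : ℕ →₀ M} (h : Sup a b x)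
    (h' : Sup a b y) : Sup a b (x + y) := by
  intro n hn
  by_contra h1
  have h2 : x n = 0 := by by_contra h2; exact h1 (h n h2)
  have h3 : y n = 0 := by by_contra h2; exact h1 (h' n h2)
  exact hn (by simp [h2, h3])

lemma Sup.neg {M : Type*} [AddCommGroup M] {a b : ℕ} {x : ℕ →₀ M} (h : Sup a b x) :
    Sup a b (-x) := fun n hn => h n (by simpa using hn)

lemma Sup.sub {M : Type*} [AddCommGroup M] {a b : ℕ} {x y : ℕ →₀ M} (h : Sup a b x)
    (h' : Sup a b y) : Sup a b (x - y) := by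
  rw [sub_eq_add_neg]; exact h.add h'.neg

lemma Sup.smul {R : Type*} [Ring R] {a b : ℕ} {x : ℕ →₀ R} (h : Sup a b x) (c : R) :
    Sup a b (c • x) := by
  intro n hn
  apply h n
  intro h1
  exact hn (by simp [h1])

lemma Sup.sum {M ι : Type*} [AddCommGroup M] {a b : ℕ} {s : Finset ι} {x : ι → ℕ →₀ M}
    (h : ∀ i ∈ s, Sup a b (x i)) : Sup a b (∑ i ∈ s, x i) := by
  classical
  induction s using Finset.induction_on with
  | empty => simpa using Sup_zero a b
  | insert i s hi ih =>
    rw [sum_insert hi]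
    exact (h i (mem_insert_self _ _)).add (ih fun j hj => h j (mem_insert_of_mem hj))

lemma exists_Sup {M : Type*} [Zero M] (x : ℕ →₀ M) : ∃ b, Sup 0 b x := by
  refine ⟨x.support.sup id + 1, fun n hn => ⟨Nat.zero_le _, ?_⟩⟩
  exact Nat.lt_succ_of_le (le_sup (f := id) (Finsupp.mem_support_iff.mpr hn))

lemma ev_Sup {a b : ℕ} {x : V} (h : Sup a b x) (f : Fn) : ev f x = ev (rs a b f) x := by
  rw [ev_rs, h.rs_eq le_rfl le_rfl]

lemma ev_disj {a b a' b' : ℕ} {x : V} {f : Fn} (h : Sup a b x) (h' : Sup a' b' f)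
    (hab : b ≤ a' ∨ b' ≤ a) : ev f x = 0 := by
  rw [ev_Sup h, h'.rs_eq_zero (by tauto), ev_zero]

def l1 (x : V) : ℝ := ∑ n ∈ x.support, |x n|

lemma l1_nonneg (x : V) : 0 ≤ l1 x := sum_nonneg fun _ _ => abs_nonneg _

lemma ev_le_l1 {o : Option ℕ} {f : Fn} {c : ℝ} (h : ∀ n, |(f n : ℝ)| ≤ c) (x : V) :
    |ev f x| ≤ c * l1 x := by
  rw [ev_apply, l1, mul_sum]
  refine (abs_sum_le_sum_abs _ _).trans (sum_le_sum fun n _ => ?_)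
  rw [abs_mul, mul_comm]
  exact mul_le_mul_of_nonneg_right (h n) (abs_nonneg _)

lemma KK_le_l1 {f : Fn} (h : KK f) (x : V) : |ev f x| ≤ l1 x := by
  have := ev_le_l1 (o := none) h.coord x
  simpa using this

lemma WW_le_l1 {f : Fn} {w : ℕ} (h : WW w f) (x : V) : |ev f x| ≤ l1 x / mm w := by
  have := ev_le_l1 (o := none) h.coord x
  simpa [div_eq_inv_mul] using this

lemma KK_zero : KK 0 := InK.up 0 _ (WW_zero 0)

def vn (x : V) : ℝ := ⨆ f : {f : Fn // KK f}, |ev f.1 x|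

lemma vn_bdd (x : V) : BddAbove (Set.range fun f : {f : Fn // KK f} => |ev f.1 x|) :=
  ⟨l1 x, by rintro _ ⟨f, rfl⟩; exact KK_le_l1 f.2 x⟩

lemma le_vn {f : Fn} (h : KK f) (x : V) : |ev f x| ≤ vn x :=
  le_ciSup (vn_bdd x) (⟨f, h⟩ : {f : Fn // KK f})

instance : Nonempty {f : Fn // KK f} := ⟨⟨0, KK_zero⟩⟩

lemma vn_le {x : V} {C : ℝ} (h : ∀ f, KK f → |ev f x| ≤ C) : vn x ≤ C :=
  ciSup_le fun f => h f.1 f.2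

lemma coord_le_vn (x : V) (n : ℕ) : |x n| ≤ vn x := by
  have := le_vn (InK.single n 1 (by simp)) x
  rwa [ev_single, Rat.cast_one, one_mul] at this

def vnorm : AddGroupNorm V where
  toFun := vn
  map_zero' := le_antisymm (vn_le fun f _ => by simp)
    ((abs_nonneg _).trans (le_vn KK_zero 0))
  add_le' x y := vn_le fun f hf => by
    rw [map_add]
    exact (abs_add_le _ _).trans (add_le_add (le_vn hf x) (le_vn hf y))
  neg' x := by unfold vn; simp
  eq_zero_of_map_eq_zero' x hx := by
    ext n
    have := coord_le_vn x n
    have h2 : vn x = 0 := hx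
    rw [h2] at this
    simpa using abs_nonpos_iff.mp this

instance instNV : NormedAddCommGroup V := vnorm.toNormedAddCommGroup

lemma norm_def (x : V) : ‖x‖ = vn x := rfl

instance instNSV : NormedSpace ℝ V where
  norm_smul_le c x := by
    rw [norm_def, norm_def]
    refine vn_le fun f hf => ?_
    rw [map_smul, smul_eq_mul, abs_mul]
    exact mul_le_mul_of_nonneg_left (le_vn hf x) (abs_nonneg _)

lemma ev_le {f : Fn} (h : KK f) (x : V) : |ev f x| ≤ ‖x‖ := le_vn h x
lemma norm_le_of {x : V} {C : ℝ} (h : ∀ f, KK f → |ev f x| ≤ C) : ‖x‖ ≤ C := vn_le h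
lemma coord_le (x : V) (n : ℕ) : |x n| ≤ ‖x‖ := coord_le_vn x n
lemma norm_le_l1 (x : V) : ‖x‖ ≤ l1 x := norm_le_of fun f hf => KK_le_l1 hf x

lemma exists_norming (x : V) {c : ℝ} (hc : c < ‖x‖) : ∃ f, KK f ∧ c < ev f x := by
  by_contra h
  push Not at h
  have : ‖x‖ ≤ c := norm_le_of fun f hf => by
    rw [abs_le]
    refine ⟨?_, h f hf⟩
    have := h _ hf.neg
    rw [ev_neg] at this
    linarith
  linarith

lemma norm_rs_le (a b : ℕ) (x : V) : ‖rs a b x‖ ≤ ‖x‖ :=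
  norm_le_of fun f hf => by rw [← ev_rs]; exact ev_le (hf.rs a b) x

/-- norming functional with same support -/
lemma exists_norming' {a b : ℕ} {x : V} (hx : Sup a b x) {c : ℝ} (hc : c < ‖x‖) :
    ∃ f, KK f ∧ Sup a b f ∧ c < ev f x := by
  obtain ⟨f, hf, h⟩ := exists_norming x hc
  exact ⟨rs a b f, hf.rs a b, Sup_rs _ _ _, by rwa [← ev_Sup hx]⟩

/-- block sequences -/
structure Blk (R : ℕ → ℕ) (z : ℕ → V) : Prop where
  mono : Monotone R
  sup : ∀ i, Sup (R i) (R (i + 1)) (z i)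

lemma Blk.sub {R : ℕ → ℕ} {z : ℕ → V} (h : Blk R z) {φ : ℕ → ℕ} (hφ : StrictMono φ) :
    Blk (R ∘ φ) (z ∘ φ) :=
  ⟨h.mono.comp hφ.monotone, fun i => (h.sup (φ i)).mono le_rfl
    (h.mono (hφ (Nat.lt_succ_self i)))⟩

lemma Blk.lt {R : ℕ → ℕ} {z : ℕ → V} (h : Blk R z) {i j n m : ℕ} (hij : i < j)
    (hn : z i n ≠ 0) (hm : z j m ≠ 0) : n < m :=
  ((h.sup i n hn).2.trans_le (h.mono hij)).trans_le (h.sup j m hm).1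

lemma Blk.sum_sup {R : ℕ → ℕ} {z : ℕ → V} (h : Blk R z) (p q : ℕ) :
    Sup (R p) (R q) (∑ i ∈ Ico p q, z i) :=
  Sup.sum fun i hi => (h.sup i).mono (h.mono (mem_Ico.mp hi).1) (h.mono (mem_Ico.mp hi).2)

lemma Blk.smul {R : ℕ → ℕ} {z : ℕ → V} (h : Blk R z) (a : ℕ → ℝ) :
    Blk R (fun i => a i • z i) := ⟨h.mono, fun i => (h.sup i).smul _⟩

/-! The completion -/

abbrev XX := UniformSpace.Completion V

def jj : V →ₗᵢ[ℝ] XX := UniformSpace.Completion.toComplₗᵢ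

lemma jj_dense : DenseRange (jj : V → XX) := UniformSpace.Completion.denseRange_coe

lemma jj_ui : IsUniformInducing (jj : V → XX) := UniformSpace.Completion.isUniformInducing_coe V

lemma ev_bdd (f : Fn) (x : V) : |ev f x| ≤ (∑ n ∈ f.support, |(f n : ℝ)|) * ‖x‖ := by
  have h1 : f = ∑ n ∈ f.support, Finsupp.single n (f n) := (Finsupp.sum_single f).symm
  conv_lhs => rw [h1, ev_sum]
  rw [sum_mul]
  refine (abs_sum_le_sum_abs _ _).trans (sum_le_sum fun n _ => ?_)
  rw [ev_single, abs_mul]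
  exact mul_le_mul_of_nonneg_left (coord_le x n) (abs_nonneg _)

def evL (f : Fn) : V →L[ℝ] ℝ := (ev f).mkContinuous _ (ev_bdd f)

def evX (f : Fn) : XX →L[ℝ] ℝ := (evL f).extend jj.toContinuousLinearMap

lemma evX_jj (f : Fn) (x : V) : evX f (jj x) = ev f x :=
  (evL f).extend_eq (e := jj.toContinuousLinearMap) jj_dense jj_ui x

lemma evX_le {f : Fn} (h : KK f) (x : XX) : |evX f x| ≤ ‖x‖ := by
  refine jj_dense.induction_on (p := fun x => |evX f x| ≤ ‖x‖) x ?_ ?_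
  · exact isClosed_le (by fun_prop) (by fun_prop)
  · intro x; rw [evX_jj, jj.norm_map]; exact ev_le h x

def rsLin (a b : ℕ) : V →ₗ[ℝ] V where
  toFun := rs a b
  map_add' := rs_add a b
  map_smul' c x := rs_smul a b c x

def rsL (a b : ℕ) : V →L[ℝ] V := (rsLin a b).mkContinuous 1 fun x => by
  rw [one_mul]; exact norm_rs_le a b x

def prX (a b : ℕ) : XX →L[ℝ] XX :=
  (jj.toContinuousLinearMap.comp (rsL a b)).extend jj.toContinuousLinearMap

lemma prX_jj (a b : ℕ) (x : V) : prX a b (jj x) = jj (rs a b x) :=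
  (jj.toContinuousLinearMap.comp (rsL a b)).extend_eq (e := jj.toContinuousLinearMap)
    jj_dense jj_ui x

lemma prX_le (a b : ℕ) (x : XX) : ‖prX a b x‖ ≤ ‖x‖ := by
  refine jj_dense.induction_on (p := fun x => ‖prX a b x‖ ≤ ‖x‖) x ?_ ?_
  · exact isClosed_le (by fun_prop) (by fun_prop)
  · intro x; rw [prX_jj, jj.norm_map, jj.norm_map]; exact norm_rs_le a b x

def cX (n : ℕ) : XX →L[ℝ] ℝ := evX (Finsupp.single n 1)

lemma cX_jj (n : ℕ) (x : V) : cX n (jj x) = x n := by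
  unfold cX; rw [evX_jj, ev_single]; simp

lemma cX_le (n : ℕ) (x : XX) : |cX n x| ≤ ‖x‖ := evX_le (InK.single n 1 (by simp)) x

/-- truncation as a finitely supported vector -/
def tr (a b : ℕ) (x : XX) : V := ∑ n ∈ Ico a b, Finsupp.single n (cX n x)

lemma tr_apply (a b : ℕ) (x : XX) (n : ℕ) : tr a b x n = if a ≤ n ∧ n < b then cX n x else 0 := by
  unfold tr
  rw [Finsupp.finsetSum_apply]
  split_ifs with h
  · rw [sum_eq_single_of_mem n (mem_Ico.mpr h)]
    · simp
    · intro m _ hm; simp [Finsupp.single_apply, hm]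
  · refine sum_eq_zero fun m hm => ?_
    rw [Finsupp.single_apply, if_neg]
    rintro rfl
    exact h (mem_Ico.mp hm)

lemma tr_Sup (a b : ℕ) (x : XX) : Sup a b (tr a b x) := by
  intro n hn
  rw [tr_apply] at hn
  by_contra h
  simp [h] at hn

lemma tr_jj (a b : ℕ) (x : V) : tr a b (jj x) = rs a b x := by
  ext n; rw [tr_apply, rs_apply, cX_jj]

lemma jj_tr (a b : ℕ) (x : XX) : jj (tr a b x) = prX a b x := by
  refine jj_dense.induction_on (p := fun x => jj (tr a b x) = prX a b x) x ?_ ?_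
  · refine isClosed_eq ?_ (by fun_prop)
    have : (fun x => jj (tr a b x)) = fun x => ∑ n ∈ Ico a b, (cX n x) • jj (Finsupp.single n 1) := by
      funext x
      unfold tr
      rw [map_sum]
      refine sum_congr rfl fun n _ => ?_
      rw [← map_smul, Finsupp.smul_single, smul_eq_mul, mul_one]
    rw [this]
    fun_prop
  · intro x; rw [tr_jj, prX_jj]

lemma norm_tr_le (a b : ℕ) (x : XX) : ‖tr a b x‖ ≤ ‖x‖ := by
  rw [← jj.norm_map, jj_tr]; exact prX_le a b x

lemma tr_tendsto (x : XX) : Filter.Tendsto (fun n => jj (tr 0 n x)) Filter.atTop (nhds x) := by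
  rw [Metric.tendsto_atTop]
  intro ε hε
  obtain ⟨_, ⟨v, rfl⟩, hv⟩ := Metric.mem_closure_iff.mp (jj_dense x) (ε / 2) (by linarith)
  obtain ⟨b, hb⟩ := exists_Sup v
  refine ⟨b, fun n hn => ?_⟩
  rw [jj_tr, dist_eq_norm]
  have h1 : prX 0 n (jj v) = jj v := by rw [prX_jj, hb.rs_eq le_rfl hn]
  have h2 : prX 0 n x - x = prX 0 n (x - jj v) - (x - jj v) := by rw [map_sub, h1]; abel
  rw [h2]
  have h3 := prX_le 0 n (x - jj v)
  have h4 := norm_sub_le (prX 0 n (x - jj v)) (x - jj v)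
  rw [dist_eq_norm] at hv
  linarith

lemma eq_zero_of_cX {x : XX} (h : ∀ n, cX n x = 0) : x = 0 := by
  have h1 : ∀ n, jj (tr 0 n x) = 0 := by
    intro n
    have : tr 0 n x = 0 := by ext m; rw [tr_apply, h m]; simp
    rw [this, map_zero]
  have := tr_tendsto x
  simp only [h1] at this
  exact (tendsto_nhds_unique this tendsto_const_nhds)

instance : TopologicalSpace.SeparableSpace V := by
  let D : Set V := Set.range fun q : ℕ →₀ ℚ => q.mapRange (fun r : ℚ => (r : ℝ)) (by simp)
  refine ⟨⟨D, Set.countable_range _, ?_⟩⟩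
  intro x
  rw [Metric.mem_closure_iff]
  intro ε hε
  set s := x.support with hs
  have hc : (0:ℝ) < s.card + 1 := by positivity
  have : ∀ n, ∃ q : ℚ, |x n - q| < ε / (s.card + 1) := fun n => by
    obtain ⟨q, h1, h2⟩ := exists_rat_btwn (show x n - ε / (s.card + 1) < x n by
      have : 0 < ε / (s.card + 1) := by positivity
      linarith)
    exact ⟨q, by rw [abs_of_pos (by linarith)]; linarith⟩
  choose q hq using this
  let f : ℕ →₀ ℚ := ∑ n ∈ s, Finsupp.single n (q n)
  refine ⟨_, ⟨f, rfl⟩, ?_⟩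
  rw [dist_eq_norm]
  have hf : ∀ n, f n = if n ∈ s then q n else 0 := by
    intro n
    simp only [f, Finsupp.finsetSum_apply, Finsupp.single_apply]
    rw [sum_ite_eq' s n]
  set y := x - f.mapRange (fun r : ℚ => (r : ℝ)) (by simp) with hy
  have hyn : ∀ n, y n = if n ∈ s then x n - q n else 0 := by
    intro n
    simp only [hy, Finsupp.sub_apply, Finsupp.mapRange_apply, hf]
    split_ifs with h
    · rfl
    · simp [Finsupp.notMem_support_iff.mp h]
  have hys : y.support ⊆ s := by
    intro n hn
    rw [Finsupp.mem_support_iff, hyn] at hn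
    by_contra h
    simp [h] at hn
  have : l1 y ≤ ∑ n ∈ s, ε / (s.card + 1) := by
    unfold l1
    refine (sum_le_sum_of_subset_of_nonneg hys fun _ _ _ => abs_nonneg _).trans
      (sum_le_sum fun n hn => ?_)
    rw [hyn, if_pos hn]; exact (hq n).le
  have h2 : ∑ n ∈ s, ε / (s.card + 1 : ℝ) < ε := by
    rw [sum_const, nsmul_eq_mul, mul_div_assoc', div_lt_iff₀ hc]
    nlinarith
  linarith [norm_le_l1 y]

instance : TopologicalSpace.SeparableSpace XX := inferInstance

lemma XX_infdim : ¬ FiniteDimensional ℝ XX := by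
  intro h
  have h1 : LinearIndependent ℝ fun n : ℕ => jj (Finsupp.single n (1:ℝ)) := by
    have := (Finsupp.basisSingleOne (R := ℝ) (ι := ℕ)).linearIndependent
    have := this.map' jj.toLinearMap (LinearMap.ker_eq_bot.mpr jj.injective)
    simpa [Function.comp_def] using this
  have := h1.finite
  exact not_finite ℕ

end HJT

namespace HJT
open Finset

lemma staircase : ∀ (d : ℕ) (A : ℕ → Finset ℕ) (p q : ℕ), p ≤ q →
    (∀ l < d, A l ⊆ Ico p q) →
    (∀ l l', l < l' → l' < d → ∀ i ∈ A l, ∀ i' ∈ A l', i ≤ i') →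
    ∃ P Q : ℕ → ℕ, (∀ l < d, A l ⊆ Ico (P l) (Q l) ∧ p ≤ P l ∧ P l ≤ Q l ∧ Q l ≤ q) ∧
      ∑ l ∈ range d, (Q l - P l) ≤ (q - p) + d := by
  intro d
  induction d with
  | zero => intro A p q _ _ _; exact ⟨fun _ => 0, fun _ => 0, by simp, by simp⟩
  | succ d ih =>
    intro A p q hpq hA hm
    rcases (A d).eq_empty_or_nonempty with he | hne
    · obtain ⟨P, Q, h1, h2⟩ := ih A p q hpq (fun l hl => hA l (by omega))
        (fun l l' h h' => hm l l' h (by omega))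
      refine ⟨Function.update P d p, Function.update Q d p, ?_, ?_⟩
      · intro l hl
        rcases Nat.lt_succ_iff_lt_or_eq.mp hl with h | rfl
        · rw [Function.update_of_ne h.ne, Function.update_of_ne h.ne]; exact h1 l h
        · simp [he, hpq]
      · rw [sum_range_succ]
        have : ∑ l ∈ range d, (Function.update Q d p l - Function.update P d p l)
            = ∑ l ∈ range d, (Q l - P l) := sum_congr rfl fun l hl => by
          have := (mem_range.mp hl).ne
          rw [Function.update_of_ne this, Function.update_of_ne this]
        rw [this]; simp; omega
    · set m := (A d).min' hne with hmdef
      have hmm : m ∈ A d := min'_mem _ _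
      have hmI := mem_Ico.mp (hA d (by omega) hmm)
      obtain ⟨P, Q, h1, h2⟩ := ih A p (m + 1) (by omega)
        (fun l hl i hi => mem_Ico.mpr ⟨(mem_Ico.mp (hA l (by omega) hi)).1,
          Nat.lt_succ_of_le (hm l d hl (by omega) i hi m hmm)⟩)
        (fun l l' h h' => hm l l' h (by omega))
      refine ⟨Function.update P d m, Function.update Q d q, ?_, ?_⟩
      · intro l hl
        rcases Nat.lt_succ_iff_lt_or_eq.mp hl with h | rfl
        · rw [Function.update_of_ne h.ne, Function.update_of_ne h.ne]
          obtain ⟨a, b, c, e⟩ := h1 l h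
          exact ⟨a, b, c, by omega⟩
        · simp only [Function.update_self]
          refine ⟨fun i hi => mem_Ico.mpr ⟨min'_le _ _ hi, (mem_Ico.mp (hA l (by omega) hi)).2⟩,
            hmI.1, hmI.2.le, le_rfl⟩
      · rw [sum_range_succ]
        have : ∑ l ∈ range d, (Function.update Q d q l - Function.update P d m l)
            = ∑ l ∈ range d, (Q l - P l) := sum_congr rfl fun l hl => by
          have := (mem_range.mp hl).ne
          rw [Function.update_of_ne this, Function.update_of_ne this]
        rw [this]; simp only [Function.update_self]; omega

def SS (z : ℕ → V) (ε N : ℝ) : Prop :=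
  ∀ g, KK g → ∀ p q : ℕ, |ev g (∑ i ∈ Ico p q, z i)| ≤ ε * ((q - p : ℕ) : ℝ) + N

/-- The `W`-lemma. -/
lemma Wbound {R : ℕ → ℕ} {z : ℕ → V} (hz : Blk R z) {ε N : ℝ} (hε : 0 ≤ ε) (hN : 0 ≤ N)
    (h : SS z ε N) {w : ℕ} {f : Fn} (hf : WW w f) (p q : ℕ) :
    |ev f (∑ i ∈ Ico p q, z i)| ≤ (1 / mm w) * (ε * ((q - p : ℕ) + nn w) + nn w * N) := by
  have hw := mm_pos w
  rcases le_total q p with hqp | hpq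
  · rw [Ico_eq_empty_of_le hqp]; simp; positivity
  cases hf with
  | wt _ d F hd hF hs =>
  classical
  rw [ev_smul, abs_mul, ev_sum]
  push_cast
  rw [abs_of_nonneg (by positivity)]
  refine mul_le_mul_of_nonneg_left ?_ (by positivity)
  let A : ℕ → Finset ℕ := fun l => (Ico p q).filter fun i => ev (F l) (z i) ≠ 0
  have hitem : ∀ l i, ev (F l) (z i) ≠ 0 → ∃ n, F l n ≠ 0 ∧ z i n ≠ 0 := by
    intro l i hne
    by_contra hcon
    push Not at hcon
    apply hne
    rw [ev_apply]
    refine sum_eq_zero fun n hn => ?_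
    by_cases h0 : F l n = 0
    · simp [h0]
    · simp [hcon n h0]
  obtain ⟨P, Q, hPQ, hsum⟩ := staircase d A p q hpq (fun l _ => filter_subset _ _) (by
    intro l l' hll hl' i hi i' hi'
    by_contra hlt
    push Not at hlt
    obtain ⟨n, hn1, hn2⟩ := hitem l i (mem_filter.mp hi).2
    obtain ⟨n', hn1', hn2'⟩ := hitem l' i' (mem_filter.mp hi').2
    have h1 := hz.lt hlt hn2' hn2
    have h2 := hs l l' hll hl' n (by simpa using hn1) n' (by simpa using hn1')
    omega)
  have hl : ∀ l ∈ range d, |ev (F l) (∑ i ∈ Ico p q, z i)| ≤ ε * ((Q l - P l : ℕ) : ℝ) + N := by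
    intro l hl
    obtain ⟨h1, h2, h3, h4⟩ := hPQ l (mem_range.mp hl)
    have : ev (F l) (∑ i ∈ Ico p q, z i) = ev (F l) (∑ i ∈ Ico (P l) (Q l), z i) := by
      rw [map_sum, map_sum]
      symm
      refine sum_subset (Ico_subset_Ico h2 h4) fun i hi hni => ?_
      by_contra hne
      exact hni (h1 (mem_filter.mpr ⟨hi, hne⟩))
    rw [this]
    exact h _ (hF l (mem_range.mp hl)) _ _
  have hdn : (d : ℝ) ≤ nn w := by exact_mod_cast hd
  calc |∑ l ∈ range d, ev (F l) (∑ i ∈ Ico p q, z i)|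
      ≤ ∑ l ∈ range d, (ε * ((Q l - P l : ℕ) : ℝ) + N) :=
        (abs_sum_le_sum_abs _ _).trans (sum_le_sum hl)
    _ = ε * ((∑ l ∈ range d, (Q l - P l) : ℕ) : ℝ) + d * N := by
        rw [sum_add_distrib, ← mul_sum]; simp
    _ ≤ ε * (((q - p) + d : ℕ) : ℝ) + d * N := by
        have : ((∑ l ∈ range d, (Q l - P l) : ℕ) : ℝ) ≤ (((q - p) + d : ℕ) : ℝ) := by
          exact_mod_cast hsum
        have := mul_le_mul_of_nonneg_left this hε
        linarith
    _ ≤ ε * ((q - p : ℕ) + nn w) + nn w * N := by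
        push_cast
        have := mul_le_mul_of_nonneg_right hdn hN
        have := mul_le_mul_of_nonneg_left hdn hε
        linarith

/-- restrict weight window of type II data -/
def T2.win (T : T2) (α β : ℕ) : T2 :=
  { T with lo := fun l => max (T.lo l) α, hi := fun l => min (T.hi l) β }

lemma T2.win_pt (T : T2) (α β w : ℕ) :
    (T.win α β).pt w = if α ≤ w ∧ w < β then T.pt w else 0 := by
  unfold T2.pt
  split_ifs with h
  · congr 2
    refine sum_congr rfl fun l _ => ?_
    by_cases h1 : T.lo l ≤ w ∧ w < T.hi l
    · rw [if_pos h1]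
      exact if_pos ⟨max_le h1.1 h.1, lt_min h1.2 h.2⟩
    · rw [if_neg h1]
      exact if_neg fun h2 => h1 ⟨(le_max_left _ _).trans h2.1, h2.2.trans_le (min_le_left _ _)⟩
  · rw [sum_eq_zero, rs_zero, smul_zero]
    intro l _
    exact if_neg fun h2 => h ⟨(le_max_right _ _).trans h2.1, h2.2.trans_le (min_le_right _ _)⟩

lemma T2.Val.win {T : T2} (h : T.Val) (α β : ℕ) : (T.win α β).Val :=
  ⟨⟨h.hL, h.card, h.hc, fun l hl => (h.hlo l hl).trans (le_max_left _ _),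
    fun l hl l' hl' w h1 h2 h3 h4 h5 h6 => h.disj l hl l' hl' w h1 h2
      ((le_max_left _ _).trans h3) (h4.trans_le (min_le_left _ _))
      ((le_max_left _ _).trans h5) (h6.trans_le (min_le_left _ _))⟩, h.hn⟩

lemma T2.win_fn (T : T2) (α β : ℕ) {B : ℕ} (hB : β ≤ B) : (T.win α β).fn 0 B = T.fn α β := by
  unfold T2.fn
  rw [sum_congr rfl fun w _ => T.win_pt α β w, ← sum_filter]
  refine sum_congr ?_ fun _ _ => rfl
  ext w; simp only [mem_filter, mem_Ico]; omega

lemma ev_fn (T : T2) (α β : ℕ) (x : V) : ev (T.fn α β) x = ∑ w ∈ Ico α β, ev (T.pt w) x := by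
  unfold T2.fn; rw [ev_sum]

lemma card_filter_le_one_sum {s : Finset ℕ} {p : ℕ → Prop} [DecidablePred p] {C : ℝ} (hC : 0 ≤ C)
    (h : ∀ i ∈ s, ∀ j ∈ s, p i → p j → i = j) : ∑ i ∈ s, (if p i then C else 0) ≤ C := by
  rw [← sum_filter, sum_const, nsmul_eq_mul]
  have : (s.filter p).card ≤ 1 := card_le_one.mpr fun a ha b hb =>
    h a (mem_filter.mp ha).1 b (mem_filter.mp hb).1 (mem_filter.mp ha).2 (mem_filter.mp hb).2
  have : ((s.filter p).card : ℝ) ≤ 1 := by exact_mod_cast this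
  nlinarith

structure BL (R : ℕ → ℕ) (z : ℕ → V) (lo hi : ℕ → ℕ) (τ : ℕ → ℝ) (C S : ℝ) : Prop where
  blk : Blk R z
  hC : 0 ≤ C
  hS : 0 ≤ S
  nz : ∀ i, ‖z i‖ ≤ C
  lohi : ∀ i, lo i ≤ hi i
  hilo : ∀ i j, i < j → hi i ≤ lo j
  h4 : ∀ i w f, WW w f → w < lo i → |ev f (z i)| ≤ C / mm w
  h5 : ∀ i w f, WW w f → hi i ≤ w → |ev f (z i)| ≤ τ i
  h6 : ∀ i (T : T2), T.Val → ∀ β, |ev (T.fn (hi i) β) (z i)| ≤ τ i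
  hτ : ∀ i, 0 ≤ τ i
  sumτ : ∀ s : Finset ℕ, ∑ i ∈ s, τ i ≤ S

def Matched (z : ℕ → V) (lo hi : ℕ → ℕ) (ε M : ℝ) : Prop :=
  ∀ T : T2, T.Val → ∀ p q : ℕ,
    |∑ i ∈ Ico p q, ev (T.fn (lo i) (hi i)) (z i)| ≤ ε * ((q - p : ℕ) : ℝ) + M

namespace BL
variable {R : ℕ → ℕ} {z : ℕ → V} {lo hi : ℕ → ℕ} {τ : ℕ → ℝ} {C S : ℝ}

lemma lo_mono (H : BL R z lo hi τ C S) : Monotone lo := fun i j h => by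
  rcases h.eq_or_lt with rfl | h
  · exact le_rfl
  · exact (H.lohi i).trans (H.hilo i j h)

lemma triv (H : BL R z lo hi τ C S) : SS z C 0 := by
  intro g hg p q
  rw [map_sum]
  refine (abs_sum_le_sum_abs _ _).trans ?_
  refine (sum_le_sum fun i _ => (ev_le hg (z i)).trans (H.nz i)).trans ?_
  simp [mul_comm]

lemma Whigh (H : BL R z lo hi τ C S) {w : ℕ} {f : Fn} (hf : WW w f) (p q : ℕ) :
    |ev f (∑ i ∈ Ico p q, z i)| ≤ C / mm w * ((q - p : ℕ) : ℝ) + S + C := by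
  classical
  have hw := mm_pos w
  have hCw : 0 ≤ C / mm w := div_nonneg H.hC hw.le
  rw [map_sum]
  refine (abs_sum_le_sum_abs _ _).trans ?_
  have : ∀ i ∈ Ico p q, |ev f (z i)| ≤ C / mm w + τ i + if lo i ≤ w ∧ w < hi i then C else 0 := by
    intro i _
    have h1 := H.hτ i
    split_ifs with h
    · have := (ev_le (InK.up w f hf) (z i)).trans (H.nz i)
      linarith
    · rcases lt_or_ge w (lo i) with h2 | h2
      · have := H.h4 i w f hf h2; linarith
      · have := H.h5 i w f hf (by omega); linarith
  refine (sum_le_sum this).trans ?_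
  rw [sum_add_distrib, sum_add_distrib]
  have h2 := H.sumτ (Ico p q)
  have h3 := card_filter_le_one_sum (s := Ico p q) (p := fun i => lo i ≤ w ∧ w < hi i) H.hC (by
    intro i _ j _ hi hj
    by_contra hne
    rcases lt_or_gt_of_ne hne with h | h
    · have := H.hilo i j h; omega
    · have := H.hilo j i h; omega)
  simp only [sum_const, Nat.card_Ico, nsmul_eq_mul]
  linarith

/-- splitting type II functionals -/
lemma t2split (H : BL R z lo hi τ C S) {T : T2} (hT : T.Val) {ε M : ℝ} (hM : Matched z lo hi ε M)
    (α β p q : ℕ) :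
    ∃ T' : T2, T'.Val ∧ (∀ w, T'.pt w = if α ≤ w ∧ w < β then T.pt w else 0) ∧
    |ev (T.fn α β) (∑ i ∈ Ico p q, z i)| ≤
      |∑ i ∈ Ico p q, ∑ w ∈ Ico 0 (lo i), ev (T'.pt w) (z i)| + ε * ((q - p : ℕ) : ℝ) + M + S := by
  refine ⟨T.win α β, hT.win α β, T.win_pt α β, ?_⟩
  set T' := T.win α β with hT'
  have hV : T'.Val := hT.win α β
  set B := β + ∑ i ∈ Ico p q, hi i with hB
  have e1 : T.fn α β = T'.fn 0 B := (T.win_fn α β (by omega)).symm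
  have e2 : ev (T.fn α β) (∑ i ∈ Ico p q, z i) =
      ∑ i ∈ Ico p q, ∑ w ∈ Ico 0 (lo i), ev (T'.pt w) (z i) +
      ∑ i ∈ Ico p q, ev (T'.fn (lo i) (hi i)) (z i) +
      ∑ i ∈ Ico p q, ev (T'.fn (hi i) B) (z i) := by
    rw [map_sum, ← sum_add_distrib, ← sum_add_distrib]
    refine sum_congr rfl fun i hi' => ?_
    have h1 : hi i ≤ B := by
      have := single_le_sum (f := hi) (fun _ _ => Nat.zero_le _) hi'
      omega
    rw [e1, T'.fn_split (Nat.zero_le (lo i)) ((H.lohi i).trans h1), T'.fn_split (H.lohi i) h1,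
      ev_add, ev_add, ev_fn T' 0]
    ring
  rw [e2]
  have h3 := hM T' hV p q
  have h4 : |∑ i ∈ Ico p q, ev (T'.fn (hi i) B) (z i)| ≤ S :=
    (abs_sum_le_sum_abs _ _).trans ((sum_le_sum fun i _ => H.h6 i T' hV B).trans (H.sumτ _))
  have h5 := abs_add_le (∑ i ∈ Ico p q, ∑ w ∈ Ico 0 (lo i), ev (T'.pt w) (z i) +
      ∑ i ∈ Ico p q, ev (T'.fn (lo i) (hi i)) (z i)) (∑ i ∈ Ico p q, ev (T'.fn (hi i) B) (z i))
  have h6 := abs_add_le (∑ i ∈ Ico p q, ∑ w ∈ Ico 0 (lo i), ev (T'.pt w) (z i))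
      (∑ i ∈ Ico p q, ev (T'.fn (lo i) (hi i)) (z i))
  linarith

/-- low parts with weights at least `J` -/
lemma lowtail (H : BL R z lo hi τ C S) {T : T2} (hT : T.Val) (J i : ℕ) :
    |∑ w ∈ Ico J (lo i), ev (T.pt w) (z i)| ≤ 2 * C / mm J := by
  refine (abs_sum_le_sum_abs _ _).trans ?_
  calc ∑ w ∈ Ico J (lo i), |ev (T.pt w) (z i)| ≤ ∑ w ∈ Ico J (lo i), C * (1 / (mm w : ℝ)) :=
        sum_le_sum fun w hw => by
          have := H.h4 i w _ (hT.pt_mem w) (mem_Ico.mp hw).2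
          rwa [mul_one_div]
    _ = C * ∑ w ∈ Ico J (lo i), (1 / (mm w : ℝ)) := by rw [mul_sum]
    _ ≤ C * (2 / mm J) := mul_le_mul_of_nonneg_left (sum_inv_mm _ _) H.hC
    _ = _ := by ring

lemma sum_single_le (H : BL R z lo hi τ C S) (p q n : ℕ) :
    |(∑ i ∈ Ico p q, z i) n| ≤ C := by
  rw [Finsupp.finsetSum_apply]
  by_cases hx : ∃ i ∈ Ico p q, z i n ≠ 0
  · obtain ⟨i, hi, hn⟩ := hx
    rw [sum_eq_single_of_mem i hi]
    · exact (coord_le _ _).trans (H.nz i)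
    · intro j _ hne
      by_contra h
      rcases lt_or_gt_of_ne hne with h1 | h1
      · exact lt_irrefl _ (H.blk.lt h1 h hn)
      · exact lt_irrefl _ (H.blk.lt h1 hn h)
  · push Not at hx
    rw [sum_eq_zero hx]; simpa using H.hC

/-- Basic Lemma, one step. -/
lemma step (H : BL R z lo hi τ C S) {ε N M ns : ℝ} {J : ℕ} (hε : 0 ≤ ε) (hN : 0 ≤ N)
    (hM0 : 0 ≤ M) (h : SS z (4 * ε) N) (hM : Matched z lo hi (ε / 4) M)
    (hJ : 2 * C / mm J ≤ ε / 4) (hns : ∀ w < J, (nn w : ℝ) ≤ ns) (hns0 : 0 ≤ ns) :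
    SS z ε (ns * (4 * ε + N) + M + C + S) := by
  have hC := H.hC
  have hS := H.hS
  have hA : 0 ≤ ns * (4 * ε + N) := by positivity
  -- bound for low weights
  have lowW : ∀ w < J, ∀ f, WW w f → ∀ p q : ℕ, |ev f (∑ i ∈ Ico p q, z i)| ≤
      (1 / mm w) * (4 * ε * ((q - p : ℕ) : ℝ) + ns * (4 * ε + N)) := by
    intro w hw f hf p q
    refine (Wbound H.blk (by linarith) hN h hf p q).trans ?_
    have := mm_pos w
    refine mul_le_mul_of_nonneg_left ?_ (by positivity)
    have := mul_le_mul_of_nonneg_right (hns w hw) (show 0 ≤ 4 * ε + N by linarith)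
    linarith
  intro g hg p q
  have hk : (0:ℝ) ≤ ((q - p : ℕ) : ℝ) := Nat.cast_nonneg _
  have hεk : 0 ≤ ε * ((q - p : ℕ) : ℝ) := by positivity
  cases hg with
  | single n c hc =>
    rw [ev_single, abs_mul]
    have h1 := H.sum_single_le p q n
    have h2 : |(c : ℝ)| ≤ 1 := by exact_mod_cast hc
    have := mul_le_mul h2 h1 (abs_nonneg _) zero_le_one
    linarith
  | up w f hf =>
    rcases lt_or_ge w J with hw | hw
    · refine (lowW w hw g hf p q).trans ?_
      have h1 : (1 : ℝ) / mm w ≤ 1 / 4 :=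
        one_div_le_one_div_of_le (by norm_num) (by linarith [mm_ge' w])
      have h2 : 0 ≤ 4 * ε * ((q - p : ℕ) : ℝ) + ns * (4 * ε + N) := by positivity
      have := mul_le_mul_of_nonneg_right h1 h2
      linarith
    · refine (H.Whigh hf p q).trans ?_
      have h1 : C / mm w ≤ C / mm J := div_le_div_of_nonneg_left hC (mm_pos J) (mm_mono' hw)
      have h2 : C / mm J ≤ ε := by
        have : 2 * C / mm J = 2 * (C / mm J) := by ring
        have : 0 ≤ C / mm J := div_nonneg hC (mm_pos J).le
        linarith
      have := mul_le_mul_of_nonneg_right (h1.trans h2) hk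
      linarith
  | t2 T α β hT hn =>
    obtain ⟨T', hV, -, hb⟩ := H.t2split ⟨hT, hn⟩ hM α β p q
    refine hb.trans ?_
    have e1 : ∑ i ∈ Ico p q, ∑ w ∈ Ico 0 (lo i), ev (T'.pt w) (z i) =
        ∑ i ∈ Ico p q, ∑ w ∈ Ico J (lo i), ev (T'.pt w) (z i) +
        ∑ w ∈ Ico 0 J, ∑ i ∈ (Ico p q).filter (fun i => w < lo i), ev (T'.pt w) (z i) := by
      have : ∑ w ∈ Ico 0 J, ∑ i ∈ (Ico p q).filter (fun i => w < lo i), ev (T'.pt w) (z i)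
          = ∑ i ∈ Ico p q, ∑ w ∈ (Ico 0 J).filter (fun w => w < lo i), ev (T'.pt w) (z i) := by
        simp only [sum_filter]
        exact sum_comm
      rw [this, ← sum_add_distrib]
      refine sum_congr rfl fun i _ => ?_
      rcases le_total J (lo i) with h1 | h1
      · rw [← sum_Ico_consecutive _ (Nat.zero_le J) h1, add_comm]
        congr 1
        refine sum_congr ?_ fun _ _ => rfl
        ext w; simp only [mem_filter, mem_Ico]; omega
      · rw [Ico_eq_empty_of_le h1, sum_empty, zero_add]
        refine sum_congr ?_ fun _ _ => rfl
        ext w; simp only [mem_filter, mem_Ico]; omega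
    have b1 : |∑ i ∈ Ico p q, ∑ w ∈ Ico J (lo i), ev (T'.pt w) (z i)| ≤
        ε / 4 * ((q - p : ℕ) : ℝ) := by
      refine (abs_sum_le_sum_abs _ _).trans
        ((sum_le_sum fun i _ => (H.lowtail hV J i).trans hJ).trans ?_)
      simp [mul_comm]
    have b2 : ∀ w ∈ Ico 0 J,
        |∑ i ∈ (Ico p q).filter (fun i => w < lo i), ev (T'.pt w) (z i)| ≤
        (1 / mm w) * (4 * ε * ((q - p : ℕ) : ℝ) + ns * (4 * ε + N)) := by
      intro w hw
      have hw' := (mem_Ico.mp hw).2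
      -- the filter is an interval
      obtain ⟨p', hp'1, hp'⟩ : ∃ p', p ≤ p' ∧ (Ico p q).filter (fun i => w < lo i) = Ico p' q := by
        by_cases hx : ∃ i, p ≤ i ∧ w < lo i
        · classical
          refine ⟨Nat.find hx, (Nat.find_spec hx).1, ?_⟩
          ext i
          simp only [mem_filter, mem_Ico]
          constructor
          · rintro ⟨⟨h1, h2⟩, h3⟩
            exact ⟨Nat.find_min' hx ⟨h1, h3⟩, h2⟩
          · rintro ⟨h1, h2⟩
            exact ⟨⟨(Nat.find_spec hx).1.trans h1, h2⟩,
              (Nat.find_spec hx).2.trans_le (H.lo_mono h1)⟩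
        · push Not at hx
          refine ⟨max p q, le_max_left _ _, ?_⟩
          ext i
          simp only [mem_filter, mem_Ico]
          constructor
          · rintro ⟨⟨h1, h2⟩, h3⟩
            exact absurd h3 (not_lt.mpr (hx i h1))
          · rintro ⟨h1, h2⟩
            omega
      rw [hp', ← map_sum]
      refine (lowW w hw' _ (hV.pt_mem w) p' q).trans ?_
      have := mm_pos w
      refine mul_le_mul_of_nonneg_left ?_ (by positivity)
      have h1 : ((q - p' : ℕ) : ℝ) ≤ ((q - p : ℕ) : ℝ) := by
        exact_mod_cast (by omega : q - p' ≤ q - p)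
      have := mul_le_mul_of_nonneg_left h1 (show 0 ≤ 4 * ε by linarith)
      linarith
    have b3 : |∑ w ∈ Ico 0 J, ∑ i ∈ (Ico p q).filter (fun i => w < lo i), ev (T'.pt w) (z i)| ≤
        (1 / 8) * (4 * ε * ((q - p : ℕ) : ℝ) + ns * (4 * ε + N)) := by
      refine (abs_sum_le_sum_abs _ _).trans ((sum_le_sum b2).trans ?_)
      rw [← sum_mul]
      refine mul_le_mul_of_nonneg_right ((sum_inv_mm 0 J).trans ?_) (by positivity)
      have := mm_ge' 0
      rw [div_le_div_iff₀ (mm_pos 0) (by norm_num)]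
      linarith
    rw [e1]
    have b4 := abs_add_le (∑ i ∈ Ico p q, ∑ w ∈ Ico J (lo i), ev (T'.pt w) (z i))
      (∑ w ∈ Ico 0 J, ∑ i ∈ (Ico p q).filter (fun i => w < lo i), ev (T'.pt w) (z i))
    linarith

lemma exists_mm (H : BL R z lo hi τ C S) {ε : ℝ} (hε : 0 < ε) : ∃ J, 2 * C / mm J ≤ ε := by
  obtain ⟨J, hJ⟩ := exists_nat_gt (2 * C / ε)
  refine ⟨J, ?_⟩
  have : (J : ℝ) < mm J := by exact_mod_cast mm_gt J
  rw [div_le_iff₀ (mm_pos J)]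
  rw [div_lt_iff₀ hε] at hJ
  nlinarith

/-- averages tend to zero when everything can be matched -/
lemma small (H : BL R z lo hi τ C S) (hM : ∀ ε > 0, ∃ M, Matched z lo hi ε M) :
    ∀ ε > 0, ∃ N, 0 ≤ N ∧ SS z ε N := by
  have key : ∀ k : ℕ, ∃ N, 0 ≤ N ∧ SS z ((C + 1) / 4 ^ k) N := by
    intro k
    induction k with
    | zero =>
      refine ⟨0, le_rfl, fun g hg p q => (H.triv g hg p q).trans ?_⟩
      have : (0:ℝ) ≤ ((q - p : ℕ) : ℝ) := Nat.cast_nonneg _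
      simp; nlinarith
    | succ k ih =>
      obtain ⟨N, hN, hS⟩ := ih
      have hC := H.hC
      set ε := (C + 1) / 4 ^ (k + 1) with hε
      have hεp : 0 < ε := by positivity
      obtain ⟨M, hM⟩ := hM (ε / 4) (by linarith)
      obtain ⟨J, hJ⟩ := H.exists_mm (show 0 < ε / 4 by linarith)
      have e : (C + 1) / 4 ^ k = 4 * ε := by rw [hε, pow_succ]; field_simp
      rw [e] at hS
      have hM' : Matched z lo hi (ε / 4) |M| := fun T hT p q =>
        (hM T hT p q).trans (by linarith [le_abs_self M])
      refine ⟨_, ?_, H.step hεp.le hN (abs_nonneg M) hS hM' hJ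
        (ns := nn J) (fun w hw => by exact_mod_cast nn_mono hw.le) (Nat.cast_nonneg _)⟩
      have := H.hS
      positivity
  intro ε hε
  obtain ⟨k, hk⟩ := pow_unbounded_of_one_lt ((C + 1) / ε) (show (1:ℝ) < 4 by norm_num)
  obtain ⟨N, hN, hS⟩ := key k
  refine ⟨N, hN, fun g hg p q => (hS g hg p q).trans ?_⟩
  have h1 : (C + 1) / 4 ^ k ≤ ε := by
    rw [div_lt_iff₀ hε] at hk
    rw [div_le_iff₀ (by positivity)]; linarith
  have := mul_le_mul_of_nonneg_right h1 (show (0:ℝ) ≤ ((q - p : ℕ) : ℝ) from Nat.cast_nonneg _)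
  linarith

end BL
end HJT

namespace HJT
open Finset

/-- Rapidly increasing sequences. -/
structure RIS (R : ℕ → ℕ) (d : ℕ → V) (lo hi : ℕ → ℕ) (τ : ℕ → ℝ) : Prop where
  bl : BL R d lo hi τ 4 4
  mt : ∀ T : T2, T.Val → ∀ ε : ℝ, 0 < ε → ε ≤ 1 → ∀ I : Finset ℕ,
    ∑ i ∈ I, |ev (T.fn (lo i) (hi i)) (d i)| ≤ ε * I.card + 20 / ε + 10

lemma BL.sub {R : ℕ → ℕ} {z : ℕ → V} {lo hi : ℕ → ℕ} {τ : ℕ → ℝ} {C S : ℝ}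
    (H : BL R z lo hi τ C S) {φ : ℕ → ℕ} (hφ : StrictMono φ) :
    BL (R ∘ φ) (z ∘ φ) (lo ∘ φ) (hi ∘ φ) (τ ∘ φ) C S where
  blk := H.blk.sub hφ
  hC := H.hC
  hS := H.hS
  nz i := H.nz _
  lohi i := H.lohi _
  hilo i j h := H.hilo _ _ (hφ h)
  h4 i := H.h4 _
  h5 i := H.h5 _
  h6 i := H.h6 _
  hτ i := H.hτ _
  sumτ s := by
    have := H.sumτ (s.map ⟨φ, hφ.injective⟩)
    rwa [sum_map] at this

lemma BL.smul {R : ℕ → ℕ} {z : ℕ → V} {lo hi : ℕ → ℕ} {τ : ℕ → ℝ} {C S : ℝ}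
    (H : BL R z lo hi τ C S) {a : ℕ → ℝ} (ha : ∀ i, |a i| ≤ 1) :
    BL R (fun i => a i • z i) lo hi τ C S where
  blk := H.blk.smul a
  hC := H.hC
  hS := H.hS
  nz i := by
    rw [norm_smul, Real.norm_eq_abs]
    have := mul_le_mul (ha i) (H.nz i) (norm_nonneg _) zero_le_one
    linarith
  lohi i := H.lohi _
  hilo i j h := H.hilo _ _ h
  h4 i w f hf hw := by
    rw [map_smul, smul_eq_mul, abs_mul]
    have := mul_le_mul (ha i) (H.h4 i w f hf hw) (abs_nonneg _) zero_le_one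
    linarith
  h5 i w f hf hw := by
    rw [map_smul, smul_eq_mul, abs_mul]
    have := mul_le_mul (ha i) (H.h5 i w f hf hw) (abs_nonneg _) zero_le_one
    linarith
  h6 i T hT β := by
    rw [map_smul, smul_eq_mul, abs_mul]
    have := mul_le_mul (ha i) (H.h6 i T hT β) (abs_nonneg _) zero_le_one
    linarith
  hτ i := H.hτ _
  sumτ s := H.sumτ s

namespace RIS
variable {R : ℕ → ℕ} {d : ℕ → V} {lo hi : ℕ → ℕ} {τ : ℕ → ℝ}

lemma sub (H : RIS R d lo hi τ) {φ : ℕ → ℕ} (hφ : StrictMono φ) :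
    RIS (R ∘ φ) (d ∘ φ) (lo ∘ φ) (hi ∘ φ) (τ ∘ φ) where
  bl := H.bl.sub hφ
  mt T hT ε h1 h2 I := by
    have := H.mt T hT ε h1 h2 (I.map ⟨φ, hφ.injective⟩)
    rwa [sum_map, card_map] at this

lemma smul (H : RIS R d lo hi τ) {a : ℕ → ℝ} (ha : ∀ i, |a i| ≤ 1) :
    RIS R (fun i => a i • d i) lo hi τ where
  bl := H.bl.smul ha
  mt T hT ε h1 h2 I := by
    refine le_trans (sum_le_sum fun i _ => ?_) (H.mt T hT ε h1 h2 I)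
    rw [map_smul, smul_eq_mul, abs_mul]
    have := mul_le_mul_of_nonneg_right (ha i) (abs_nonneg (ev (T.fn (lo i) (hi i)) (d i)))
    linarith

lemma matched (H : RIS R d lo hi τ) {ε : ℝ} (h1 : 0 < ε) (h2 : ε ≤ 1) :
    Matched d lo hi ε (20 / ε + 10) := by
  intro T hT p q
  refine (abs_sum_le_sum_abs _ _).trans ((H.mt T hT ε h1 h2 (Ico p q)).trans ?_)
  rw [Nat.card_Ico]; linarith

lemma small (H : RIS R d lo hi τ) : ∀ ε > 0, ∃ N, 0 ≤ N ∧ SS d ε N := by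
  refine H.bl.small fun ε hε => ?_
  refine ⟨20 / (min ε 1) + 10, fun T hT p q => ?_⟩
  refine (H.matched (lt_min hε one_pos) (min_le_right _ _) T hT p q).trans ?_
  have := mul_le_mul_of_nonneg_right (min_le_left ε 1)
    (show (0:ℝ) ≤ ((q - p : ℕ) : ℝ) from Nat.cast_nonneg _)
  linarith

lemma mm_four (j : ℕ) : mm j = 4 ^ (2 ^ (j + 2)) := by
  unfold mm
  rw [show (4:ℕ) = 2 ^ 2 by norm_num, ← pow_mul]
  congr 1
  rw [pow_succ 2 (j + 2)]; ring

lemma univ_aux (H : RIS R d lo hi τ) (j : ℕ) : ∀ k ≤ 2 ^ (j + 2) - 2,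
    SS d (4 / 4 ^ k) (Qr (pv j) (2 * mm j + 30) k) := by
  intro k
  have h4 : 4 ≤ 2 ^ (j + 2) := by
    calc 4 = 2 ^ 2 := by norm_num
      _ ≤ _ := Nat.pow_le_pow_right (by norm_num) (by omega)
  induction k with
  | zero => intro _; simpa [Qr] using H.bl.triv
  | succ k ih =>
    intro hk
    have hS := ih (by omega)
    have hm : (16 : ℝ) * 4 ^ (k + 1) ≤ mm j := by
      have : 4 ^ (k + 1 + 2) ≤ mm j := by
        rw [mm_four]; exact Nat.pow_le_pow_right (by norm_num) (by omega)
      have h : ((4 ^ (k + 1 + 2) : ℕ) : ℝ) ≤ mm j := by exact_mod_cast this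
      push_cast at h
      rw [pow_add _ _ 2] at h
      linarith
    set p : ℝ := 4 ^ (k + 1) with hp
    have hp4 : (4:ℝ) ≤ p := by
      rw [hp, pow_succ]
      have : (1:ℝ) ≤ 4 ^ k := one_le_pow₀ (by norm_num)
      linarith
    have hp0 : 0 < p := by linarith
    have e : (4:ℝ) / 4 ^ k = 4 * (4 / p) := by
      rw [hp, pow_succ]; field_simp
    rw [e] at hS
    have hmm := mm_pos j
    have := H.bl.step (ε := 4 / p) (M := 20 / (4 / p / 4) + 10) (J := j) (ns := pv j)
      (by positivity) (Nat.cast_nonneg _) (by positivity) hS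
      (H.matched (by positivity) (by
        rw [div_div, div_le_one (by positivity)]; linarith))
      (by
        rw [div_div, div_le_div_iff₀ hmm (by positivity)]
        linarith)
      (fun w hw => by exact_mod_cast nn_le_pv hw) (Nat.cast_nonneg _)
    intro g hg x y
    refine (this g hg x y).trans ?_
    have e2 : (20 : ℝ) / (4 / p / 4) = 20 * p := by field_simp
    rw [e2]
    have h5 : 4 * (4 / p) ≤ 16 := by
      have : 4 / p ≤ 1 := (div_le_one hp0).mpr hp4
      linarith
    have h6 := mul_le_mul_of_nonneg_left (add_le_add_left h5
      (Qr (pv j) (2 * mm j + 30) k : ℝ)) (show (0:ℝ) ≤ pv j from Nat.cast_nonneg _)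
    simp only [Qr]
    push_cast
    linarith

/-- universal estimate -/
lemma univ (H : RIS R d lo hi τ) (j : ℕ) : SS d (64 / mm j) (QQ j (pv j)) := by
  have := H.univ_aux j _ le_rfl
  have e : (4:ℝ) / 4 ^ (2 ^ (j + 2) - 2) = 64 / mm j := by
    have h4 : 2 ≤ 2 ^ (j + 2) := by
      calc 2 = 2 ^ 1 := by norm_num
        _ ≤ _ := Nat.pow_le_pow_right (by norm_num) (by omega)
    have : (mm j : ℝ) = 4 ^ (2 ^ (j + 2) - 2) * 16 := by
      rw [mm_four]; push_cast
      rw [show (16:ℝ) = 4 ^ 2 by norm_num, ← pow_add]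
      congr 1; omega
    rw [this]; field_simp; norm_num
  rw [e] at this
  exact this

end RIS

/-- Exact vectors. -/
structure Exact (C : ℝ) (j : ℕ) (x : V) : Prop where
  e1 : ‖x‖ ≤ C
  e2 : ∀ w f, WW w f → w < j → |ev f x| ≤ C / mm w
  e3 : ∀ w f, WW w f → j < w → |ev f x| ≤ C / mm j
  e4 : ∀ T : T2, T.Val → ∀ α β, j < α → |ev (T.fn α β) x| ≤ C / mm j

lemma Exact.nonneg {C : ℝ} {j : ℕ} {x : V} (h : Exact C j x) : 0 ≤ C := (norm_nonneg _).trans h.e1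

lemma Exact.smul {C : ℝ} {j : ℕ} {x : V} (h : Exact C j x) {c : ℝ} {A : ℝ} (hc : |c| ≤ A) :
    Exact (A * C) j (c • x) := by
  have hA : 0 ≤ A := (abs_nonneg _).trans hc
  have key : ∀ f : Fn, ∀ B, |ev f x| ≤ B → |ev f (c • x)| ≤ A * B := by
    intro f B hB
    rw [map_smul, smul_eq_mul, abs_mul]
    exact mul_le_mul hc hB (abs_nonneg _) hA
  refine ⟨?_, ?_, ?_, ?_⟩
  · rw [norm_smul, Real.norm_eq_abs]; exact mul_le_mul hc h.e1 (norm_nonneg _) hA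
  · intro w f hf hw; rw [mul_div_assoc]; exact key _ _ (h.e2 w f hf hw)
  · intro w f hf hw; rw [mul_div_assoc]; exact key _ _ (h.e3 w f hf hw)
  · intro T hT α β hw; rw [mul_div_assoc]; exact key _ _ (h.e4 T hT α β hw)

lemma Exact.mono {C C' : ℝ} {j : ℕ} {x : V} (h : Exact C j x) (hC : C ≤ C') : Exact C' j x := by
  have : ∀ w, C / mm w ≤ C' / mm w := fun w => div_le_div_of_nonneg_right hC (mm_pos w).le
  exact ⟨h.e1.trans hC, fun w f a b => (h.e2 w f a b).trans (this _),
    fun w f a b => (h.e3 w f a b).trans (this _), fun T a α β b => (h.e4 T a α β b).trans (this _)⟩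

def exv (d : ℕ → V) (j p : ℕ) : V := ((mm j : ℝ) / nn j) • ∑ i ∈ Ico p (p + nn j), d i

lemma RIS.exact {R : ℕ → ℕ} {d : ℕ → V} {lo hi : ℕ → ℕ} {τ : ℕ → ℝ}
    (H : RIS R d lo hi τ) (j p : ℕ) : Exact 100 j (exv d j p) := by
  have hm := mm_pos j
  have hm256 := mm_ge' j
  have hn : (0:ℝ) < nn j := by exact_mod_cast nn_pos j
  have hU := H.univ j
  set Q : ℝ := (QQ j (pv j) : ℝ) with hQ
  have hQ0 : 0 ≤ Q := Nat.cast_nonneg _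
  have hpv1 : (1:ℝ) ≤ pv j := by exact_mod_cast one_le_pv j
  have g1 : (mm j : ℝ) * pv j * (Q + 64) ≤ nn j := by rw [hQ]; exact_mod_cast nn_ge1 j
  have g2 : (mm j : ℝ) ^ 2 * (20 * (mm j : ℝ) ^ 2 + 100) ≤ nn j := by exact_mod_cast nn_ge2 j
  have hsub : p + nn j - p = nn j := by omega
  have hc : (0:ℝ) ≤ mm j / nn j := by positivity
  have red : ∀ f : Fn, ∀ B B' : ℝ, |ev f (∑ i ∈ Ico p (p + nn j), d i)| ≤ B →
      mm j * B ≤ B' * nn j → |ev f (exv d j p)| ≤ B' := by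
    intro f B B' h1 h2
    unfold exv
    rw [map_smul, smul_eq_mul, abs_mul, abs_of_nonneg hc]
    refine (mul_le_mul_of_nonneg_left h1 hc).trans ?_
    rw [div_mul_eq_mul_div, div_le_iff₀ hn]; exact h2
  have hmQ : (mm j : ℝ) * Q ≤ nn j := by
    have h1 : (mm j : ℝ) * Q ≤ mm j * pv j * (Q + 64) := by
      have : Q ≤ pv j * (Q + 64) := by nlinarith
      calc (mm j : ℝ) * Q ≤ mm j * (pv j * (Q + 64)) := mul_le_mul_of_nonneg_left this hm.le
        _ = _ := by ring
    linarith
  refine ⟨?_, ?_, ?_, ?_⟩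
  · refine norm_le_of fun f hf => red f _ _ (hU f hf _ _) ?_
    rw [hsub]
    have e : (mm j : ℝ) * (64 / mm j * nn j + Q) = 64 * nn j + mm j * Q := by field_simp
    rw [e]; linarith
  · intro w f hf hw
    have hmw := mm_pos w
    refine red f _ _ (Wbound H.bl.blk (by positivity) hQ0 hU hf _ _) ?_
    rw [hsub]
    have hnw : (nn w : ℝ) ≤ pv j := by exact_mod_cast nn_le_pv hw
    have hnw0 : (0:ℝ) ≤ nn w := Nat.cast_nonneg _
    have e : (mm j : ℝ) * (1 / mm w * (64 / mm j * (nn j + nn w) + nn w * Q)) =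
        1 / mm w * (64 * (nn j + nn w) + mm j * (nn w * Q)) := by field_simp
    rw [e, div_mul_eq_mul_div, div_mul_eq_mul_div, one_mul]
    refine div_le_div_of_nonneg_right ?_ hmw.le
    have h1 : (mm j : ℝ) * (nn w * Q) ≤ mm j * (pv j * Q) :=
      mul_le_mul_of_nonneg_left (mul_le_mul_of_nonneg_right hnw hQ0) hm.le
    have h2 : (nn w : ℝ) ≤ mm j * pv j := by nlinarith
    nlinarith
  · intro w f hf hw
    refine red f _ _ (H.bl.Whigh hf _ _) ?_
    rw [hsub]
    have h1 : (mm j : ℝ) ^ 2 ≤ mm w := by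
      rw [show (mm j : ℝ) ^ 2 = ((mm (j + 1) : ℕ) : ℝ) by rw [mm_succ]; push_cast; ring]
      exact mm_mono' hw
    have h2 : (4:ℝ) / mm w ≤ 4 / mm j ^ 2 :=
      div_le_div_of_nonneg_left (by norm_num) (by positivity) h1
    have h3 : (8:ℝ) ≤ 8 / mm j ^ 2 * nn j := by
      rw [div_mul_eq_mul_div, le_div_iff₀ (by positivity)]
      nlinarith [pow_pos hm 2]
    have h4 := mul_le_mul_of_nonneg_right h2 hn.le
    calc (mm j : ℝ) * (4 / mm w * nn j + 4 + 4)
        ≤ mm j * (4 / mm j ^ 2 * nn j + 8 / mm j ^ 2 * nn j) :=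
          mul_le_mul_of_nonneg_left (by linarith) hm.le
      _ = 12 / mm j * nn j := by field_simp; ring
      _ ≤ _ := by
        refine mul_le_mul_of_nonneg_right ?_ hn.le
        exact div_le_div_of_nonneg_right (by norm_num) hm.le
  · intro T hT α β hα
    have hε : (0:ℝ) < 1 / mm j ^ 2 := by positivity
    obtain ⟨T', hV, hpt, hb⟩ := H.bl.t2split hT
      (H.matched hε (by rw [div_le_one (by positivity)]; nlinarith)) α β p (p + nn j)
    refine red _ _ _ hb ?_
    have low : |∑ i ∈ Ico p (p + nn j), ∑ w ∈ Ico 0 (lo i), ev (T'.pt w) (d i)| ≤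
        8 / mm j ^ 2 * nn j := by
      have : ∀ i ∈ Ico p (p + nn j), |∑ w ∈ Ico 0 (lo i), ev (T'.pt w) (d i)| ≤ 8 / mm j ^ 2 := by
        intro i _
        have e : ∑ w ∈ Ico 0 (lo i), ev (T'.pt w) (d i) =
            ∑ w ∈ Ico (j + 1) (lo i), ev (T'.pt w) (d i) := by
          symm
          refine sum_subset (Ico_subset_Ico_left (Nat.zero_le _)) fun w hw hnw => ?_
          rw [hpt, if_neg, ev_zero]
          simp only [mem_Ico] at hw hnw
          omega
        rw [e]
        refine (H.bl.lowtail hV (j + 1) i).trans ?_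
        rw [mm_succ]; push_cast; norm_num
      refine (abs_sum_le_sum_abs _ _).trans ((sum_le_sum this).trans ?_)
      simp [mul_comm]
    rw [hsub]
    have e3 : (20 : ℝ) / (1 / mm j ^ 2) = 20 * mm j ^ 2 := by field_simp
    rw [e3]
    have h3 : 20 * (mm j : ℝ) ^ 2 + 14 ≤ 1 / mm j ^ 2 * nn j := by
      rw [div_mul_eq_mul_div, le_div_iff₀ (by positivity)]
      nlinarith [pow_pos hm 2]
    calc (mm j : ℝ) * (_ + 1 / mm j ^ 2 * nn j + (20 * mm j ^ 2 + 10) + 4)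
        ≤ mm j * (8 / mm j ^ 2 * nn j + 1 / mm j ^ 2 * nn j + 1 / mm j ^ 2 * nn j) :=
          mul_le_mul_of_nonneg_left (by linarith) hm.le
      _ = 10 / mm j * nn j := by field_simp; ring
      _ ≤ _ := by
        refine mul_le_mul_of_nonneg_right ?_ hn.le
        exact div_le_div_of_nonneg_right (by norm_num) hm.le

def exf (f : ℕ → Fn) (j p : ℕ) : Fn := (1 / mm j : ℚ) • ∑ i ∈ Ico p (p + nn j), f i

lemma exf_mem {R : ℕ → ℕ} (hR : Monotone R) {f : ℕ → Fn} (hf : ∀ i, KK (f i))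
    (hs : ∀ i, Sup (R i) (R (i + 1)) (f i)) (j p : ℕ) : WW j (exf f j p) := by
  unfold exf
  rw [sum_Ico_eq_sum_range, show p + nn j - p = nn j by omega]
  refine InK.wt j (nn j) (fun l => f (p + l)) le_rfl (fun l _ => hf _) ?_
  intro l l' hll _ n hn n' hn'
  have h1 := hs _ n (Finsupp.mem_support_iff.mp hn)
  have h2 := hs _ n' (Finsupp.mem_support_iff.mp hn')
  have h3 : R (p + l + 1) ≤ R (p + l') := hR (by omega)
  omega

lemma exf_sup {R : ℕ → ℕ} (hR : Monotone R) {f : ℕ → Fn}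
    (hs : ∀ i, Sup (R i) (R (i + 1)) (f i)) (j p : ℕ) :
    Sup (R p) (R (p + nn j)) (exf f j p) := by
  refine Sup.smul (Sup.sum fun i hi => ?_) _
  have := mem_Ico.mp hi
  exact (hs i).mono (hR this.1) (hR this.2)

lemma exv_sup {R : ℕ → ℕ} {d : ℕ → V} (h : Blk R d) (j p : ℕ) :
    Sup (R p) (R (p + nn j)) (exv d j p) := (h.sum_sup _ _).smul _

lemma exf_exv {R : ℕ → ℕ} {v : ℕ → V} (hv : Blk R v) {f : ℕ → Fn}
    (hs : ∀ i, Sup (R i) (R (i + 1)) (f i)) (j p : ℕ) :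
    ev (exf f j p) (exv v j p) = (∑ i ∈ Ico p (p + nn j), ev (f i) (v i)) / nn j := by
  unfold exf exv
  have hm := mm_pos j
  rw [ev_smul, map_smul, smul_eq_mul, ev_sum]
  have : ∑ i ∈ Ico p (p + nn j), ev (f i) (∑ i ∈ Ico p (p + nn j), v i) =
      ∑ i ∈ Ico p (p + nn j), ev (f i) (v i) := by
    refine sum_congr rfl fun i hi => ?_
    rw [map_sum, sum_eq_single_of_mem i hi]
    intro k _ hk
    refine ev_disj (hv.sup k) (hs i) ?_
    rcases lt_or_gt_of_ne hk with h | h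
    · left; exact hv.mono h
    · right; exact hv.mono h
  rw [this]
  push_cast
  field_simp

end HJT

namespace HJT
open Finset

def pth (b : ℕ → Fn) : ℕ → List Fn
  | 0 => []
  | i + 1 => b i :: pth b i

lemma pth_suffix (b : ℕ → Fn) {i k : ℕ} (h : i ≤ k) : pth b i <:+ pth b k := by
  induction k, h using Nat.le_induction with
  | base => exact List.suffix_rfl
  | succ k _ ih => exact ih.trans (List.suffix_cons _ _)

lemma pth_lt (b : ℕ → Fn) : StrictMono fun i => sg (pth b i) :=
  strictMono_nat_of_lt_succ fun i => sg_cons (b i) (pth b i)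

lemma Nd_pth (b : ℕ → Fn) {i k : ℕ} (h : i < k) : Nd (pth b k) (sg (pth b i)) = b i :=
  Nd_eq (pth_suffix b (show i + 1 ≤ k from h))

lemma sum_Nd_pth (b : ℕ → Fn) (n : ℕ) : ∀ B, sg (pth b n) ≤ B →
    ∑ w ∈ Ico 0 B, Nd (pth b n) w = ∑ i ∈ range n, b i := by
  induction n with
  | zero => intro B _; simp [pth, Nd]
  | succ n ih =>
    intro B hB
    have h1 : sg (pth b n) < B := (pth_lt b (Nat.lt_succ_self n)).trans_le hB
    rw [sum_range_succ, ← ih B h1.le]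
    have : ∀ w ∈ Ico 0 B, Nd (pth b (n + 1)) w =
        Nd (pth b n) w + if w = sg (pth b n) then b n else 0 := by
      intro w _
      simp only [pth, Nd]
      by_cases h : sg (pth b n) = w
      · subst h
        rw [if_pos rfl, if_pos rfl, Nd_large le_rfl, zero_add]
      · rw [if_neg h, if_neg (Ne.symm h), add_zero]
    rw [sum_congr rfl this, sum_add_distrib]
    congr 1
    rw [sum_ite_eq', if_pos (mem_Ico.mpr ⟨Nat.zero_le _, h1⟩)]

structure Dep (C : ℝ) (R : ℕ → ℕ) (b : ℕ → Fn) (x : ℕ → V) : Prop where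
  mono : Monotone R
  supx : ∀ i, Sup (R i) (R (i + 1)) (x i)
  supb : ∀ i, Sup (R i) (R (i + 1)) (b i)
  wb : ∀ i, WW (sg (pth b i)) (b i)
  ex : ∀ i, Exact C (sg (pth b i)) (x i)

lemma pth_nodes {b : ℕ → Fn} (wb : ∀ i, WW (sg (pth b i)) (b i)) (n : ℕ) (c : Fn) (r : List Fn)
    (h : (c :: r) <:+ pth b n) : WW (sg r) c := by
  induction n with
  | zero => simp [pth] at h
  | succ n ih =>
    rcases List.suffix_cons_iff.mp h with h | h
    · obtain ⟨rfl, rfl⟩ := List.cons_eq_cons.mp h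
      exact wb n
    · exact ih h

/-- the sum of the functionals of a dependent sequence lies in `K`. -/
lemma dep_sum_mem {b : ℕ → Fn} (wb : ∀ i, WW (sg (pth b i)) (b i)) (n : ℕ) :
    KK (∑ i ∈ range n, b i) := by
  set f := ∑ i ∈ range n, b i with hf
  obtain ⟨B, hB⟩ := exists_Sup f
  set B' := sg (pth b n) with hB'
  let T : T2 := ⟨1, {0}, fun _ => pth b n, fun _ => 1, fun _ => B', fun _ => 1, 0, B⟩
  have hT : T.Val := by
    refine ⟨⟨le_rfl, by simp [T], by simp [T], by simp [T], ?_⟩, ?_⟩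
    · intro l hl l' hl' w _ _ _ _ _ _
      simp only [T, mem_singleton] at hl hl'
      rw [hl, hl']
    · intro l _ c r h
      exact pth_nodes wb n c r h
  have : T.fn 0 B' = f := by
    unfold T2.fn
    have : ∀ w ∈ Ico 0 B', T.pt w = rs 0 B (Nd (pth b n) w) := by
      intro w hw
      simp only [T2.pt, T, Nat.cast_one, one_div_one, one_smul, sum_singleton]
      congr 1
      by_cases h1 : 1 ≤ w
      · rw [if_pos ⟨h1, (mem_Ico.mp hw).2⟩]
      · rw [if_neg (by tauto), Nd_zero]
        rintro ⟨c, r, _, h2⟩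
        have := sg_pos r
        omega
    rw [sum_congr rfl this, ← rs_sum, sum_Nd_pth b n B' le_rfl, ← hf, hB.rs_eq le_rfl le_rfl]
  rw [← this]
  exact hT.mem 0 B'

lemma min_sq_div {L k n : ℕ} (hL : 1 ≤ L) (h1 : k ≤ L ^ 2) (h2 : k ≤ n) {κ : ℝ} (hκ : 0 < κ) :
    (k : ℝ) / L ≤ κ * n + 1 / κ := by
  have hL' : (1:ℝ) ≤ L := by exact_mod_cast hL
  have h1' : (k : ℝ) ≤ (L : ℝ) ^ 2 := by exact_mod_cast h1
  have h2' : (k : ℝ) ≤ n := by exact_mod_cast h2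
  have hn : (0:ℝ) ≤ n := Nat.cast_nonneg _
  have hk : (0:ℝ) ≤ k := Nat.cast_nonneg _
  have h0 : 0 < 1 / κ := by positivity
  rcases le_total (L : ℝ) (1 / κ) with h | h
  · have : (k : ℝ) / L ≤ L := by rw [div_le_iff₀ (by linarith)]; nlinarith
    have : 0 ≤ κ * n := by positivity
    linarith
  · have : (k : ℝ) / L ≤ κ * n := by
      rw [div_le_iff₀ (by linarith)]
      rw [div_le_iff₀ hκ] at h
      nlinarith
    linarith

lemma filter_Ico_interval {P : ℕ → Prop} [DecidablePred P] (p q : ℕ)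
    (h : ∀ i k j, i ≤ k → k ≤ j → P i → P j → P k) :
    ∃ p' q', p ≤ p' ∧ q' ≤ q ∧ q' - p' ≤ q - p ∧ (Ico p q).filter P = Ico p' q' := by
  rcases ((Ico p q).filter P).eq_empty_or_nonempty with he | hne
  · exact ⟨max p q, q, by omega, le_rfl, by omega, by rw [he, Ico_eq_empty_of_le (by omega)]⟩
  · have h1 := mem_filter.mp (min'_mem _ hne)
    have h2 := mem_filter.mp (max'_mem _ hne)
    have h1' := mem_Ico.mp h1.1
    have h2' := mem_Ico.mp h2.1
    refine ⟨((Ico p q).filter P).min' hne, ((Ico p q).filter P).max' hne + 1, by omega,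
      by omega, by omega, ?_⟩
    ext k
    simp only [mem_Ico]
    constructor
    · intro hk
      exact ⟨min'_le _ _ hk, Nat.lt_succ_of_le (le_max' _ _ hk)⟩
    · rintro ⟨ha, hb⟩
      exact mem_filter.mpr ⟨mem_Ico.mpr ⟨by omega, by omega⟩,
        h _ k _ ha (by omega) h1.2 h2.2⟩

lemma T2.ev_pt (T : T2) (w : ℕ) (x : V) :
    ev (T.pt w) x = (∑ l ∈ T.ι, if T.lo l ≤ w ∧ w < T.hi l then
      (T.c l : ℝ) * ev (Nd (T.t l) w) (rs T.a T.b x) else 0) / T.L := by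
  unfold T2.pt
  rw [ev_smul, ev_rs, ev_sum]
  push_cast
  rw [one_div_mul_eq_div]
  congr 1
  refine sum_congr rfl fun l _ => ?_
  split_ifs
  · rw [ev_smul]
  · rw [ev_zero]

namespace Dep
variable {C : ℝ} {R : ℕ → ℕ} {b : ℕ → Fn} {x : ℕ → V}

lemma Cnn (H : Dep C R b x) : 0 ≤ C := (H.ex 0).nonneg

lemma bl (H : Dep C R b x) {a : ℕ → ℝ} {A : ℝ} (ha : ∀ i, |a i| ≤ A) :
    BL R (fun i => a i • x i) (fun i => sg (pth b i)) (fun i => sg (pth b i) + 1)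
      (fun i => A * C / mm (sg (pth b i))) (A * C) (A * C) := by
  have hA : 0 ≤ A := (abs_nonneg _).trans (ha 0)
  have hC := H.Cnn
  have hE := fun i => (H.ex i).smul (ha i)
  refine ⟨⟨H.mono, fun i => (H.supx i).smul _⟩, by positivity, by positivity, fun i => (hE i).e1,
    fun i => by simp, fun i j h => pth_lt b h, fun i w f hf hw => (hE i).e2 w f hf hw,
    fun i w f hf hw => (hE i).e3 w f hf hw, fun i T hT β => (hE i).e4 T hT _ β (Nat.lt_succ_self _),
    fun i => by have := mm_pos (sg (pth b i)); positivity, fun s => ?_⟩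
  have h1 : ∑ i ∈ s, (1:ℝ) / mm (sg (pth b i)) ≤ 1 := by
    classical
    have e : ∑ i ∈ s, (1:ℝ) / mm (sg (pth b i)) =
        ∑ w ∈ s.map ⟨_, (pth_lt b).injective⟩, (1:ℝ) / mm w := by rw [sum_map]; rfl
    rw [e]
    have h2 : s.map ⟨_, (pth_lt b).injective⟩ ⊆ Ico 0 ((s.map ⟨_, (pth_lt b).injective⟩).sup id + 1) := by
      intro w hw
      exact mem_Ico.mpr ⟨Nat.zero_le _, Nat.lt_succ_of_le (le_sup (f := id) hw)⟩
    refine (sum_le_sum_of_subset_of_nonneg h2 fun w _ _ => ?_).trans ((sum_inv_mm _ _).trans ?_)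
    · have := mm_pos w; positivity
    · have := mm_ge' 0
      rw [div_le_one (mm_pos 0)]; linarith
  calc ∑ i ∈ s, A * C / mm (sg (pth b i)) = A * C * ∑ i ∈ s, (1:ℝ) / mm (sg (pth b i)) := by
        rw [mul_sum]; exact sum_congr rfl fun i _ => by ring
    _ ≤ A * C * 1 := mul_le_mul_of_nonneg_left h1 (by positivity)
    _ = A * C := mul_one _

open Classical in
/-- contribution of one path -/
lemma onepath (H : Dep C R b x) {a : ℕ → ℝ} {A B : ℝ} (ha : ∀ i, |a i| ≤ A)
    (hB : ∀ p q, |∑ i ∈ Ico p q, a i * ev (b i) (x i)| ≤ B) (t : List Fn)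
    (ht : ∀ c r, (c :: r) <:+ t → WW (sg r) c) (lo hi p q : ℕ) :
    |∑ i ∈ Ico p q, if lo ≤ sg (pth b i) ∧ sg (pth b i) < hi then
      ev (Nd t (sg (pth b i))) (a i • x i) else 0| ≤
    if ∃ i ∈ Ico p q, lo ≤ sg (pth b i) ∧ sg (pth b i) < hi ∧ HasNode t (sg (pth b i)) then
      B + A * C else 0 := by
  classical
  split_ifs with hx
  · set w := fun i => sg (pth b i) with hw
    set S := (Ico p q).filter fun i => lo ≤ w i ∧ w i < hi ∧ HasNode t (w i) with hS
    have hne : S.Nonempty := by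
      obtain ⟨i, h1, h2⟩ := hx
      exact ⟨i, mem_filter.mpr ⟨h1, h2⟩⟩
    set k := S.max' hne with hk
    have hkS := mem_filter.mp (max'_mem S hne)
    rw [← hk] at hkS
    obtain ⟨hkI, hk1, hk2, c, r, hcr, hr⟩ := hkS
    obtain rfl : r = pth b k := sg_inj hr
    have hkI' := mem_Ico.mp hkI
    -- terms
    have e : ∑ i ∈ Ico p q, (if lo ≤ w i ∧ w i < hi then ev (Nd t (w i)) (a i • x i) else 0) =
        ∑ i ∈ (Ico p k).filter (fun i => lo ≤ w i), a i * ev (b i) (x i) +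
          ev (Nd t (w k)) (a k • x k) := by
      have h1 : ∑ i ∈ Ico p q, (if lo ≤ w i ∧ w i < hi then ev (Nd t (w i)) (a i • x i) else 0) =
          ∑ i ∈ Ico p (k + 1), (if lo ≤ w i ∧ w i < hi then ev (Nd t (w i)) (a i • x i) else 0) := by
        symm
        refine sum_subset (Ico_subset_Ico_right (by omega)) fun i hi1 hi2 => ?_
        split_ifs with h3
        · rw [Nd_zero, ev_zero]
          intro h4
          have : i ≤ k := le_max' S i (mem_filter.mpr ⟨hi1, h3.1, h3.2, h4⟩)
          simp only [mem_Ico] at hi1 hi2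
          omega
        · rfl
      rw [h1, sum_Ico_succ_top hkI'.1, if_pos ⟨hk1, hk2⟩, sum_filter]
      congr 1
      refine sum_congr rfl fun i hi1 => ?_
      have hik := (mem_Ico.mp hi1).2
      have hwik : w i < w k := pth_lt b hik
      by_cases h3 : lo ≤ w i
      · rw [if_pos ⟨h3, by omega⟩, if_pos h3, Nd_suffix hcr hwik, Nd_pth b hik, map_smul, smul_eq_mul]
      · rw [if_neg h3, if_neg (by tauto)]
    rw [e]
    obtain ⟨p', q', -, -, -, h5⟩ := filter_Ico_interval (P := fun i => lo ≤ w i) p k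
      (fun i k j h1 h2 h3 h4 => h3.trans ((pth_lt b).monotone h1))
    rw [h5]
    have h6 : |ev (Nd t (w k)) (a k • x k)| ≤ A * C := by
      have : WW (w k) (Nd t (w k)) := by rw [hw]; simp only; rw [Nd_eq hcr]; exact ht _ _ hcr
      exact (ev_le (InK.up _ _ this) _).trans ((H.bl ha).nz k)
    have := hB p' q'
    exact (abs_add_le _ _).trans (by linarith)
  · rw [sum_eq_zero]
    · simp
    · intro i hi'
      split_ifs with h
      · rw [Nd_zero, ev_zero]
        intro h2
        exact hx ⟨i, hi', h.1, h.2, h2⟩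
      · rfl

lemma matched (H : Dep C R b x) {a : ℕ → ℝ} {A B : ℝ} (ha : ∀ i, |a i| ≤ A)
    (hB : ∀ p q, |∑ i ∈ Ico p q, a i * ev (b i) (x i)| ≤ B) (ε : ℝ) (hε : 0 < ε) :
    ∃ M, Matched (fun i => a i • x i) (fun i => sg (pth b i)) (fun i => sg (pth b i) + 1) ε M := by
  classical
  have hA : 0 ≤ A := (abs_nonneg _).trans (ha 0)
  have hC := H.Cnn
  have hB0 : 0 ≤ B := (abs_nonneg _).trans (hB 0 0)
  set w := fun i => sg (pth b i) with hw
  set z := fun i => a i • x i with hz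
  have BLz := H.bl ha
  set D := B + A * C with hD
  have hD0 : 0 ≤ D := by positivity
  set κ := ε / (D + 1) with hκ
  have hκ0 : 0 < κ := by positivity
  refine ⟨D * (1 / κ) + 2 * (A * C), fun T hT p q => ?_⟩
  -- split off cut indices
  set G := (Ico p q).filter fun i => T.a ≤ R i ∧ R (i + 1) ≤ T.b with hG
  have hL : (1:ℝ) ≤ T.L := by exact_mod_cast hT.hL
  have e1 : ∑ i ∈ Ico p q, ev (T.pt (w i)) (z i) = ∑ i ∈ G, ev (T.pt (w i)) (z i) +
      ∑ i ∈ (Ico p q).filter (fun i => ¬ (T.a ≤ R i ∧ R (i + 1) ≤ T.b)), ev (T.pt (w i)) (z i) :=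
    (sum_filter_add_sum_filter_not _ _ _).symm
  have cut : |∑ i ∈ (Ico p q).filter (fun i => ¬ (T.a ≤ R i ∧ R (i + 1) ≤ T.b)),
      ev (T.pt (w i)) (z i)| ≤ 2 * (A * C) := by
    have h1 : ∀ i ∈ (Ico p q).filter (fun i => ¬ (T.a ≤ R i ∧ R (i + 1) ≤ T.b)),
        |ev (T.pt (w i)) (z i)| ≤ (if R i < T.a ∧ T.a < R (i + 1) then A * C else 0) +
          (if R i < T.b ∧ T.b < R (i + 1) then A * C else 0) := by
      intro i hi
      have hi' := (mem_filter.mp hi).2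
      have hAC : 0 ≤ A * C := by positivity
      by_cases hc : (R i < T.a ∧ T.a < R (i + 1)) ∨ (R i < T.b ∧ T.b < R (i + 1))
      · have h2 : |ev (T.pt (w i)) (z i)| ≤ A * C :=
          (ev_le (InK.up _ _ (hT.pt_mem (w i))) _).trans (BLz.nz i)
        rcases hc with hc | hc
        · rw [if_pos hc]; split_ifs <;> linarith
        · rw [if_pos hc]; split_ifs <;> linarith
      · have h3 : ev (T.pt (w i)) (z i) = 0 := by
          rw [T.ev_pt]
          have : rs T.a T.b (z i) = 0 := by
            refine (BLz.blk.sup i).rs_eq_zero ?_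
            show R (i + 1) ≤ T.a ∨ T.b ≤ R i
            omega
          rw [this]
          simp
        rw [h3, abs_zero]
        split_ifs <;> linarith
    refine (abs_sum_le_sum_abs _ _).trans ((sum_le_sum h1).trans ?_)
    rw [sum_add_distrib]
    have uq : ∀ c : ℕ, ∀ i j : ℕ, R i < c ∧ c < R (i + 1) → R j < c ∧ c < R (j + 1) → i = j := by
      intro c i j h1 h2
      by_contra hne
      rcases lt_or_gt_of_ne hne with h | h
      · have := H.mono (show i + 1 ≤ j from h); omega
      · have := H.mono (show j + 1 ≤ i from h); omega
    have h2 := card_filter_le_one_sum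
      (s := (Ico p q).filter (fun i => ¬ (T.a ≤ R i ∧ R (i + 1) ≤ T.b)))
      (p := fun i => R i < T.a ∧ T.a < R (i + 1)) (C := A * C) (by positivity)
      (fun i _ j _ => uq _ i j)
    have h3 := card_filter_le_one_sum
      (s := (Ico p q).filter (fun i => ¬ (T.a ≤ R i ∧ R (i + 1) ≤ T.b)))
      (p := fun i => R i < T.b ∧ T.b < R (i + 1)) (C := A * C) (by positivity)
      (fun i _ j _ => uq _ i j)
    linarith
  obtain ⟨p', q', -, -, hpq, hGI⟩ := filter_Ico_interval
    (P := fun i => T.a ≤ R i ∧ R (i + 1) ≤ T.b) p q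
    (fun i k j h1 h2 h3 h4 => ⟨h3.1.trans (H.mono h1), (H.mono (by omega)).trans h4.2⟩)
  let act : ℕ → Prop := fun l => ∃ i ∈ Ico p' q', T.lo l ≤ w i ∧ w i < T.hi l ∧ HasNode (T.t l) (w i)
  have e2 : ∑ i ∈ G, ev (T.pt (w i)) (z i) = (∑ l ∈ T.ι, (T.c l : ℝ) * ∑ i ∈ Ico p' q',
      if T.lo l ≤ w i ∧ w i < T.hi l then ev (Nd (T.t l) (w i)) (z i) else 0) / T.L := by
    rw [hG, hGI]
    have : ∀ i ∈ Ico p' q', ev (T.pt (w i)) (z i) = (∑ l ∈ T.ι, (T.c l : ℝ) *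
        if T.lo l ≤ w i ∧ w i < T.hi l then ev (Nd (T.t l) (w i)) (z i) else 0) / T.L := by
      intro i hi
      rw [← hGI] at hi
      have hi' := (mem_filter.mp hi).2
      rw [T.ev_pt, (BLz.blk.sup i).rs_eq hi'.1 hi'.2]
      congr 1
      refine sum_congr rfl fun l _ => ?_
      split_ifs
      · rfl
      · rw [mul_zero]
    rw [sum_congr rfl this, ← sum_div, sum_comm]
    congr 1
    refine sum_congr rfl fun l _ => ?_
    rw [mul_sum]
  have b2 : |∑ i ∈ G, ev (T.pt (w i)) (z i)| ≤ D * (((T.ι.filter act).card : ℝ) / T.L) := by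
    rw [e2, abs_div, abs_of_pos (show (0:ℝ) < T.L by linarith), ← mul_div_assoc]
    refine div_le_div_of_nonneg_right ?_ (by linarith)
    refine (abs_sum_le_sum_abs _ _).trans ?_
    have : ∀ l ∈ T.ι, |(T.c l : ℝ) * ∑ i ∈ Ico p' q',
        if T.lo l ≤ w i ∧ w i < T.hi l then ev (Nd (T.t l) (w i)) (z i) else 0| ≤
        if act l then D else 0 := by
      intro l hl
      rw [abs_mul]
      have h1 := H.onepath ha hB (T.t l) (hT.hn l hl) (T.lo l) (T.hi l) p' q'
      have h2 : |(T.c l : ℝ)| ≤ 1 := by exact_mod_cast hT.hc l hl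
      calc _ ≤ 1 * (if act l then D else 0) := by
            refine mul_le_mul h2 ?_ (abs_nonneg _) zero_le_one
            refine h1.trans (le_of_eq ?_)
            congr
        _ = _ := one_mul _
    refine (sum_le_sum this).trans ?_
    rw [← sum_filter, sum_const, nsmul_eq_mul, mul_comm]
  have c1 : (T.ι.filter act).card ≤ T.L ^ 2 := (card_filter_le _ _).trans hT.card
  have c2 : (T.ι.filter act).card ≤ q - p := by
    have hch : ∀ l, ∃ i, act l → (i ∈ Ico p' q' ∧ T.lo l ≤ w i ∧ w i < T.hi l ∧ HasNode (T.t l) (w i)) := by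
      intro l
      by_cases h : act l
      · obtain ⟨i, h1, h2⟩ := h; exact ⟨i, fun _ => ⟨h1, h2⟩⟩
      · exact ⟨0, fun h' => absurd h' h⟩
    choose φ hφ using hch
    have : (T.ι.filter act).card ≤ (Ico p' q').card := by
      refine card_le_card_of_injOn φ (fun l hl => (hφ l (mem_filter.mp hl).2).1) ?_
      intro l hl l' hl' he
      have hl := mem_filter.mp hl
      have hl' := mem_filter.mp hl'
      obtain ⟨-, h1, h2, h3⟩ := hφ l hl.2
      obtain ⟨-, h1', h2', h3'⟩ := hφ l' hl'.2
      rw [← he] at h1' h2' h3'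
      exact hT.disj l hl.1 l' hl'.1 _ h3 h3' h1 h2 h1' h2'
    rw [Nat.card_Ico] at this
    omega
  have b3 := min_sq_div hT.hL c1 c2 hκ0
  have e0 : ∑ i ∈ Ico p q, ev (T.fn (w i) (w i + 1)) (z i) = ∑ i ∈ Ico p q, ev (T.pt (w i)) (z i) :=
    sum_congr rfl fun i _ => by rw [T2.fn_succ]
  change |∑ i ∈ Ico p q, ev (T.fn (w i) (w i + 1)) (z i)| ≤ _
  rw [e0, e1]
  refine (abs_add_le _ _).trans ?_
  have b4 := mul_le_mul_of_nonneg_left b3 hD0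
  have b5 : D * (κ * ((q - p : ℕ) : ℝ)) ≤ ε * ((q - p : ℕ) : ℝ) := by
    rw [← mul_assoc]
    refine mul_le_mul_of_nonneg_right ?_ (Nat.cast_nonneg _)
    rw [hκ, mul_div_assoc', div_le_iff₀ (by positivity)]
    nlinarith
  linarith

/-- The dependent sequence lemma. -/
lemma small (H : Dep C R b x) {a : ℕ → ℝ} {A B : ℝ} (ha : ∀ i, |a i| ≤ A)
    (hB : ∀ p q, |∑ i ∈ Ico p q, a i * ev (b i) (x i)| ≤ B) (ε : ℝ) (hε : 0 < ε) :
    ∃ N : ℝ, 0 ≤ N ∧ ∀ n : ℕ, ‖∑ i ∈ range n, a i • x i‖ ≤ ε * n + N := by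
  obtain ⟨N, hN, h⟩ := (H.bl ha).small (H.matched ha hB) ε hε
  refine ⟨N, hN, fun n => norm_le_of fun f hf => ?_⟩
  have := h f hf 0 n
  rwa [Nat.Ico_zero_eq_range] at this

end Dep

/-- Building dependent sequences. -/
lemma build {β : Type*} {C : ℝ} (Q : ℕ → ℕ → V → Fn → β → Prop)
    (hQ : ∀ i j N : ℕ, ∃ x b y, WW j b ∧ Exact C j x ∧ (∃ N', N ≤ N' ∧ Sup N N' x ∧ Sup N N' b) ∧
      Q i j x b y) :
    ∃ (R : ℕ → ℕ) (b : ℕ → Fn) (x : ℕ → V) (y : ℕ → β), Dep C R b x ∧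
      ∀ i, Q i (sg (pth b i)) (x i) (b i) (y i) := by
  choose X B Y hQ using hQ
  choose hW hE hQ hq using hQ
  choose N' hN hX hB using hQ
  -- state: path and position
  let st : ℕ → List Fn × ℕ := fun i => Nat.rec ([], 0)
    (fun i s => (B i (sg s.1) s.2 :: s.1, N' i (sg s.1) s.2)) i
  have st1 : ∀ i, st (i + 1) = (B i (sg (st i).1) (st i).2 :: (st i).1, N' i (sg (st i).1) (st i).2) :=
    fun i => rfl
  set b : ℕ → Fn := fun i => B i (sg (st i).1) (st i).2 with hb
  have hp : ∀ i, pth b i = (st i).1 := by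
    intro i
    induction i with
    | zero => rfl
    | succ i ih => rw [st1]; simp only [pth]; rw [ih]
  have hR : ∀ i, (st (i + 1)).2 = N' i (sg (st i).1) (st i).2 := fun i => rfl
  refine ⟨fun i => (st i).2, b, fun i => X i (sg (st i).1) (st i).2,
    fun i => Y i (sg (st i).1) (st i).2, ⟨?_, ?_, ?_, ?_, ?_⟩, ?_⟩
  · exact monotone_nat_of_le_succ fun i => by rw [hR]; exact hN _ _ _
  · intro i; rw [hR]; exact hX _ _ _
  · intro i; rw [hR]; exact hB _ _ _
  · intro i; rw [hp]; exact hW _ _ _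
  · intro i; rw [hp]; exact hE _ _ _
  · intro i; rw [hp]; exact hq _ _ _

end HJT

namespace HJT
open Finset

def PP (t : List Fn) (α β : ℕ) : Fn := ∑ w ∈ Ico α β, Nd t w

def VP (t : List Fn) : Prop := ∀ c r, (c :: r) <:+ t → WW (sg r) c

lemma VP_nil : VP [] := fun c r h => by simp at h

lemma VP.nd {t : List Fn} (h : VP t) (w : ℕ) : WW w (Nd t w) := by
  by_cases hw : HasNode t w
  · obtain ⟨c, r, h1, rfl⟩ := hw
    rw [Nd_eq h1]; exact h c r h1
  · rw [Nd_zero hw]; exact WW_zero w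

lemma ev_PP (t : List Fn) (α β : ℕ) (x : V) : ev (PP t α β) x = ∑ w ∈ Ico α β, ev (Nd t w) x := by
  unfold PP; rw [ev_sum]

lemma PP_split (t : List Fn) {α β γ : ℕ} (h1 : α ≤ β) (h2 : β ≤ γ) (x : V) :
    ev (PP t α γ) x = ev (PP t α β) x + ev (PP t β γ) x := by
  rw [ev_PP, ev_PP, ev_PP, sum_Ico_consecutive _ h1 h2]

lemma T2.ev_fn_PP (T : T2) (α β : ℕ) (x : V) : ev (T.fn α β) x =
    (∑ l ∈ T.ι, (T.c l : ℝ) * ev (PP (T.t l) (max (T.lo l) α) (min (T.hi l) β)) (rs T.a T.b x)) / T.L := by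
  rw [ev_fn, sum_congr rfl fun w _ => T.ev_pt w x, ← sum_div, sum_comm]
  congr 1
  refine sum_congr rfl fun l _ => ?_
  rw [ev_PP, mul_sum, ← sum_filter]
  refine sum_congr ?_ fun _ _ => rfl
  ext w
  simp only [mem_filter, mem_Ico]
  omega

/-- a weight-disjoint family of paths -/
lemma PP_fam {ι : Finset ℕ} {t : ℕ → List Fn} {α β : ℕ → ℕ} {L : ℕ} (hL : 1 ≤ L)
    (hc : ι.card ≤ L ^ 2) (hα : ∀ l ∈ ι, L ≤ α l) (hV : ∀ l ∈ ι, VP (t l))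
    (disj : ∀ l ∈ ι, ∀ l' ∈ ι, ∀ w, HasNode (t l) w → HasNode (t l') w →
      α l ≤ w → w < β l → α l' ≤ w → w < β l' → l = l') (x : V) :
    ∑ l ∈ ι, |ev (PP (t l) (α l) (β l)) x| ≤ L * ‖x‖ := by
  classical
  obtain ⟨B, hB⟩ := exists_Sup x
  let T : T2 := ⟨L, ι, t, α, β, fun l => if 0 ≤ ev (PP (t l) (α l) (β l)) x then 1 else -1, 0, B⟩
  have hT : T.Val := by
    refine ⟨⟨hL, hc, fun l _ => ?_, hα, disj⟩, hV⟩
    simp only [T]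
    split_ifs <;> simp
  have h := ev_le (hT.mem 0 (ι.sup β)) x
  rw [T.ev_fn_PP] at h
  have e : ∑ l ∈ T.ι, (T.c l : ℝ) * ev (PP (T.t l) (max (T.lo l) 0) (min (T.hi l) (ι.sup β)))
      (rs T.a T.b x) = ∑ l ∈ ι, |ev (PP (t l) (α l) (β l)) x| := by
    refine sum_congr rfl fun l hl => ?_
    have h1 : min (β l) (ι.sup β) = β l := min_eq_left (le_sup hl)
    simp only [T, Nat.max_zero, h1, hB.rs_eq le_rfl le_rfl]
    split_ifs with h0
    · rw [abs_of_nonneg h0]; simp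
    · rw [abs_of_neg (not_le.mp h0)]; simp
  rw [e] at h
  have hL' : (0:ℝ) < L := by exact_mod_cast hL
  have h2 := (le_abs_self _).trans h
  rw [div_le_iff₀ (by exact hL')] at h2
  rw [mul_comm]; exact h2

lemma PP_le {t : List Fn} (ht : VP t) (α β : ℕ) (x : V) : |ev (PP t α β) x| ≤ ‖x‖ := by
  have h := PP_fam (ι := {0}) (t := fun _ => t) (α := fun _ => max α 1) (β := fun _ => β) (L := 1)
    le_rfl (by simp) (by simp) (by simpa using ht) (by
      intro l hl l' hl'; rw [mem_singleton] at hl hl'; intros; rw [hl, hl']) x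
  rw [sum_singleton, Nat.cast_one, one_mul] at h
  refine le_trans (le_of_eq ?_) h
  congr 1
  rw [ev_PP, ev_PP]
  symm
  refine sum_subset (Ico_subset_Ico_left (le_max_left _ _)) fun w h1 h2 => ?_
  simp only [mem_Ico] at h1 h2
  have : w = 0 := by omega
  rw [Nd_zero, ev_zero]
  rintro ⟨c, r, _, hr⟩
  have := sg_pos r
  omega

/-- tail estimate -/
lemma PP_tail {t : List Fn} (ht : VP t) (α β : ℕ) (x : V) :
    |ev (PP t α β) x| ≤ 2 * l1 x / mm α := by
  rw [ev_PP]
  refine (abs_sum_le_sum_abs _ _).trans ((sum_le_sum fun w _ => WW_le_l1 (ht.nd w) x).trans ?_)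
  have := mul_le_mul_of_nonneg_left (sum_inv_mm α β) (l1_nonneg x)
  rw [mul_sum] at this
  refine le_trans (le_of_eq (sum_congr rfl fun w _ => by ring)) (this.trans (le_of_eq (by ring)))

lemma T2_tail {T : T2} (hT : T.Val) (α β : ℕ) (x : V) :
    |ev (T.fn α β) x| ≤ 2 * l1 x / mm α := by
  rw [ev_fn]
  refine (abs_sum_le_sum_abs _ _).trans ((sum_le_sum fun w _ => WW_le_l1 (hT.pt_mem w) x).trans ?_)
  have := mul_le_mul_of_nonneg_left (sum_inv_mm α β) (l1_nonneg x)
  rw [mul_sum] at this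
  refine le_trans (le_of_eq (sum_congr rfl fun w _ => by ring)) (this.trans (le_of_eq (by ring)))

lemma PP_head {t : List Fn} (ht : VP t) {α β γ : ℕ} {x : V}
    (hx : ∀ w f, WW w f → w < γ → |ev f x| ≤ 2 / mm w) (h : β ≤ γ) :
    |ev (PP t α β) x| ≤ 4 / mm α := by
  rw [ev_PP]
  refine (abs_sum_le_sum_abs _ _).trans ((sum_le_sum fun w hw => hx w _ (ht.nd w)
    ((mem_Ico.mp hw).2.trans_le h)).trans ?_)
  have := mul_le_mul_of_nonneg_left (sum_inv_mm α β) (show (0:ℝ) ≤ 2 by norm_num)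
  rw [mul_sum] at this
  refine le_trans (le_of_eq (sum_congr rfl fun w _ => by ring)) (this.trans (le_of_eq (by ring)))

/-- Data giving the matching bound. -/
structure NC (R : ℕ → ℕ) (d : ℕ → V) (lo hi : ℕ → ℕ) (η : ℕ → ℝ) : Prop where
  blk : Blk R d
  nd : ∀ i, ‖d i‖ ≤ 2
  lohi : ∀ i, lo i < hi i
  hilo : ∀ i j, i < j → hi i ≤ lo j
  pos : ∀ i, 0 < η i
  small : ∀ i, η i ≤ 1 / 2 ^ i
  anti : Antitone η
  fast : ∀ i, η (i + 1) * (hi i + 1) ≤ η i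
  nc : ∀ i i', i < i' → ∀ t, VP t → ∀ α β, lo i' ≤ α → β ≤ hi i' →
    η i < |ev (PP t α β) (d i')| → |ev (PP t (lo i) (hi i)) (d i)| ≤ η i

lemma sqrt_choice {n L : ℕ} (hn : 1 ≤ n) (hL : n ≤ L ^ 2) :
    ∃ M, 1 ≤ M ∧ M ≤ L ∧ n ≤ M ^ 2 ∧ M ^ 2 ≤ 4 * n := by
  have h1 := Nat.sqrt_le' n
  have h2 := Nat.lt_succ_sqrt' n
  have h3 : 1 ≤ Nat.sqrt n := Nat.sqrt_pos.mpr hn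
  have hL1 : 1 ≤ L := by
    rcases Nat.eq_zero_or_pos L with h | h
    · subst h; omega
    · exact h
  rcases le_total L (Nat.sqrt n + 1) with h | h
  · refine ⟨L, hL1, le_rfl, hL, ?_⟩
    nlinarith
  · refine ⟨Nat.sqrt n + 1, by omega, h, h2.le, ?_⟩
    nlinarith

namespace NC
variable {R : ℕ → ℕ} {d : ℕ → V} {lo hi : ℕ → ℕ} {η : ℕ → ℝ}

lemma hi_gt (H : NC R d lo hi η) (i : ℕ) : i < hi i := by
  induction i with
  | zero => have := H.lohi 0; omega
  | succ i ih => have := H.lohi (i + 1); have := H.hilo i (i + 1) (by omega); omega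

lemma hi_mono (H : NC R d lo hi η) : Monotone hi := monotone_nat_of_le_succ fun i =>
  (H.hilo i (i + 1) (by omega)).trans (H.lohi _).le

/-- the two-window property -/
lemma two (H : NC R d lo hi η) {t : List Fn} (ht : VP t) (a b : ℕ) (I : Finset ℕ) (k : ℕ)
    (hI : ∀ i ∈ I, k ≤ i ∧ η k < |ev (PP t (max a (lo i)) (min b (hi i))) (d i)|) :
    I.card ≤ 2 := by
  classical
  rcases I.eq_empty_or_nonempty with rfl | hne
  · simp
  set m := I.max' hne with hm
  have hmI := max'_mem I hne
  have key : ∀ i ∈ I.erase m, lo i < a ∧ a < hi i := by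
    intro i hi'
    obtain ⟨h1, h2⟩ := mem_erase.mp hi'
    have him : i < m := lt_of_le_of_ne (le_max' I i h2) h1
    have ne : ∀ i ∈ I, max a (lo i) < min b (hi i) := by
      intro i hi2
      by_contra hcon
      have h3 := (hI i hi2).2
      rw [PP, Ico_eq_empty_of_le (not_lt.mp hcon), sum_empty, ev_zero, abs_zero] at h3
      linarith [H.pos k]
    have n1 := ne i h2
    have n2 := ne m hmI
    have h4 := (hI i h2).2
    have h5 := (hI m hmI).2
    have hk := H.anti (hI i h2).1
    have h6 := H.nc i m him t ht _ _ (le_max_right _ _) (min_le_right _ _) (lt_of_le_of_lt hk h5)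
    have h7 := H.hilo i m him
    refine ⟨?_, by omega⟩
    by_contra hcon
    have e1 : max a (lo i) = lo i := by omega
    have e2 : min b (hi i) = hi i := by omega
    rw [e1, e2] at h4
    linarith
  have : (I.erase m).card ≤ 1 := card_le_one.mpr fun i hi1 j hj1 => by
    have h1 := key i hi1
    have h2 := key j hj1
    by_contra hne
    rcases lt_or_gt_of_ne hne with h | h
    · have := H.hilo i j h; omega
    · have := H.hilo j i h; omega
  have h8 := card_erase_add_one hmI
  rw [← hm] at h8
  omega

lemma mt (H : NC R d lo hi η) (T : T2) (hT : T.Val) (ε : ℝ) (hε : 0 < ε) (hε1 : ε ≤ 1)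
    (I : Finset ℕ) :
    ∑ i ∈ I, |ev (T.fn (lo i) (hi i)) (d i)| ≤ ε * I.card + 20 / ε + 10 := by
  classical
  have hL1 : (1:ℝ) ≤ T.L := by exact_mod_cast hT.hL
  -- k
  have hex : ∃ k, T.L < hi k := ⟨T.L, H.hi_gt _⟩
  set k := Nat.find hex with hk
  have hkL : T.L < hi k := Nat.find_spec hex
  have hkmin : ∀ i < k, hi i ≤ T.L := fun i h => not_lt.mp (Nat.find_min hex h)
  set K := ⌈2 / ε⌉₊ + 1 with hK
  have hK1 : (K : ℝ) ≤ 2 / ε + 2 := by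
    have := Nat.ceil_lt_add_one (show 0 ≤ 2 / ε by positivity)
    rw [hK]; push_cast; linarith
  have hK2 : (1:ℝ) / 2 ^ (K - 1) ≤ ε / 2 := by
    have h1 : (2:ℝ) / ε ≤ (⌈2 / ε⌉₊ : ℝ) := Nat.le_ceil _
    have h2 : ((⌈2 / ε⌉₊ : ℕ) : ℝ) ≤ 2 ^ ⌈2 / ε⌉₊ := by exact_mod_cast Nat.lt_two_pow_self.le
    have h3 : K - 1 = ⌈2 / ε⌉₊ := by omega
    rw [h3, div_le_div_iff₀ (by positivity) (by norm_num)]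
    have h4 : 2 / ε ≤ 2 ^ ⌈2 / ε⌉₊ := h1.trans h2
    rw [div_le_iff₀ hε] at h4
    linarith
  set k' := max (k + 1) K with hk'
  set θ := η k' with hθ
  have hθ0 := H.pos k'
  have hLθ : T.L * θ ≤ ε / 2 := by
    obtain ⟨m, hm⟩ : ∃ m, k' = m + 1 := ⟨k' - 1, by omega⟩
    have h1 := H.fast m
    rw [← hm] at h1
    have h2 : T.L < hi m := hkL.trans_le (H.hi_mono (by omega))
    have h2' : (T.L : ℝ) ≤ hi m := by exact_mod_cast h2.le
    have h3 := H.small m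
    have h4 : (1:ℝ) / 2 ^ m ≤ 1 / 2 ^ (K - 1) :=
      one_div_le_one_div_of_le (by positivity) (pow_le_pow_right₀ (by norm_num) (by omega))
    nlinarith
  let av : ℕ → ℕ → ℝ := fun l i => |ev (PP (T.t l) (max (T.lo l) (lo i)) (min (T.hi l) (hi i))) (d i)|
  let A : ℕ → Finset ℕ := fun i => if k' ≤ i then T.ι.filter fun l => θ < av l i else ∅
  have hd : ∀ i, |ev (T.fn (lo i) (hi i)) (d i)| ≤ 2 := fun i =>
    (ev_le (hT.mem _ _) _).trans (H.nd i)
  set κ := ε / 2 with hκ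
  have hκ0 : 0 < κ := by positivity
  set Γ : ℝ := 4 / (κ * (T.L : ℝ) ^ 2) with hΓ
  have hΓ0 : 0 ≤ Γ := by positivity
  -- pointwise bound
  have pw : ∀ i ∈ I, |ev (T.fn (lo i) (hi i)) (d i)| ≤
      (if R i < T.a ∧ T.a < R (i + 1) then 2 else 0) + (if R i < T.b ∧ T.b < R (i + 1) then 2 else 0)
      + (if i = k then 2 else 0) + (if i < K then 2 else 0) + (ε + Γ * (A i).card) := by
    intro i hiI
    have hn : 0 ≤ ε + Γ * (A i).card := by positivity
    have p1 : (0:ℝ) ≤ (if R i < T.a ∧ T.a < R (i + 1) then 2 else 0) := by split_ifs <;> norm_num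
    have p2 : (0:ℝ) ≤ (if R i < T.b ∧ T.b < R (i + 1) then 2 else 0) := by split_ifs <;> norm_num
    have p3 : (0:ℝ) ≤ (if i = k then 2 else 0) := by split_ifs <;> norm_num
    have p4 : (0:ℝ) ≤ (if i < K then 2 else 0) := by split_ifs <;> norm_num
    by_cases c1 : R i < T.a ∧ T.a < R (i + 1)
    · rw [if_pos c1]; linarith [hd i]
    by_cases c2 : R i < T.b ∧ T.b < R (i + 1)
    · rw [if_pos c2]; linarith [hd i]
    by_cases c3 : i = k
    · rw [if_pos c3]; linarith [hd i]
    by_cases c4 : i < K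
    · rw [if_pos c4]; linarith [hd i]
    refine le_trans ?_ (show ε + Γ * (A i).card ≤ _ by linarith)
    clear p1 p2 p3 p4
    rw [T.ev_fn_PP]
    by_cases c5 : i < k
    · rw [sum_eq_zero, zero_div, abs_zero]
      · exact hn
      · intro l hl
        have := hkmin i c5
        have := hT.hlo l hl
        rw [PP, Ico_eq_empty_of_le (by omega), sum_empty, ev_zero, mul_zero]
    have hik : k' ≤ i := by omega
    by_cases c6 : T.a ≤ R i ∧ R (i + 1) ≤ T.b
    swap
    · rw [(H.blk.sup i).rs_eq_zero (by omega)]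
      simpa using hn
    rw [(H.blk.sup i).rs_eq c6.1 c6.2]
    have b1 : |∑ l ∈ T.ι, (T.c l : ℝ) * ev (PP (T.t l) (max (T.lo l) (lo i)) (min (T.hi l) (hi i))) (d i)|
        ≤ ∑ l ∈ T.ι, av l i := by
      refine (abs_sum_le_sum_abs _ _).trans (sum_le_sum fun l hl => ?_)
      rw [abs_mul]
      have h2 : |(T.c l : ℝ)| ≤ 1 := by exact_mod_cast hT.hc l hl
      exact mul_le_of_le_one_left (abs_nonneg _) h2
    have b2 : ∑ l ∈ T.ι, av l i = ∑ l ∈ A i, av l i + ∑ l ∈ T.ι.filter (fun l => ¬ θ < av l i), av l i := by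
      simp only [A, if_pos hik]
      exact (sum_filter_add_sum_filter_not _ _ _).symm
    have b3 : ∑ l ∈ T.ι.filter (fun l => ¬ θ < av l i), av l i ≤ (T.L : ℝ) ^ 2 * θ := by
      refine (sum_le_card_nsmul _ _ θ fun l hl => not_lt.mp (mem_filter.mp hl).2).trans ?_
      rw [nsmul_eq_mul]
      refine mul_le_mul_of_nonneg_right ?_ hθ0.le
      exact_mod_cast (card_filter_le _ _).trans hT.card
    have b4 : ∑ l ∈ A i, av l i ≤ T.L * (κ + Γ * (A i).card) := by
      rcases (A i).eq_empty_or_nonempty with he | hne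
      · rw [he]; simp; positivity
      have hsub : A i ⊆ T.ι := by simp only [A, if_pos hik]; exact filter_subset _ _
      obtain ⟨M, hM1, hML, hM2, hM3⟩ := sqrt_choice (card_pos.mpr hne)
        ((card_le_card hsub).trans hT.card)
      have h1 := PP_fam (ι := A i) (t := T.t) (α := fun l => max (T.lo l) (lo i))
        (β := fun l => min (T.hi l) (hi i)) hM1 hM2
        (fun l hl => (hML.trans (hT.hlo l (hsub hl))).trans (le_max_left _ _))
        (fun l hl => hT.hn l (hsub hl))
        (fun l hl l' hl' w h1 h2 h3 h4 h5 h6 => hT.disj l (hsub hl) l' (hsub hl') w h1 h2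
          (by omega) (by omega) (by omega) (by omega)) (d i)
      have h2 : (M : ℝ) * ‖d i‖ ≤ M * 2 := mul_le_mul_of_nonneg_left (H.nd i) (Nat.cast_nonneg _)
      refine (h1.trans h2).trans ?_
      have h3 : (M : ℝ) ^ 2 ≤ 4 * (A i).card := by exact_mod_cast hM3
      have h4 : Γ * (A i).card * (κ * (T.L : ℝ) ^ 2) = 4 * (A i).card := by
        rw [hΓ]; field_simp
      have hMpos : (0:ℝ) ≤ M := Nat.cast_nonneg _
      -- 2 M L ≤ κ L² + M²/κ
      have h5 : (M : ℝ) * 2 * (κ * T.L) ≤ T.L * (κ + Γ * (A i).card) * (κ * T.L) := by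
        nlinarith [sq_nonneg ((M:ℝ) - κ * T.L)]
      exact le_of_mul_le_mul_right h5 (by positivity)
    rw [abs_div, abs_of_pos (show (0:ℝ) < T.L by linarith), div_le_iff₀ (by linarith)]
    have : (T.L:ℝ) ^ 2 * θ ≤ T.L * (ε / 2) := by nlinarith
    have e : T.L * (κ + Γ * (A i).card) = T.L * (ε / 2) + (Γ * (A i).card) * T.L := by rw [hκ]; ring
    calc _ ≤ _ := b1
      _ ≤ T.L * (ε / 2) + (Γ * (A i).card) * T.L + T.L * (ε / 2) := by linarith
      _ = _ := by ring
  refine (sum_le_sum pw).trans ?_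
  rw [sum_add_distrib, sum_add_distrib, sum_add_distrib, sum_add_distrib, sum_add_distrib]
  have uq : ∀ c : ℕ, ∀ i j : ℕ, R i < c ∧ c < R (i + 1) → R j < c ∧ c < R (j + 1) → i = j := by
    intro c i j h1 h2
    by_contra hne
    rcases lt_or_gt_of_ne hne with h | h
    · have := H.blk.mono (show i + 1 ≤ j from h); omega
    · have := H.blk.mono (show j + 1 ≤ i from h); omega
  have s1 := card_filter_le_one_sum (s := I)
    (p := fun i => R i < T.a ∧ T.a < R (i + 1)) (C := 2) (by norm_num) (fun i _ j _ => uq _ i j)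
  have s2 := card_filter_le_one_sum (s := I)
    (p := fun i => R i < T.b ∧ T.b < R (i + 1)) (C := 2) (by norm_num) (fun i _ j _ => uq _ i j)
  have s3 := card_filter_le_one_sum (s := I)
    (p := fun i => i = k) (C := 2) (by norm_num) (fun i _ j _ h1 h2 => h1.trans h2.symm)
  have s4 : ∑ i ∈ I, (if i < K then (2:ℝ) else 0) ≤ 2 * K := by
    rw [← sum_filter, sum_const, nsmul_eq_mul, mul_comm]
    refine mul_le_mul_of_nonneg_left ?_ (by norm_num)
    have : (I.filter (· < K)) ⊆ range K := fun i hi => mem_range.mpr (mem_filter.mp hi).2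
    have h := card_le_card this
    rw [card_range] at h
    exact_mod_cast h
  have s5 : ∑ i ∈ I, ε = ε * I.card := by rw [sum_const, nsmul_eq_mul, mul_comm]
  have s6 : ∑ i ∈ I, Γ * ((A i).card : ℝ) ≤ 16 / ε := by
    rw [← mul_sum]
    have h1 : ∑ i ∈ I, (A i).card ≤ 2 * T.L ^ 2 := by
      have e : ∀ i ∈ I, (A i).card = ∑ l ∈ T.ι, if l ∈ A i then 1 else 0 := by
        intro i _
        rw [← card_filter]
        congr 1
        ext l
        simp only [mem_filter]
        refine ⟨fun h => ⟨?_, h⟩, fun h => h.2⟩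
        simp only [A] at h
        split_ifs at h
        · exact (mem_filter.mp h).1
        · simp at h
      rw [sum_congr rfl e, sum_comm]
      have h2 : ∀ l ∈ T.ι, (∑ i ∈ I, if l ∈ A i then 1 else 0) ≤ 2 := by
        intro l hl
        rw [← card_filter]
        refine H.two (hT.hn l hl) (T.lo l) (T.hi l) _ k' fun i hi' => ?_
        have h := (mem_filter.mp hi').2
        simp only [A] at h
        split_ifs at h with h3
        · exact ⟨h3, (mem_filter.mp h).2⟩
        · simp at h
      refine (sum_le_card_nsmul _ _ 2 h2).trans ?_
      rw [smul_eq_mul, mul_comm]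
      exact Nat.mul_le_mul_left _ hT.card
    have h1' : ∑ i ∈ I, ((A i).card : ℝ) ≤ 2 * (T.L : ℝ) ^ 2 := by exact_mod_cast h1
    refine (mul_le_mul_of_nonneg_left h1' hΓ0).trans (le_of_eq ?_)
    rw [hΓ, hκ]; field_simp; norm_num
  have e3 : (20:ℝ) / ε = 16 / ε + 2 * (2 / ε) := by ring
  rw [e3]
  linarith

end NC
end HJT

namespace HJT
open Finset Filter Topology

structure Pre (R : ℕ → ℕ) (y : ℕ → V) (lo hi : ℕ → ℕ) : Prop where
  blk : Blk R y
  ny : ∀ i, ‖y i‖ ≤ 1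
  lohi : ∀ i, lo i < hi i
  hilo : ∀ i j, i < j → hi i ≤ lo j
  h4 : ∀ i w f, WW w f → w < lo i → |ev f (y i)| ≤ 2 / mm w
  h5 : ∀ i, 2 * l1 (y i) / mm (hi i) ≤ 1 / 2 ^ i

def Bad (y : ℕ → V) (lo hi : ℕ → ℕ) (δ : ℝ) (t : List Fn) (x : ℕ) : Prop :=
  ∃ α β, lo x ≤ α ∧ β ≤ hi x ∧ δ < |ev (PP t α β) (y x)|

namespace Pre
variable {R : ℕ → ℕ} {y : ℕ → V} {lo hi : ℕ → ℕ}

lemma lo_ge (H : Pre R y lo hi) (i : ℕ) : i ≤ lo i := by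
  induction i with
  | zero => exact Nat.zero_le _
  | succ i ih => have := H.lohi i; have := H.hilo i (i + 1) (by omega); omega

lemma fam_aux (δ : ℝ) (x : ℕ) (n : ℕ) :
    (∃ (t : ℕ → List Fn) (α β : ℕ → ℕ), (∀ l < n, VP (t l) ∧ lo x ≤ α l ∧ β l ≤ hi x ∧
      δ < |ev (PP (t l) (α l) (β l)) (y x)|) ∧ ∀ l < n, ∀ l' < n, ∀ w, HasNode (t l) w →
      HasNode (t l') w → α l ≤ w → w < β l → α l' ≤ w → w < β l' → l = l') ∨
    (∃ F : ℕ → List Fn, (∀ a, VP (F a)) ∧ ∀ t, VP t → Bad y lo hi δ t x →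
      ∃ a < n, ∃ w, lo x ≤ w ∧ HasNode t w ∧ HasNode (F a) w) := by
  induction n with
  | zero => left; exact ⟨fun _ => [], fun _ => 0, fun _ => 0, by simp, by simp⟩
  | succ n ih =>
    rcases ih with ⟨t, α, β, h1, h2⟩ | ⟨F, hF, h⟩
    swap
    · right
      exact ⟨F, hF, fun t ht hb => by
        obtain ⟨a, ha, w, hw⟩ := h t ht hb; exact ⟨a, by omega, w, hw⟩⟩
    by_cases hc : ∃ s a b, VP s ∧ lo x ≤ a ∧ b ≤ hi x ∧ δ < |ev (PP s a b) (y x)| ∧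
        ∀ l < n, ∀ w, HasNode (t l) w → HasNode s w → α l ≤ w → w < β l → a ≤ w → w < b → False
    · obtain ⟨s, a, b, hs, ha, hb, hd, hdis⟩ := hc
      left
      refine ⟨Function.update t n s, Function.update α n a, Function.update β n b, ?_, ?_⟩
      · intro l hl
        rcases Nat.lt_succ_iff_lt_or_eq.mp hl with h | rfl
        · simp only [Function.update_of_ne h.ne]; exact h1 l h
        · simp only [Function.update_self]; exact ⟨hs, ha, hb, hd⟩
      · intro l hl l' hl' w
        rcases Nat.lt_succ_iff_lt_or_eq.mp hl with h | rfl <;>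
          rcases Nat.lt_succ_iff_lt_or_eq.mp hl' with h' | rfl
        · simp only [Function.update_of_ne h.ne, Function.update_of_ne h'.ne]
          exact h2 l h l' h' w
        · simp only [Function.update_of_ne h.ne, Function.update_self]
          intro a1 a2 a3 a4 a5 a6
          exact (hdis l h w a1 a2 a3 a4 a5 a6).elim
        · simp only [Function.update_of_ne h'.ne, Function.update_self]
          intro a1 a2 a3 a4 a5 a6
          exact (hdis l' h' w a2 a1 a5 a6 a3 a4).elim
        · intros; rfl
    · right
      refine ⟨fun a => if a < n then t a else [], fun a => ?_, fun s hs hb => ?_⟩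
      · dsimp only
        split_ifs with h
        · exact (h1 a h).1
        · exact VP_nil
      · obtain ⟨a, b, ha, hb, hd⟩ := hb
        by_contra hcon
        apply hc
        refine ⟨s, a, b, hs, ha, hb, hd, fun l hl w e1 e2 e3 e4 e5 e6 => hcon ?_⟩
        exact ⟨l, by omega, w, by omega, e2, by dsimp only; rw [if_pos hl]; exact e1⟩

lemma fam (H : Pre R y lo hi) {δ : ℝ} (hδ : 0 < δ) : ∃ N L0 : ℕ, ∀ x, L0 ≤ x →
    ∃ F : ℕ → List Fn, (∀ a, VP (F a)) ∧ ∀ t, VP t → Bad y lo hi δ t x →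
      ∃ a < N, ∃ w, lo x ≤ w ∧ HasNode t w ∧ HasNode (F a) w := by
  set L := ⌈2 / δ⌉₊ + 1 with hL
  refine ⟨L ^ 2, L, fun x hx => ?_⟩
  rcases fam_aux (y := y) (lo := lo) (hi := hi) δ x (L ^ 2) with ⟨t, α, β, h1, h2⟩ | h
  swap
  · exact h
  exfalso
  have h3 := PP_fam (ι := range (L ^ 2)) (t := t) (α := α) (β := β) (L := L) (by omega) (by simp)
    (fun l hl => (hx.trans (H.lo_ge x)).trans (h1 l (mem_range.mp hl)).2.1)
    (fun l hl => (h1 l (mem_range.mp hl)).1)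
    (fun l hl l' hl' => h2 l (mem_range.mp hl) l' (mem_range.mp hl')) (y x)
  have h4 : (L ^ 2 : ℝ) * δ ≤ ∑ l ∈ range (L ^ 2), |ev (PP (t l) (α l) (β l)) (y x)| := by
    have := card_nsmul_le_sum (range (L ^ 2)) (fun l => |ev (PP (t l) (α l) (β l)) (y x)|) δ
      (fun l hl => (h1 l (mem_range.mp hl)).2.2.2.le)
    rw [card_range, nsmul_eq_mul] at this
    exact_mod_cast this
  have h5 : 2 / δ ≤ L := by
    have := Nat.le_ceil (2 / δ)
    rw [hL]; push_cast; linarith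
  rw [div_le_iff₀ hδ] at h5
  have h6 := H.ny x
  have h7 : (0:ℝ) < L := by rw [hL]; positivity
  nlinarith

lemma ultra_lim (𝒰 : Ultrafilter ℕ) (u : ℕ → ℝ) (h : ∀ n, |u n| ≤ 1) :
    ∃ c, |c| ≤ 1 ∧ Tendsto u 𝒰 (𝓝 c) := by
  have := (isCompact_Icc (a := (-1:ℝ)) (b := 1)).ultrafilter_le_nhds (𝒰.map u) (by
    rw [Filter.le_principal_iff]
    show ∀ᶠ n in (𝒰 : Filter ℕ), u n ∈ Set.Icc (-1:ℝ) 1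
    exact Filter.Eventually.of_forall fun n => abs_le.mp (h n))
  obtain ⟨c, hc, h⟩ := this
  exact ⟨c, abs_le.mpr hc, h⟩

lemma hyper_ge (n : ℕ) : ∀ᶠ x in (hyperfilter ℕ : Filter ℕ), n ≤ x :=
  (Nat.hyperfilter_le_atTop) (eventually_ge_atTop n)

lemma PQ (H : Pre R y lo hi) {δ : ℝ} (hδ : 0 < δ) {S : Set ℕ} (hS : S ∈ (hyperfilter ℕ : Filter ℕ)) :
    ∃ p ∈ S, ∃ q ∈ S, p < q ∧ ∀ᶠ x in (hyperfilter ℕ : Filter ℕ), ∀ t, VP t → Bad y lo hi δ t x →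
      |ev (PP t (lo p) (hi p)) (y p) - ev (PP t (lo q) (hi q)) (y q)| ≤ δ := by
  obtain ⟨N, L0, hN⟩ := H.fam hδ
  have hN' : ∀ x, ∃ F : ℕ → List Fn, (∀ a, VP (F a)) ∧ (L0 ≤ x → ∀ t, VP t → Bad y lo hi δ t x →
      ∃ a < N, ∃ w, lo x ≤ w ∧ HasNode t w ∧ HasNode (F a) w) := by
    intro x
    by_cases hx : L0 ≤ x
    · obtain ⟨F, h1, h2⟩ := hN x hx; exact ⟨F, h1, fun _ => h2⟩
    · exact ⟨fun _ => [], fun _ => VP_nil, fun h => absurd h hx⟩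
  choose F hF1 hF2 using hN'
  let v : List Fn → ℕ → ℝ := fun t i => ev (PP t (lo i) (hi i)) (y i)
  have hv : ∀ x a i, |v (F x a) i| ≤ 1 := fun x a i => (PP_le (hF1 x a) _ _ _).trans (H.ny i)
  have hg : ∀ i a, ∃ c, |c| ≤ 1 ∧ Tendsto (fun x => v (F x a) i) (hyperfilter ℕ) (𝓝 c) :=
    fun i a => ultra_lim _ _ fun x => hv x a i
  choose g hg1 hg2 using hg
  have hc : ∀ a, ∃ c, |c| ≤ 1 ∧ Tendsto (fun i => g i a) (hyperfilter ℕ) (𝓝 c) :=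
    fun a => ultra_lim _ _ fun i => hg1 i a
  choose c hc1 hc2 using hc
  have hev : ∀ᶠ i in (hyperfilter ℕ : Filter ℕ), ∀ a ∈ range N, |g i a - c a| < δ / 8 := by
    rw [Filter.eventually_all_finset]
    intro a _
    have := Metric.tendsto_nhds.mp (hc2 a) (δ / 8) (by positivity)
    simpa [Real.dist_eq] using this
  obtain ⟨p, hp, hpS⟩ := (hev.and hS).exists
  obtain ⟨q, ⟨hq, hqS⟩, hpq⟩ := ((hev.and hS).and (hyper_ge (p + 1))).exists
  refine ⟨p, hpS, q, hqS, hpq, ?_⟩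
  have e1 : ∀ i, ∀ᶠ x in (hyperfilter ℕ : Filter ℕ), ∀ a ∈ range N, |v (F x a) i - g i a| < δ / 8 := by
    intro i
    rw [Filter.eventually_all_finset]
    intro a _
    have := Metric.tendsto_nhds.mp (hg2 i a) (δ / 8) (by positivity)
    simpa [Real.dist_eq] using this
  filter_upwards [e1 p, e1 q, hyper_ge L0, hyper_ge (q + 1)] with x h1 h2 h3 h4 t ht hb
  obtain ⟨a, ha, w, hw, w1, w2⟩ := hF2 x h3 t ht hb
  have eq : ∀ i ≤ q, ev (PP t (lo i) (hi i)) (y i) = v (F x a) i := by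
    intro i hi'
    simp only [v, PP]
    congr 2
    refine sum_congr rfl fun w' hw' => ?_
    have := (mem_Ico.mp hw').2
    have := H.hilo i x (by omega)
    exact Nd_common w1 w2 (by omega)
  rw [eq p (by omega), eq q le_rfl]
  have a1 := abs_lt.mp (h1 a (mem_range.mpr ha))
  have a2 := abs_lt.mp (h2 a (mem_range.mpr ha))
  have a3 := abs_lt.mp (hp a (mem_range.mpr ha))
  have a4 := abs_lt.mp (hq a (mem_range.mpr ha))
  rw [abs_le]
  constructor <;> linarith [a1.1, a1.2, a2.1, a2.2, a3.1, a3.2, a4.1, a4.2]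

/-- decomposition of a path functional on `y p - y q` -/
lemma decomp (H : Pre R y lo hi) {p q : ℕ} (hpq : p < q) {t : List Fn} (ht : VP t) {α β : ℕ}
    (h1 : lo p ≤ α) (h2 : β ≤ hi q) :
    |ev (PP t α β) (y p - y q) - (ev (PP t α (min β (hi p))) (y p) - ev (PP t (max α (lo q)) β) (y q))|
      ≤ 1 / 2 ^ p + 4 / mm (lo p) := by
  have hmm := mm_pos (lo p)
  have n1 : (0:ℝ) ≤ 1 / 2 ^ p := by positivity
  have n2 : (0:ℝ) ≤ 4 / mm (lo p) := by positivity
  have A1 : |ev (PP t α β) (y p) - ev (PP t α (min β (hi p))) (y p)| ≤ 1 / 2 ^ p := by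
    rcases le_total β (hi p) with h | h
    · rw [min_eq_left h, sub_self, abs_zero]; exact n1
    · rw [min_eq_right h]
      rcases le_total α (hi p) with h' | h'
      · rw [PP_split t h' h, add_sub_cancel_left]
        exact (PP_tail ht _ _ _).trans (H.h5 p)
      · rw [show ev (PP t α (hi p)) (y p) = 0 by
          rw [PP, Ico_eq_empty_of_le h', sum_empty, ev_zero], sub_zero]
        refine (PP_tail ht _ _ _).trans (le_trans ?_ (H.h5 p))
        have := l1_nonneg (y p)
        exact div_le_div_of_nonneg_left (by positivity) (mm_pos _) (mm_mono' h')
  have A2 : |ev (PP t α β) (y q) - ev (PP t (max α (lo q)) β) (y q)| ≤ 4 / mm (lo p) := by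
    have hm : (4:ℝ) / mm α ≤ 4 / mm (lo p) :=
      div_le_div_of_nonneg_left (by norm_num) hmm (mm_mono' h1)
    rcases le_total (lo q) α with h | h
    · rw [max_eq_left h, sub_self, abs_zero]; exact n2
    · rw [max_eq_right h]
      rcases le_total (lo q) β with h' | h'
      · rw [PP_split t h h', add_sub_cancel_right]
        exact (PP_head ht (H.h4 q) le_rfl).trans hm
      · rw [show ev (PP t (lo q) β) (y q) = 0 by
          rw [PP, Ico_eq_empty_of_le h', sum_empty, ev_zero], sub_zero]
        exact (PP_head ht (H.h4 q) h').trans hm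
  rw [map_sub]
  rw [abs_le] at A1 A2 ⊢
  constructor <;> linarith [A1.1, A1.2, A2.1, A2.2]

structure El where
  p : ℕ
  q : ℕ
  η : ℝ
  G : Set ℕ

structure ElP (y : ℕ → V) (lo hi : ℕ → ℕ) (e : El) : Prop where
  pq : e.p < e.q
  pos : 0 < e.η
  le : e.η ≤ 1
  err : 1 / 2 ^ e.p + 4 / mm (lo e.p) ≤ e.η / 4
  hG : e.G ∈ (hyperfilter ℕ : Filter ℕ)
  nc : ∀ x ∈ e.G, ∀ t, VP t → Bad y lo hi (e.η / 4) t x →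
      |ev (PP t (lo e.p) (hi e.p)) (y e.p) - ev (PP t (lo e.q) (hi e.q)) (y e.q)| ≤ e.η / 4

structure ElR (lo hi : ℕ → ℕ) (e f : El) : Prop where
  qp : e.q < f.p
  pG : f.p ∈ e.G
  qG : f.q ∈ e.G
  half : f.η ≤ e.η / 2
  fast : f.η * (hi e.q + 1) ≤ e.η

lemma err_ev (H : Pre R y lo hi) {η : ℝ} (hη : 0 < η) : ∀ᶠ p in (hyperfilter ℕ : Filter ℕ),
    1 / 2 ^ p + 4 / (mm (lo p) : ℝ) ≤ η / 4 := by
  have h1 : Tendsto (fun p : ℕ => (1 / 2 : ℝ) ^ p + 4 / ((p : ℝ) + 1)) atTop (𝓝 (0 + 0)) := by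
    refine (tendsto_pow_atTop_nhds_zero_of_lt_one (by norm_num) (by norm_num)).add ?_
    have := (tendsto_one_div_add_atTop_nhds_zero_nat (𝕜 := ℝ)).const_mul 4
    simpa [div_eq_mul_inv] using this
  rw [add_zero] at h1
  have h2 := h1.eventually (gt_mem_nhds (show 0 < η / 4 by positivity))
  refine Nat.hyperfilter_le_atTop (h2.mono fun p hp => le_trans ?_ hp.le)
  rw [one_div_pow]
  refine add_le_add le_rfl (div_le_div_of_nonneg_left (by norm_num) (by positivity) ?_)
  have := mm_gt (lo p)
  have h3 := H.lo_ge p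
  exact_mod_cast (show p + 1 ≤ mm (lo p) by omega)

lemma El_seq (H : Pre R y lo hi) : ∃ f : ℕ → El, (∀ n, ElP y lo hi (f n)) ∧
    ∀ m n, m < n → ElR lo hi (f m) (f n) := by
  classical
  refine exists_seq_of_forall_finset_exists (ElP y lo hi) (ElR lo hi) fun s hs => ?_
  have hη : ∀ᶠ η in 𝓝[>] (0:ℝ), ∀ e ∈ s, η ≤ e.η / 2 ∧ η * (hi e.q + 1) ≤ e.η := by
    rw [Filter.eventually_all_finset]
    intro e he
    have hpos := (hs e he).pos
    have h1 : ∀ᶠ η in 𝓝[>] (0:ℝ), η < e.η / (2 * (hi e.q + 1)) :=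
      nhdsWithin_le_nhds (gt_mem_nhds (by positivity))
    filter_upwards [h1, self_mem_nhdsWithin] with η h1 h2
    rw [lt_div_iff₀ (by positivity)] at h1
    have h2 : (0:ℝ) < η := h2
    have h3 : (0:ℝ) ≤ hi e.q := Nat.cast_nonneg _
    constructor <;> nlinarith
  have hη1 : ∀ᶠ η in 𝓝[>] (0:ℝ), η < 1 := nhdsWithin_le_nhds (gt_mem_nhds one_pos)
  obtain ⟨η, ⟨h1, h2⟩, h3⟩ := ((hη.and hη1).and self_mem_nhdsWithin).exists
  have h3 : (0:ℝ) < η := h3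
  have hS : {x | ∀ e ∈ s, x ∈ e.G ∧ e.q + 1 ≤ x} ∩
      {p | 1 / 2 ^ p + 4 / (mm (lo p) : ℝ) ≤ η / 4} ∈ (hyperfilter ℕ : Filter ℕ) := by
    refine Filter.inter_mem ?_ (H.err_ev h3)
    have : ∀ᶠ x in (hyperfilter ℕ : Filter ℕ), ∀ e ∈ s, x ∈ e.G ∧ e.q + 1 ≤ x := by
      rw [Filter.eventually_all_finset]
      exact fun e he => (Filter.Eventually.and (hs e he).hG (hyper_ge _))
    exact this
  obtain ⟨p, hp, q, hq, hpq, hev⟩ := H.PQ (δ := η / 4) (by positivity) hS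
  refine ⟨⟨p, q, η, _⟩, ⟨hpq, h3, h2.le, hp.2, hev, fun x hx => hx⟩, fun e he => ?_⟩
  exact ⟨(hp.1 e he).2, (hp.1 e he).1, (hq.1 e he).1, (h1 e he).1, (h1 e he).2⟩

/-- The selection theorem. -/
theorem ris (H : Pre R y lo hi) : ∃ p q : ℕ → ℕ, (∀ i, p i < q i) ∧ (∀ i, q i < p (i + 1)) ∧
    RIS (fun i => R (p i)) (fun i => y (p i) - y (q i)) (fun i => lo (p i)) (fun i => hi (q i))
      (fun i => 2 / 2 ^ i) := by
  obtain ⟨f, hP, hR⟩ := H.El_seq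
  have hpq := fun i => (hP i).pq
  have hqp := fun i => (hR i (i + 1) (by omega)).qp
  have hpm : StrictMono fun i => (f i).p := strictMono_nat_of_lt_succ fun i => (hpq i).trans (hqp i)
  have hpi : ∀ i, i ≤ (f i).p := fun i => hpm.le_apply
  have hblk : Blk (fun i => R (f i).p) (fun i => y (f i).p - y (f i).q) := by
    refine ⟨H.blk.mono.comp hpm.monotone, fun i => ?_⟩
    have a := hpq i
    have b := hqp i
    refine Sup.sub ((H.blk.sup _).mono le_rfl (H.blk.mono ?_))
      ((H.blk.sup _).mono (H.blk.mono ?_) (H.blk.mono ?_)) <;> omega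
  have hilo : ∀ i j, i < j → hi (f i).q ≤ lo (f j).p := fun i j h => H.hilo _ _ (hR i j h).qp
  have lohi : ∀ i, lo (f i).p < hi (f i).q := fun i =>
    (H.lohi _).trans_le ((H.hilo _ _ (hpq i)).trans (H.lohi _).le)
  have nd2 : ∀ i, ‖y (f i).p - y (f i).q‖ ≤ 2 := fun i =>
    (norm_sub_le _ _).trans (by linarith [H.ny (f i).p, H.ny (f i).q])
  have nc : NC (fun i => R (f i).p) (fun i => y (f i).p - y (f i).q) (fun i => lo (f i).p)
      (fun i => hi (f i).q) (fun i => (f i).η) := by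
    refine ⟨hblk, nd2, lohi, hilo, fun i => (hP i).pos, fun i => ?_, ?_, ?_, ?_⟩
    · induction i with
      | zero => simpa using (hP 0).le
      | succ i ih =>
        have := (hR i (i + 1) (by omega)).half
        have e : (1:ℝ) / 2 ^ (i + 1) = 1 / 2 ^ i / 2 := by rw [pow_succ]; field_simp
        rw [e]; linarith
    · refine antitone_nat_of_succ_le fun i => ?_
      have := (hR i (i + 1) (by omega)).half
      linarith [(hP i).pos]
    · intro i; exact (hR i (i + 1) (by omega)).fast
    · intro i i' hii t ht α β ha hb hη
      have r := hR i i' hii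
      have D := H.decomp (hpq i') ht ha hb
      have D' := H.decomp (hpq i) ht (α := lo (f i).p) (β := hi (f i).q) le_rfl le_rfl
      have m1 : min (hi (f i).q) (hi (f i).p) = hi (f i).p :=
        min_eq_right ((H.hilo _ _ (hpq i)).trans (H.lohi _).le)
      have m2 : max (lo (f i).p) (lo (f i).q) = lo (f i).q :=
        max_eq_right ((H.lohi _).le.trans (H.hilo _ _ (hpq i)))
      rw [m1, m2] at D'
      have hpos := (hP i).pos
      have E1 := (hP i').err
      have E2 := (hP i).err
      have hh := r.half
      have key : |ev (PP t (lo (f i).p) (hi (f i).p)) (y (f i).p) -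
          ev (PP t (lo (f i).q) (hi (f i).q)) (y (f i).q)| ≤ (f i).η / 4 := by
        by_cases c1 : (f i).η / 4 < |ev (PP t α (min β (hi (f i').p))) (y (f i').p)|
        · exact (hP i).nc _ r.pG t ht ⟨_, _, ha, min_le_right _ _, c1⟩
        by_cases c2 : (f i).η / 4 < |ev (PP t (max α (lo (f i').q)) β) (y (f i').q)|
        · exact (hP i).nc _ r.qG t ht ⟨_, _, le_max_right _ _, hb, c2⟩
        exfalso
        rw [not_lt] at c1 c2
        have t1 := abs_sub_abs_le_abs_sub (ev (PP t α β) (y (f i').p - y (f i').q))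
          (ev (PP t α (min β (hi (f i').p))) (y (f i').p) - ev (PP t (max α (lo (f i').q)) β) (y (f i').q))
        have t2 := abs_sub (ev (PP t α (min β (hi (f i').p))) (y (f i').p))
          (ev (PP t (max α (lo (f i').q)) β) (y (f i').q))
        linarith
      have t1 := abs_sub_abs_le_abs_sub (ev (PP t (lo (f i).p) (hi (f i).q)) (y (f i).p - y (f i).q))
        (ev (PP t (lo (f i).p) (hi (f i).p)) (y (f i).p) -
          ev (PP t (lo (f i).q) (hi (f i).q)) (y (f i).q))
      show |ev (PP t (lo (f i).p) (hi (f i).q)) (y (f i).p - y (f i).q)| ≤ (f i).η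
      linarith
  have hl1 : ∀ i w, hi (f i).q ≤ w → 2 * l1 (y (f i).p) / mm w + 2 * l1 (y (f i).q) / mm w ≤ 2 / 2 ^ i := by
    intro i w hw
    have aux : ∀ r, i ≤ r → hi r ≤ w → 2 * l1 (y r) / mm w ≤ 1 / 2 ^ i := by
      intro r h1 h2
      have := l1_nonneg (y r)
      calc _ ≤ 2 * l1 (y r) / mm (hi r) :=
            div_le_div_of_nonneg_left (by positivity) (mm_pos _) (mm_mono' h2)
        _ ≤ 1 / 2 ^ r := H.h5 r
        _ ≤ 1 / 2 ^ i := one_div_le_one_div_of_le (by positivity)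
            (pow_le_pow_right₀ (by norm_num) h1)
    have a1 := aux (f i).p (hpi i) (((H.hilo _ _ (hpq i)).trans (H.lohi _).le).trans hw)
    have a2 := aux (f i).q ((hpi i).trans (hpq i).le) hw
    calc _ ≤ 1 / 2 ^ i + (1:ℝ) / 2 ^ i := add_le_add a1 a2
      _ = _ := by ring
  refine ⟨fun i => (f i).p, fun i => (f i).q, hpq, hqp, ⟨⟨hblk, by norm_num, by norm_num,
    fun i => (nd2 i).trans (by norm_num), fun i => (lohi i).le, hilo, ?_, ?_, ?_,
    fun i => by positivity, ?_⟩, nc.mt⟩⟩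
  · intro i w g hg hw
    rw [map_sub]
    have a1 := H.h4 (f i).p w g hg hw
    have a2 := H.h4 (f i).q w g hg (hw.trans ((H.lohi _).trans_le (H.hilo _ _ (hpq i))))
    refine (abs_sub _ _).trans ?_
    calc _ ≤ 2 / (mm w : ℝ) + 2 / mm w := add_le_add a1 a2
      _ = 4 / mm w := by ring
  · intro i w g hg hw
    rw [map_sub]
    have a1 := WW_le_l1 hg (y (f i).p)
    have a2 := WW_le_l1 hg (y (f i).q)
    have a3 := hl1 i w hw
    have b1 : 0 ≤ l1 (y (f i).p) / mm w := div_nonneg (l1_nonneg _) (Nat.cast_nonneg _)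
    have b2 : 0 ≤ l1 (y (f i).q) / mm w := div_nonneg (l1_nonneg _) (Nat.cast_nonneg _)
    rw [mul_div_assoc, mul_div_assoc] at a3
    refine (abs_sub _ _).trans ?_
    linarith
  · intro i T hT β
    rw [map_sub]
    have a1 := T2_tail hT (hi (f i).q) β (y (f i).p)
    have a2 := T2_tail hT (hi (f i).q) β (y (f i).q)
    have a3 := hl1 i _ le_rfl
    refine (abs_sub _ _).trans ?_
    linarith
  · intro s
    have h2 : ∑ i ∈ s, (2:ℝ) / 2 ^ i = 2 * ∑ i ∈ s, (1 / 2 : ℝ) ^ i := by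
      rw [mul_sum]; refine sum_congr rfl fun i _ => ?_
      rw [one_div_pow]; ring
    rw [h2]
    have := summable_geometric_two.sum_le_tsum s (fun i _ => by positivity)
    rw [tsum_geometric_two] at this
    linarith

end Pre
end HJT

namespace HJT
open Finset Filter Topology

lemma build_pre {σ : Type} (pos : σ → ℕ) (s0 : σ) (Q : ℕ → σ → V → σ → Prop)
    (h : ∀ (i : ℕ) (s : σ) (L : ℕ), ∃ y s', pos s ≤ pos s' ∧ Sup (pos s) (pos s') y ∧ ‖y‖ ≤ 1 ∧
      (∀ w f, WW w f → w < L → |ev f y| ≤ 2 / mm w) ∧ Q i s y s') :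
    ∃ (s : ℕ → σ) (y : ℕ → V) (lo hi : ℕ → ℕ), s 0 = s0 ∧ Pre (fun i => pos (s i)) y lo hi ∧
      ∀ i, Q i (s i) (y i) (s (i + 1)) := by
  choose Y S h1 h2 h3 h4 h5 using h
  have hH : ∀ (i L : ℕ) (y : V), ∃ H, L < H ∧ 2 * l1 y / mm H ≤ 1 / 2 ^ i := by
    intro i L y
    refine ⟨L + 1 + ⌈2 * l1 y * 2 ^ i⌉₊, by omega, ?_⟩
    set H := L + 1 + ⌈2 * l1 y * 2 ^ i⌉₊ with hH
    have a1 : (2 * l1 y * 2 ^ i : ℝ) ≤ mm H := by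
      have b1 : (2 * l1 y * 2 ^ i : ℝ) ≤ (⌈2 * l1 y * 2 ^ i⌉₊ : ℝ) := Nat.le_ceil _
      have b2 : ((⌈2 * l1 y * 2 ^ i⌉₊ : ℕ) : ℝ) ≤ (mm H : ℝ) := by
        have := mm_gt H
        exact_mod_cast (by omega : ⌈2 * l1 y * 2 ^ i⌉₊ ≤ mm H)
      linarith
    rw [div_le_div_iff₀ (mm_pos H) (by positivity)]
    linarith
  choose H hH1 hH2 using hH
  let st : ℕ → σ × ℕ := fun n => Nat.rec (s0, 0)
    (fun i p => (S i p.1 p.2, H i p.2 (Y i p.1 p.2))) n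
  have st1 : ∀ i, st (i + 1) = (S i (st i).1 (st i).2, H i (st i).2 (Y i (st i).1 (st i).2)) :=
    fun i => rfl
  refine ⟨fun i => (st i).1, fun i => Y i (st i).1 (st i).2, fun i => (st i).2,
    fun i => (st (i + 1)).2, rfl, ⟨⟨?_, ?_⟩, ?_, ?_, ?_, ?_, ?_⟩, ?_⟩
  · refine monotone_nat_of_le_succ fun i => ?_
    simp only [st1]; exact h1 _ _ _
  · intro i; simp only [st1]; exact h2 _ _ _
  · intro i; exact h3 _ _ _
  · intro i; simp only [st1]; exact hH1 _ _ _
  · have hm : StrictMono fun i => (st i).2 := strictMono_nat_of_lt_succ fun i => by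
      simp only [st1]; exact hH1 _ _ _
    intro i j hij
    exact hm.monotone hij
  · intro i w f hf hw; exact h4 _ _ _ w f hf hw
  · intro i; simp only [st1]; exact hH2 _ _ _
  · intro i; simp only [st1]; exact h5 _ _ _

def avg (z : ℕ → V) (p n : ℕ) : V := (1 / n : ℝ) • ∑ i ∈ Ico p (p + n), z i

lemma sum_norm_le {z : ℕ → V} {C : ℝ} (hz : ∀ i, ‖z i‖ ≤ C) (p q : ℕ) :
    ‖∑ i ∈ Ico p q, z i‖ ≤ C * ((q - p : ℕ) : ℝ) := by
  refine (norm_sum_le _ _).trans ((sum_le_sum fun i _ => hz i).trans ?_)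
  rw [sum_const, Nat.card_Ico, nsmul_eq_mul, mul_comm]

lemma avg_norm {z : ℕ → V} (hz : ∀ i, ‖z i‖ ≤ 1) (p : ℕ) {n : ℕ} (hn : 1 ≤ n) :
    ‖avg z p n‖ ≤ 1 := by
  have h := sum_norm_le hz p (p + n)
  rw [show p + n - p = n by omega, one_mul] at h
  have hn' : (0:ℝ) < n := by exact_mod_cast hn
  unfold avg
  rw [norm_smul, Real.norm_of_nonneg (by positivity), div_mul_eq_mul_div, one_mul,
    div_le_one hn']
  exact h

lemma avg_sup {R : ℕ → ℕ} {z : ℕ → V} (h : Blk R z) (p n : ℕ) : Sup (R p) (R (p + n)) (avg z p n) :=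
  (h.sum_sup _ _).smul _

lemma avg_W {R : ℕ → ℕ} {z : ℕ → V} (h : Blk R z) (hz : ∀ i, ‖z i‖ ≤ 1) {n L : ℕ}
    (hn : nn L ≤ n) (p : ℕ) {w : ℕ} {f : Fn} (hf : WW w f) (hw : w < L) :
    |ev f (avg z p n)| ≤ 2 / mm w := by
  have hn' : (0:ℝ) < n := by exact_mod_cast (nn_pos L).trans hn
  have h1 : SS z 1 0 := by
    intro g hg p q
    rw [add_zero]
    exact (ev_le hg _).trans (sum_norm_le hz p q)
  have h2 := Wbound h zero_le_one le_rfl h1 hf p (p + n)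
  rw [show p + n - p = n by omega] at h2
  have h3 : (nn w : ℝ) ≤ n := by exact_mod_cast (nn_mono hw.le).trans hn
  have hm := mm_pos w
  unfold avg
  rw [map_smul, smul_eq_mul, abs_mul, abs_of_nonneg (by positivity), div_mul_eq_mul_div, one_mul,
    div_le_iff₀ hn']
  refine h2.trans ?_
  rw [div_mul_eq_mul_div, div_mul_eq_mul_div]
  refine div_le_div_of_nonneg_right ?_ hm.le
  linarith

lemma avg_pre {R : ℕ → ℕ} {z : ℕ → V} (h : Blk R z) (hz : ∀ i, ‖z i‖ ≤ 1) :
    ∃ p n lo hi : ℕ → ℕ, (∀ i, 1 ≤ n i) ∧ (∀ i, p (i + 1) = p i + n i) ∧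
      Pre (fun i => R (p i)) (fun i => avg z (p i) (n i)) lo hi := by
  obtain ⟨s, y, lo, hi, _, hP, hQ⟩ := build_pre (σ := ℕ) R 0
    (fun i s y s' => ∃ n, 1 ≤ n ∧ s' = s + n ∧ y = avg z s n) (by
      intro i s L
      exact ⟨avg z s (nn L), s + nn L, h.mono (by omega), avg_sup h _ _, avg_norm hz _ (nn_pos L),
        fun w f hf hw => avg_W h hz le_rfl s hf hw, nn L, nn_pos L, rfl, rfl⟩)
  choose n h1 h2 h3 using hQ
  refine ⟨s, n, lo, hi, h1, h2, ?_⟩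
  have : y = fun i => avg z (s i) (n i) := funext h3
  rwa [← this]

lemma lower {R : ℕ → ℕ} {v : ℕ → V} (h : Blk R v) {c : ℝ} (p j N : ℕ)
    (hv : ∀ i, c < ‖v i‖) (hN : N ≤ nn j) :
    N * c / mm j ≤ ‖∑ i ∈ Ico p (p + N), v i‖ := by
  choose f hf hs hc using fun i => exists_norming' (h.sup i) (hv i)
  have hW : WW j ((1 / mm j : ℚ) • ∑ l ∈ range N, f (p + l)) := by
    refine InK.wt j N (fun l => f (p + l)) hN (fun l _ => hf _) ?_
    intro l l' hll _ n hn n' hn'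
    have h1 := hs _ n (Finsupp.mem_support_iff.mp hn)
    have h2 := hs _ n' (Finsupp.mem_support_iff.mp hn')
    exact (h1.2.trans_le (h.mono (by omega))).trans_le h2.1
  have hK : KK _ := InK.up j _ hW
  have := (le_abs_self _).trans (ev_le hK (∑ i ∈ Ico p (p + N), v i))
  refine le_trans ?_ this
  rw [ev_smul, ev_sum]
  have e : ∀ l ∈ range N, ev (f (p + l)) (∑ i ∈ Ico p (p + N), v i) = ev (f (p + l)) (v (p + l)) := by
    intro l hl
    rw [map_sum, sum_eq_single_of_mem (p + l) (by have := mem_range.mp hl; simp; omega)]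
    intro i _ hi
    refine ev_disj (h.sup i) (hs (p + l)) ?_
    rcases lt_or_gt_of_ne hi with h' | h'
    · exact Or.inl (h.mono h')
    · exact Or.inr (h.mono h')
  rw [sum_congr rfl e]
  have h3 : (N : ℝ) * c ≤ ∑ l ∈ range N, ev (f (p + l)) (v (p + l)) := by
    have := sum_le_sum (s := range N) (f := fun _ => c) (g := fun l => ev (f (p + l)) (v (p + l)))
      (fun l _ => (hc (p + l)).le)
    simpa using this
  have hm := mm_pos j
  push_cast
  rw [one_div, div_eq_inv_mul]
  exact mul_le_mul_of_nonneg_left h3 (by positivity)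

abbrev US (v : ℕ → V) (k : ℕ) : Submodule ℝ V := Submodule.span ℝ (v '' Set.Ici k)

lemma US_anti (v : ℕ → V) {k k' : ℕ} (h : k ≤ k') : US v k' ≤ US v k :=
  Submodule.span_mono (Set.image_mono (Set.Ici_subset_Ici.mpr h))

lemma US_mem (v : ℕ → V) {k i : ℕ} (h : k ≤ i) : v i ∈ US v k :=
  Submodule.subset_span ⟨i, h, rfl⟩

lemma james {R : ℕ → ℕ} {v : ℕ → V} (h : Blk R v) (hv : ∀ i, ‖v i‖ = 1) (n k : ℕ) (hn : 1 ≤ n) :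
    ∃ (p : ℕ → ℕ) (x : ℕ → V), StrictMono p ∧ k ≤ p 0 ∧ Blk (fun l => R (p l)) x ∧
      (∀ l, x l ∈ US v k) ∧ (∀ l, ‖x l‖ ≤ 1) ∧ (n / 2 : ℝ) ≤ ‖∑ l ∈ range n, x l‖ := by
  by_contra hcon
  push Not at hcon
  have hn' : (0:ℝ) < n := by exact_mod_cast hn
  have key : ∀ s q, k ≤ q → ‖∑ i ∈ Ico q (q + n ^ s), v i‖ ≤ ((n:ℝ) / 2) ^ s := by
    intro s
    induction s with
    | zero => intro q _; simp [hv]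
    | succ s ih =>
      intro q hq
      have hns : 0 < n ^ s := by positivity
      have hc : (0:ℝ) < (2 / n) ^ s := by positivity
      have := hcon (fun l => q + l * n ^ s)
        (fun l => ((2:ℝ) / n) ^ s • ∑ i ∈ Ico (q + l * n ^ s) (q + (l + 1) * n ^ s), v i)
        (by intro a b hab
            have := Nat.mul_lt_mul_of_pos_right hab hns
            show q + a * n ^ s < q + b * n ^ s
            omega) (by simpa using hq)
        (by
          refine ⟨fun a b hab => h.mono (Nat.add_le_add_left (Nat.mul_le_mul_right _ hab) _),
            fun l => (h.sum_sup _ _).smul _⟩)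
        (by
          intro l
          refine Submodule.smul_mem _ _ (Submodule.sum_mem _ fun i hi => US_mem v ?_)
          have := (mem_Ico.mp hi).1
          exact (hq.trans (Nat.le_add_right _ _)).trans this)
        (by
          intro l
          have := ih (q + l * n ^ s) (hq.trans (Nat.le_add_right _ _))
          rw [norm_smul, Real.norm_of_nonneg hc.le,
            show q + (l + 1) * n ^ s = q + l * n ^ s + n ^ s by ring]
          calc _ ≤ ((2:ℝ) / n) ^ s * ((n:ℝ) / 2) ^ s := by gcongr
            _ = 1 := by rw [← mul_pow]; rw [show (2 / n * (n / 2) : ℝ) = 1 by field_simp]; simp)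
      rw [← smul_sum, norm_smul, Real.norm_of_nonneg hc.le] at this
      have hS : ∀ m, ∑ l ∈ range m, ∑ i ∈ Ico (q + l * n ^ s) (q + (l + 1) * n ^ s), v i
          = ∑ i ∈ Ico q (q + m * n ^ s), v i := by
        intro m
        induction m with
        | zero => simp
        | succ m ihm =>
          rw [sum_range_succ, ihm, sum_Ico_consecutive _ (by omega)
            (Nat.add_le_add_left (Nat.mul_le_mul_right _ (Nat.le_succ m)) _)]
      rw [hS n, show n * n ^ s = n ^ (s + 1) by ring] at this
      have h3 : ‖∑ i ∈ Ico q (q + n ^ (s + 1)), v i‖ =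
          ((n:ℝ) / 2) ^ s * (((2:ℝ) / n) ^ s * ‖∑ i ∈ Ico q (q + n ^ (s + 1)), v i‖) := by
        rw [← mul_assoc, ← mul_pow, show ((n:ℝ) / 2 * (2 / n) : ℝ) = 1 by field_simp]; simp
      rw [h3, pow_succ]
      exact mul_le_mul_of_nonneg_left this.le (by positivity)
  have h1 := key (2 ^ (n + 3) + 2) k le_rfl
  have h2 := lower h (c := 1 / 2) k n (n ^ (2 ^ (n + 3) + 2)) (fun i => by rw [hv]; norm_num)
    (nn_ge3 n)
  have h3 := h2.trans h1
  have h4 : ((mm n : ℕ) : ℝ) = 2 ^ (2 ^ (n + 3)) := by unfold mm; push_cast; rfl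
  rw [h4, div_pow, div_le_div_iff₀ (by positivity) (by positivity), pow_add 2 (2 ^ (n + 3)) 2] at h3
  push_cast at h3
  have h5 : (0:ℝ) < (n:ℝ) ^ (2 ^ (n + 3) + 2) := by positivity
  have h6 : (0:ℝ) < 2 ^ (2 ^ (n + 3)) := by positivity
  nlinarith [mul_pos h5 h6]

lemma ris_in {R : ℕ → ℕ} {v : ℕ → V} (h : Blk R v) (hv : ∀ i, ‖v i‖ = 1) :
    ∃ R' d lo hi τ, RIS R' d lo hi τ ∧ (∀ i, d i ∈ US v i) ∧ ∀ i, 1 / 2 ≤ ‖d i‖ := by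
  obtain ⟨s, y, lo, hi, _, hP, hQ⟩ := build_pre (σ := ℕ) R 0
    (fun i s y s' => s < s' ∧ y ∈ US v s ∧ 1 / 2 ≤ ‖y‖) (by
      intro i s L
      obtain ⟨p, x, hp, hk, hb, hx, hx1, hn⟩ := james h hv (nn L) s (nn_pos L)
      have hpos : (0:ℝ) < nn L := by exact_mod_cast nn_pos L
      have hs : s < p (nn L) := hk.trans_lt (hp (nn_pos L))
      refine ⟨avg x 0 (nn L), p (nn L), h.mono hs.le, ?_, avg_norm hx1 _ (nn_pos L),
        fun w f hf hw => avg_W hb hx1 le_rfl 0 hf hw, hs, ?_, ?_⟩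
      · have := avg_sup hb 0 (nn L)
        simp only [zero_add] at this
        exact this.mono (h.mono hk) le_rfl
      · exact Submodule.smul_mem _ _ (Submodule.sum_mem _ fun i _ => hx i)
      · unfold avg
        rw [norm_smul, Real.norm_of_nonneg (by positivity), zero_add, Nat.Ico_zero_eq_range,
          div_mul_eq_mul_div, one_mul, le_div_iff₀ hpos]
        linarith)
  obtain ⟨p, q, hpq, hqp, hR⟩ := hP.ris
  have hs : StrictMono s := strictMono_nat_of_lt_succ fun i => (hQ i).1
  have hp : StrictMono p := strictMono_nat_of_lt_succ fun i => (hpq i).trans (hqp i)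
  have hi' : ∀ i, i ≤ s (p i) := fun i => hp.le_apply.trans hs.le_apply
  refine ⟨_, _, _, _, _, hR, fun i => ?_, fun i => ?_⟩
  · exact Submodule.sub_mem _ (US_anti v (hi' i) (hQ (p i)).2.1)
      (US_anti v ((hi' i).trans (hs.monotone (hpq i).le)) (hQ (q i)).2.1)
  · refine (hQ (p i)).2.2.trans ?_
    have h1 : rs (R (s (p i))) (R (s (p i + 1))) (y (p i) - y (q i)) = y (p i) := by
      rw [sub_eq_add_neg, rs_add, (hP.blk.sup (p i)).rs_eq le_rfl le_rfl,
        ((hP.blk.sup (q i)).neg).rs_eq_zero (Or.inr (hP.blk.mono (hpq i))), add_zero]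
    have h2 := norm_rs_le (R (s (p i))) (R (s (p i + 1))) (y (p i) - y (q i))
    rw [h1] at h2
    exact h2

lemma Blk.strict {R : ℕ → ℕ} {z : ℕ → V} (h : Blk R z) (hz : ∀ i, z i ≠ 0) : StrictMono R := by
  refine strictMono_nat_of_lt_succ fun i => ?_
  obtain ⟨n, hn⟩ : ∃ n, z i n ≠ 0 := by
    by_contra hc; push Not at hc
    exact hz i (Finsupp.ext hc)
  have := h.sup i n hn
  omega

lemma exact_pair {R : ℕ → ℕ} {v : ℕ → V} (h : Blk R v) (hv : ∀ i, ‖v i‖ = 1) (j N k : ℕ) :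
    ∃ x b, x ∈ US v k ∧ WW j b ∧ Exact 400 j x ∧ (∃ N', N ≤ N' ∧ Sup N N' x ∧ Sup N N' b) ∧
      ev b x = 1 := by
  obtain ⟨R', d, lo, hi, τ, hd, hU, hd2⟩ := ris_in h hv
  have hb := hd.bl.blk
  choose g hg hs hc using fun i => exists_norming' (c := 1 / 4) (hb.sup i)
    (by linarith [hd2 i] : (1:ℝ) / 4 < ‖d i‖)
  have hR : StrictMono R' := hb.strict fun i hi => by
    have := hd2 i; rw [hi, norm_zero] at this; linarith
  set P := max N k
  have hNP : N ≤ R' P := (le_max_left N k).trans hR.le_apply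
  have hpos : (0:ℝ) < nn j := by exact_mod_cast nn_pos j
  set t := ev (exf g j P) (exv d j P) with ht
  have ht4 : 1 / 4 ≤ t := by
    rw [ht, exf_exv hb hs, le_div_iff₀ hpos]
    have := sum_le_sum (s := Ico P (P + nn j)) (f := fun _ => (1:ℝ) / 4) (fun i _ => (hc i).le)
    rw [sum_const, Nat.card_Ico, nsmul_eq_mul, show P + nn j - P = nn j by omega] at this
    linarith
  refine ⟨t⁻¹ • exv d j P, exf g j P, ?_, exf_mem hb.mono hg hs j P, ?_,
    ⟨R' (P + nn j), hNP.trans (hb.mono (by omega)), (((exv_sup hb j P).smul _).mono hNP le_rfl),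
      (exf_sup hb.mono hs j P).mono hNP le_rfl⟩, ?_⟩
  · refine Submodule.smul_mem _ _ (Submodule.smul_mem _ _ (Submodule.sum_mem _ fun i hi => ?_))
    exact US_anti v ((le_max_right N k).trans (mem_Ico.mp hi).1) (hU i)
  · have := (hd.exact j P).smul (c := t⁻¹) (A := 4) (by
      rw [abs_of_nonneg (by positivity)]
      exact inv_le_of_inv_le₀ (by norm_num) (by linarith))
    exact this.mono (by norm_num)
  · rw [map_smul, smul_eq_mul, ← ht, inv_mul_cancel₀ (by linarith)]

end HJT

namespace HJT
open Finset Filter Topology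

lemma geo_sum {s : Finset ℕ} {k : ℕ} (hs : ∀ i ∈ s, k ≤ i) :
    ∑ i ∈ s, (1:ℝ) / 2 ^ (i + 1) ≤ 1 / 2 ^ k := by
  obtain ⟨B, hB⟩ : ∃ B, ∀ i ∈ s, i < B := ⟨s.sup id + 1, fun i hi => Nat.lt_succ_of_le (le_sup (f := id) hi)⟩
  have h1 : s ⊆ Ico k (max k B) := fun i hi =>
    mem_Ico.mpr ⟨hs i hi, (hB i hi).trans_le (le_max_right _ _)⟩
  have h2 : ∀ m, ∑ i ∈ Ico k (k + m), (1:ℝ) / 2 ^ (i + 1) = 1 / 2 ^ k - 1 / 2 ^ (k + m) := by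
    intro m
    induction m with
    | zero => simp
    | succ m ih =>
      rw [← add_assoc, sum_Ico_succ_top (by omega), ih]
      rw [pow_succ 2 (k + m)]; field_simp; ring
  refine (sum_le_sum_of_subset_of_nonneg h1 fun _ _ _ => by positivity).trans ?_
  obtain ⟨m, hm⟩ := Nat.exists_eq_add_of_le (le_max_left k B)
  rw [hm, h2 m]
  have : (0:ℝ) < 1 / 2 ^ (k + m) := by positivity
  linarith

lemma US_rep {R : ℕ → ℕ} {v : ℕ → V} (h : Blk R v) (hv : ∀ i, ‖v i‖ = 1) {k : ℕ} {w : V}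
    (hw : w ∈ US v k) : ∃ (s : Finset ℕ) (a : ℕ → ℝ), (∀ i ∈ s, k ≤ i) ∧
      w = ∑ i ∈ s, a i • v i ∧ ∀ i ∈ s, |a i| ≤ ‖w‖ := by
  rw [US, Finsupp.mem_span_image_iff_linearCombination] at hw
  obtain ⟨l, hl, rfl⟩ := hw
  have e : Finsupp.linearCombination ℝ v l = ∑ i ∈ l.support, l i • v i := rfl
  refine ⟨l.support, l, fun i hi => hl hi, e, fun i hi => ?_⟩
  have h2 := norm_rs_le (R i) (R (i + 1)) (Finsupp.linearCombination ℝ v l)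
  rw [e, rs_sum, sum_eq_single_of_mem i hi, rs_smul, (h.sup i).rs_eq le_rfl le_rfl, norm_smul,
    hv i, mul_one] at h2
  · exact h2
  · intro m _ hm
    rw [rs_smul, (h.sup m).rs_eq_zero, smul_zero]
    rcases lt_or_gt_of_ne hm with h' | h'
    · exact Or.inl (h.mono h')
    · exact Or.inr (h.mono h')

lemma pert_sum {E : Type*} [NormedAddCommGroup E] [NormedSpace ℝ E] {s : Finset ℕ} {a : ℕ → ℝ}
    {e : ℕ → E} {k : ℕ} {A ρ : ℝ} (hA : 0 ≤ A) (hρ : 0 ≤ ρ) (hs : ∀ i ∈ s, k ≤ i)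
    (ha : ∀ i ∈ s, |a i| ≤ A) (he : ∀ i, ‖e i‖ ≤ ρ / 2 ^ (i + 1)) :
    ‖∑ i ∈ s, a i • e i‖ ≤ ρ / 2 ^ k * A := by
  calc _ ≤ ∑ i ∈ s, A * ρ * (1 / 2 ^ (i + 1)) := by
        refine (norm_sum_le _ _).trans (sum_le_sum fun i hi => ?_)
        rw [norm_smul, Real.norm_eq_abs]
        calc _ ≤ A * (ρ / 2 ^ (i + 1)) := mul_le_mul (ha i hi) (he i) (norm_nonneg _) hA
          _ = _ := by ring
    _ = A * ρ * ∑ i ∈ s, (1:ℝ) / 2 ^ (i + 1) := by rw [mul_sum]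
    _ ≤ A * ρ * (1 / 2 ^ k) := mul_le_mul_of_nonneg_left (geo_sum hs) (by positivity)
    _ = _ := by ring

lemma exists_tail {Y : Submodule ℝ XX} (hY : ¬ FiniteDimensional ℝ Y) (N : ℕ) :
    ∃ y ∈ Y, ‖y‖ = 1 ∧ ∀ n < N, cX n y = 0 := by
  let φ : Y →ₗ[ℝ] (Fin N → ℝ) := LinearMap.pi fun i => (cX i).toLinearMap ∘ₗ Y.subtype
  have hφ : ¬ Function.Injective φ := fun hi => hY (FiniteDimensional.of_injective φ hi)
  rw [← LinearMap.ker_eq_bot, Submodule.eq_bot_iff] at hφ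
  push Not at hφ
  obtain ⟨y, hy, hy0⟩ := hφ
  have hy0' : (y : XX) ≠ 0 := fun h => hy0 (Subtype.ext h)
  have hn : ‖(y : XX)‖ ≠ 0 := norm_ne_zero_iff.mpr hy0'
  refine ⟨‖(y:XX)‖⁻¹ • y, Y.smul_mem _ y.2, ?_, fun n hn => ?_⟩
  · rw [norm_smul, norm_inv, norm_norm, inv_mul_cancel₀ hn]
  · have h1 : φ y ⟨n, hn⟩ = 0 := by rw [LinearMap.mem_ker.mp hy]; rfl
    have h2 : cX n (y : XX) = 0 := h1
    rw [map_smul, h2, smul_zero]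

/-- approximate a vector with vanishing first coordinates by a block -/
lemma approx_tail {y : XX} {N : ℕ} (hy : ∀ n < N, cX n y = 0) {δ : ℝ} (hδ : 0 < δ) :
    ∃ M, N < M ∧ ‖y - jj (tr N M y)‖ < δ := by
  obtain ⟨M0, hM⟩ := Metric.tendsto_atTop.mp (tr_tendsto y) δ hδ
  have h := hM (max M0 (N + 1)) (le_max_left _ _)
  refine ⟨max M0 (N + 1), by have := le_max_right M0 (N + 1); omega, ?_⟩
  have e : tr N (max M0 (N + 1)) y = tr 0 (max M0 (N + 1)) y := by
    ext n; rw [tr_apply, tr_apply]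
    by_cases hn : n < N
    · simp [hy n hn]
    · have : N ≤ n := by omega
      simp [this]
  rw [e, ← dist_eq_norm, dist_comm]; exact h

lemma block_in {Y : Submodule ℝ XX} (hY : ¬ FiniteDimensional ℝ Y) {ρ : ℝ} (hρ : 0 < ρ) :
    ∃ R v, Blk R v ∧ (∀ i, ‖v i‖ = 1) ∧
      ∀ k, ∀ w ∈ US v k, ∃ y ∈ Y, ‖y - jj w‖ ≤ ρ / 2 ^ k * ‖w‖ := by
  have step : ∀ (i N : ℕ), ∃ (M : ℕ) (v : V) (y : XX), N ≤ M ∧ Sup N M v ∧ ‖v‖ = 1 ∧ y ∈ Y ∧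
      ‖y - jj v‖ ≤ ρ / 2 ^ (i + 1) := by
    intro i N
    obtain ⟨y, hy, hy1, hy0⟩ := exists_tail hY N
    set δ : ℝ := min (1 / 2) (ρ / 2 ^ (i + 1) / 2) with hδ
    have hδ0 : 0 < δ := by positivity
    obtain ⟨M, hNM, hM⟩ := approx_tail hy0 hδ0
    set u := tr N M y with hu
    have h2 : 1 / 2 ≤ ‖u‖ := by
      have a1 : ‖y‖ ≤ ‖y - jj u‖ + ‖jj u‖ := by
        have := norm_add_le (y - jj u) (jj u); simpa using this
      rw [hy1, jj.norm_map] at a1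
      have : δ ≤ 1 / 2 := min_le_left _ _
      linarith
    have hu0 : ‖u‖ ≠ 0 := by linarith
    refine ⟨M, ‖u‖⁻¹ • u, ‖u‖⁻¹ • y, hNM.le, (tr_Sup _ _ _).smul _, ?_, Y.smul_mem _ hy, ?_⟩
    · rw [norm_smul, norm_inv, norm_norm, inv_mul_cancel₀ hu0]
    · rw [map_smul, ← smul_sub, norm_smul, norm_inv, norm_norm]
      have a1 : ‖u‖⁻¹ ≤ 2 := inv_le_of_inv_le₀ (by norm_num) (by linarith)
      have a2 : ‖y - jj u‖ ≤ ρ / 2 ^ (i + 1) / 2 := hM.le.trans (min_le_right _ _)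
      calc _ ≤ 2 * (ρ / 2 ^ (i + 1) / 2) := mul_le_mul a1 a2 (norm_nonneg _) (by norm_num)
        _ = _ := by ring
  choose M v y h1 h2 h3 h4 h5 using step
  let R : ℕ → ℕ := fun n => Nat.rec 0 (fun i N => M i N) n
  have hR : ∀ i, R (i + 1) = M i (R i) := fun i => rfl
  have hb : Blk R (fun i => v i (R i)) :=
    ⟨monotone_nat_of_le_succ fun i => by rw [hR]; exact h1 _ _, fun i => by rw [hR]; exact h2 _ _⟩
  refine ⟨R, fun i => v i (R i), hb, fun i => h3 _ _, fun k w hw => ?_⟩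
  obtain ⟨s, a, hs, rfl, ha⟩ := US_rep hb (fun i => h3 _ _) hw
  refine ⟨∑ i ∈ s, a i • y i (R i), Y.sum_mem fun i _ => Y.smul_mem _ (h4 _ _), ?_⟩
  rw [map_sum, ← sum_sub_distrib]
  simp only [map_smul, ← smul_sub]
  exact pert_sum (norm_nonneg _) hρ.le hs ha fun i => h5 i (R i)

lemma bdd_complete (ξ : ℕ → ℝ) (C : ℝ)
    (hC : ∀ n, ‖(∑ m ∈ range n, Finsupp.single m (ξ m) : V)‖ ≤ C) :
    ∃ x : XX, ∀ n, cX n x = ξ n := by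
  set u : ℕ → V := fun n => ∑ m ∈ range n, Finsupp.single m (ξ m) with hu
  have huv : ∀ n m, u n m = if m < n then ξ m else 0 := by
    intro n m
    simp only [hu]
    rw [Finsupp.finsetSum_apply]
    split_ifs with h
    · rw [sum_eq_single_of_mem m (mem_range.mpr h)]
      · simp
      · intro i _ hi; simp [hi]
    · refine sum_eq_zero fun i hi => ?_
      have := mem_range.mp hi
      rw [Finsupp.single_apply, if_neg (by omega)]
  have hcau : CauchySeq fun n => jj (u n) := by
    rw [Metric.cauchySeq_iff']
    by_contra hc
    push Not at hc
    obtain ⟨ε, hε, hc⟩ := hc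
    choose F hF1 hF2 using hc
    let R : ℕ → ℕ := fun n => Nat.rec 0 (fun _ N => F N) n
    have hR : ∀ i, R (i + 1) = F (R i) := fun i => rfl
    have hb : Blk R (fun i => u (R (i + 1)) - u (R i)) := by
      refine ⟨monotone_nat_of_le_succ fun i => by rw [hR]; exact hF1 _, fun i n hn => ?_⟩
      have hle : R i ≤ R (i + 1) := by rw [hR]; exact hF1 _
      rw [Finsupp.sub_apply, huv, huv] at hn
      by_contra h'
      apply hn
      rcases Nat.lt_or_ge n (R i) with h1 | h1
      · have h2 : n < R (i + 1) := by omega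
        rw [if_pos h2, if_pos h1, sub_self]
      · have h2 : ¬ n < R (i + 1) := by omega
        rw [if_neg h2, if_neg (by omega), sub_self]
    obtain ⟨j, hj⟩ := exists_nat_gt (4 * C / ε)
    have hl := lower hb (c := ε / 2) 0 j (nn j) (fun i => by
      have := hF2 (R i)
      rw [dist_eq_norm, ← map_sub, jj.norm_map, ← hR] at this
      linarith) le_rfl
    rw [zero_add, Nat.Ico_zero_eq_range, sum_range_sub (fun i => u (R i))] at hl
    have h1 := hl.trans (norm_sub_le _ _)
    have h2 := hC (R (nn j))
    have h3 := hC (R 0)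
    have hm := mm_pos j
    have hmj : (j : ℝ) ≤ mm j := by exact_mod_cast (mm_gt j).le
    have hm1 : (256 : ℝ) ≤ mm j := mm_ge' j
    have hnn : ((mm j : ℝ)) ^ 2 * (20 * (mm j : ℝ) ^ 2 + 100) ≤ nn j := by exact_mod_cast nn_ge2 j
    have h4 : (mm j : ℝ) * (ε / 2) ≤ nn j * (ε / 2) / mm j := by
      rw [le_div_iff₀ hm]
      have : (mm j : ℝ) * mm j ≤ nn j := by nlinarith [sq_nonneg ((mm j : ℝ))]
      nlinarith
    rw [div_lt_iff₀ hε] at hj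
    have : (j:ℝ) * ε ≤ mm j * ε := by gcongr
    have h5 : ‖u (R (nn j))‖ ≤ C := h2
    have h6 : ‖u (R 0)‖ ≤ C := h3
    linarith
  obtain ⟨x, hx⟩ := cauchySeq_tendsto_of_complete hcau
  refine ⟨x, fun n => ?_⟩
  have h1 : Tendsto (fun m => cX n (jj (u m))) atTop (𝓝 (cX n x)) :=
    ((cX n).continuous.tendsto x).comp hx
  refine tendsto_nhds_unique h1 (tendsto_const_nhds.congr' ?_)
  filter_upwards [eventually_gt_atTop n] with m hm
  rw [cX_jj, huv, if_pos hm]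

end HJT

namespace HJT
open Finset Filter Topology

lemma normalize_pair {E : Type*} [NormedAddCommGroup E] [NormedSpace ℝ E] {Y Z : Submodule ℝ E}
    {y z : E} (hy : y ∈ Y) (hz : z ∈ Z) {ε η : ℝ} (hη1 : η ≤ 1 / 4) (hη2 : 7 * η ≤ ε)
    (hη : 0 < η) (hpos : 0 < ‖y + z‖) (h : ‖y - z‖ ≤ η * ‖y + z‖) :
    ∃ y ∈ Y, ∃ z ∈ Z, ‖y‖ = 1 ∧ ‖z‖ = 1 ∧ ‖y - z‖ < ε := by
  have a1 : 2 * ‖y‖ ≥ ‖y + z‖ - ‖y - z‖ := by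
    have : ‖y + z‖ ≤ ‖(2:ℝ) • y‖ + ‖y - z‖ := by
      have := norm_sub_le ((2:ℝ) • y) (y - z)
      rwa [show (2:ℝ) • y - (y - z) = y + z by rw [two_smul]; abel] at this
    rw [norm_smul] at this
    norm_num at this
    linarith
  have a2 : 2 * ‖z‖ ≥ ‖y + z‖ - ‖y - z‖ := by
    have : ‖y + z‖ ≤ ‖(2:ℝ) • z‖ + ‖y - z‖ := by
      have := norm_add_le ((2:ℝ) • z) (y - z)
      rwa [show (2:ℝ) • z + (y - z) = y + z by rw [two_smul]; abel] at this
    rw [norm_smul] at this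
    norm_num at this
    linarith
  set S := ‖y + z‖
  have hyS : S / 3 ≤ ‖y‖ := by nlinarith
  have hzS : S / 3 ≤ ‖z‖ := by nlinarith
  have hy0 : 0 < ‖y‖ := by linarith
  have hz0 : 0 < ‖z‖ := by linarith
  refine ⟨‖y‖⁻¹ • y, Y.smul_mem _ hy, ‖z‖⁻¹ • z, Z.smul_mem _ hz, ?_, ?_, ?_⟩
  · rw [norm_smul, norm_inv, norm_norm, inv_mul_cancel₀ hy0.ne']
  · rw [norm_smul, norm_inv, norm_norm, inv_mul_cancel₀ hz0.ne']
  · have e : ‖y‖⁻¹ • y - ‖z‖⁻¹ • z = ‖y‖⁻¹ • ((y - z) + ((‖z‖ - ‖y‖) * ‖z‖⁻¹) • z) := by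
      rw [sub_mul, mul_inv_cancel₀ hz0.ne', sub_smul, one_smul,
        show y - z + (z - (‖y‖ * ‖z‖⁻¹) • z) = y - (‖y‖ * ‖z‖⁻¹) • z by abel, smul_sub, smul_smul,
        ← mul_assoc, inv_mul_cancel₀ hy0.ne', one_mul]
    rw [e, norm_smul, norm_inv, norm_norm, inv_mul_lt_iff₀ hy0]
    have b1 : ‖((‖z‖ - ‖y‖) * ‖z‖⁻¹) • z‖ = |‖z‖ - ‖y‖| := by
      rw [norm_smul, norm_mul, norm_inv, norm_norm, mul_assoc, inv_mul_cancel₀ hz0.ne', mul_one,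
        Real.norm_eq_abs]
    have b2 : |‖z‖ - ‖y‖| ≤ ‖y - z‖ := by
      have := abs_norm_sub_norm_le z y
      rwa [norm_sub_rev] at this
    have b3 := norm_add_le (y - z) (((‖z‖ - ‖y‖) * ‖z‖⁻¹) • z)
    rw [b1] at b3
    nlinarith

lemma dep_lower {C : ℝ} {R : ℕ → ℕ} {b : ℕ → Fn} {x : ℕ → V} (H : Dep C R b x) (n : ℕ) (a : ℕ → ℝ) :
    ev (∑ i ∈ range n, b i) (∑ i ∈ range n, a i • x i) = ∑ i ∈ range n, a i * ev (b i) (x i) := by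
  rw [ev_sum]
  refine sum_congr rfl fun i hi => ?_
  rw [map_sum, sum_eq_single_of_mem i hi, map_smul, smul_eq_mul]
  intro m _ hm
  rw [map_smul, ev_disj (H.supx m) (H.supb i), smul_zero]
  rcases lt_or_gt_of_ne hm with h' | h'
  · exact Or.inl (H.mono h')
  · exact Or.inr (H.mono h')

lemma alt_sum (p q : ℕ) : |∑ i ∈ Ico p q, (-1:ℝ) ^ i| ≤ 1 := by
  rcases le_total q p with h | h
  · rw [Ico_eq_empty_of_le h]; simp
  · have key : ∀ m, ∑ i ∈ Ico p (p + m), (-1:ℝ) ^ i = if Even m then 0 else (-1) ^ p := by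
      intro m
      induction m with
      | zero => simp
      | succ m ih =>
        rw [← add_assoc, sum_Ico_succ_top (by omega), ih]
        by_cases hm : Even m
        · rw [if_pos hm, if_neg (by simpa [Nat.even_add_one] using hm), pow_add, hm.neg_one_pow]
          ring
        · have hm' := Nat.not_even_iff_odd.mp hm
          rw [if_neg hm, if_pos (by simpa [Nat.even_add_one] using hm), pow_add, hm'.neg_one_pow]
          ring
    obtain ⟨m, rfl⟩ := Nat.exists_eq_add_of_le h
    rw [key]
    split_ifs
    · simp
    · simp

theorem XX_HI (Y Z : Submodule ℝ XX) (hY : ¬ FiniteDimensional ℝ Y) (hZ : ¬ FiniteDimensional ℝ Z)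
    (ε : ℝ) (hε : 0 < ε) : ∃ y ∈ Y, ∃ z ∈ Z, ‖y‖ = 1 ∧ ‖z‖ = 1 ∧ ‖y - z‖ < ε := by
  obtain ⟨R1, v1, hb1, hv1, hY1⟩ := block_in hY one_pos
  obtain ⟨R2, v2, hb2, hv2, hZ1⟩ := block_in hZ one_pos
  obtain ⟨R, b, x, w, H, hQ⟩ := build (β := XX) (C := 400)
    (fun i j x b w => ev b x = 1 ∧ ‖w - jj x‖ ≤ 800 / 2 ^ (i + 1) ∧ (Even i → w ∈ Y) ∧
      (¬ Even i → w ∈ Z)) (by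
    intro i j N
    have hfin : ∀ (x w : XX), ‖w - x‖ ≤ 1 / 2 ^ i * ‖x‖ → ‖x‖ ≤ 400 → ‖w - x‖ ≤ 800 / 2 ^ (i + 1) := by
      intro x w h h'
      refine h.trans ?_
      calc _ ≤ 1 / 2 ^ i * (400:ℝ) := by gcongr
        _ = _ := by rw [pow_succ]; ring
    by_cases hi : Even i
    · obtain ⟨x, b, h1, h2, h3, h4, h5⟩ := exact_pair hb1 hv1 j N i
      obtain ⟨w, hw, hw'⟩ := hY1 i x h1
      refine ⟨x, b, w, h2, h3, h4, h5, hfin _ _ (by rwa [jj.norm_map]) (by rw [jj.norm_map]; exact h3.e1),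
        fun _ => hw, fun h => absurd hi h⟩
    · obtain ⟨x, b, h1, h2, h3, h4, h5⟩ := exact_pair hb2 hv2 j N i
      obtain ⟨w, hw, hw'⟩ := hZ1 i x h1
      refine ⟨x, b, w, h2, h3, h4, h5, hfin _ _ (by rwa [jj.norm_map]) (by rw [jj.norm_map]; exact h3.e1),
        fun h => absurd h hi, fun _ => hw⟩)
  set η : ℝ := min (1 / 4) (ε / 7) with hη
  have hη0 : 0 < η := by positivity
  have hη1 : η ≤ 1 / 4 := min_le_left _ _
  have hη2 : 7 * η ≤ ε := by have : η ≤ ε / 7 := min_le_right _ _; linarith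
  obtain ⟨N, hN0, hN⟩ := H.small (a := fun i => (-1) ^ i) (A := 1) (B := 1) (by simp)
    (by intro p q; simp only [(hQ _).1, mul_one]; exact alt_sum p q) (η / 2) (by positivity)
  obtain ⟨n, hn⟩ := exists_nat_gt ((N + 801 + 800 * η) / (η / 2) + 801)
  have hn1 : N + 801 + 800 * η < η / 2 * n := by
    have h1 : (N + 801 + 800 * η) / (η / 2) < n := by linarith
    rw [div_lt_iff₀ (by positivity)] at h1
    linarith
  have hn2 : (801:ℝ) < n := by
    have : 0 ≤ (N + 801 + 800 * η) / (η / 2) := by positivity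
    linarith
  set y := ∑ i ∈ range n, (if Even i then w i else 0) with hy
  set z := ∑ i ∈ range n, (if Even i then 0 else w i) with hz
  have e1 : y + z = ∑ i ∈ range n, (1:ℝ) • w i := by
    rw [hy, hz, ← sum_add_distrib]
    refine sum_congr rfl fun i _ => ?_
    split_ifs <;> simp
  have e2 : y - z = ∑ i ∈ range n, ((-1:ℝ) ^ i) • w i := by
    rw [hy, hz, ← sum_sub_distrib]
    refine sum_congr rfl fun i _ => ?_
    split_ifs with h
    · rw [h.neg_one_pow]; simp
    · rw [(Nat.not_even_iff_odd.mp h).neg_one_pow]; simp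
  have pert : ∀ a : ℕ → ℝ, (∀ i, |a i| ≤ 1) →
      ‖∑ i ∈ range n, a i • w i - jj (∑ i ∈ range n, a i • x i)‖ ≤ 800 := by
    intro a ha
    rw [map_sum, ← sum_sub_distrib]
    simp only [map_smul, ← smul_sub]
    have := pert_sum (s := range n) (a := a) (e := fun i => w i - jj (x i)) (k := 0) (A := 1) (ρ := 800)
      zero_le_one (by norm_num) (by simp) (fun i _ => ha i) (fun i => (hQ i).2.1)
    simpa using this
  have p1 := pert (fun _ => 1) (by simp)
  have p2 := pert (fun i => (-1) ^ i) (by simp)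
  rw [← e1] at p1
  rw [← e2] at p2
  have q1 : (n:ℝ) ≤ ‖∑ i ∈ range n, (1:ℝ) • x i‖ := by
    have := (le_abs_self _).trans (ev_le (dep_sum_mem H.wb n) (∑ i ∈ range n, (1:ℝ) • x i))
    rw [dep_lower H n (fun _ => 1)] at this
    simpa [(hQ _).1] using this
  have q2 := hN n
  have r1 : (n:ℝ) - 800 ≤ ‖y + z‖ := by
    have := norm_sub_norm_le (jj (∑ i ∈ range n, (1:ℝ) • x i)) (y + z)
    rw [norm_sub_rev, jj.norm_map] at this
    linarith
  have r2 : ‖y - z‖ ≤ η / 2 * n + N + 800 := by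
    have := norm_sub_norm_le (y - z) (jj (∑ i ∈ range n, ((-1:ℝ) ^ i) • x i))
    rw [jj.norm_map] at this
    linarith
  refine normalize_pair (Y := Y) (Z := Z) (y := y) (z := z)
    (Y.sum_mem fun i _ => ?_) (Z.sum_mem fun i _ => ?_) hη1 hη2 hη0 (by linarith) ?_
  · split_ifs with h
    · exact (hQ i).2.2.1 h
    · exact Y.zero_mem
  · split_ifs with h
    · exact Z.zero_mem
    · exact (hQ i).2.2.2 h
  · have : η * ((n:ℝ) - 800) ≤ η * ‖y + z‖ := by gcongr
    nlinarith

lemma ulim {ι E : Type*} [NormedAddCommGroup E] [NormedSpace ℝ E] (𝒰 : Ultrafilter ι)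
    (f : ι → E →L[ℝ] ℝ) (C : ℝ) (hf : ∀ n x, |f n x| ≤ C * ‖x‖) :
    ∃ φ : E →L[ℝ] ℝ, ∀ x, |φ x| ≤ C * ‖x‖ ∧ Tendsto (fun n => f n x) 𝒰 (𝓝 (φ x)) := by
  have h1 : ∀ x, ∃ c, |c| ≤ C * ‖x‖ ∧ Tendsto (fun n => f n x) 𝒰 (𝓝 c) := by
    intro x
    have := (isCompact_Icc (a := -(C * ‖x‖)) (b := C * ‖x‖)).ultrafilter_le_nhds
      (𝒰.map fun n => f n x) (by
        rw [Filter.le_principal_iff]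
        show ∀ᶠ n in (𝒰 : Filter ι), f n x ∈ Set.Icc (-(C * ‖x‖)) (C * ‖x‖)
        exact Filter.Eventually.of_forall fun n => abs_le.mp (hf n x))
    obtain ⟨c, hc, h⟩ := this
    exact ⟨c, abs_le.mpr hc, h⟩
  choose φ hφ1 hφ2 using h1
  let L : E →ₗ[ℝ] ℝ :=
    { toFun := φ
      map_add' := fun x y => tendsto_nhds_unique (hφ2 (x + y)) (by
        simpa using (hφ2 x).add (hφ2 y))
      map_smul' := fun c x => tendsto_nhds_unique (hφ2 (c • x)) (by
        simpa using (hφ2 x).const_mul c) }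
  exact ⟨L.mkContinuous C hφ1, fun x => ⟨hφ1 x, hφ2 x⟩⟩

theorem XX_nonreflexive (Y : Submodule ℝ XX) (hY : ¬ FiniteDimensional ℝ Y) :
    ¬ Function.Surjective (NormedSpace.inclusionInDoubleDual ℝ Y) := by
  intro hsurj
  obtain ⟨R1, v1, hb1, hv1, hY1⟩ := block_in hY one_pos
  obtain ⟨R, b, x, y, H, hQ⟩ := build (β := Y) (C := 400)
    (fun i j x b w => ev b x = 1 ∧ ‖(w:XX) - jj x‖ ≤ 1 / 4 * (1 / 2) ^ i) (by
    intro i j N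
    obtain ⟨x, b, h1, h2, h3, h4, h5⟩ := exact_pair hb1 hv1 j N (i + 11)
    obtain ⟨w, hw, hw'⟩ := hY1 (i + 11) x h1
    refine ⟨x, b, ⟨w, hw⟩, h2, h3, h4, h5, hw'.trans ?_⟩
    calc _ ≤ 1 / 2 ^ (i + 11) * (400:ℝ) := by gcongr; exact h3.e1
      _ ≤ _ := by
        rw [pow_add, div_pow, one_pow]
        have : (0:ℝ) < 1 / 2 ^ i := by positivity
        calc _ = (400 / 2 ^ 11 : ℝ) * (1 / 2 ^ i) := by field_simp
          _ ≤ _ := mul_le_mul_of_nonneg_right (by norm_num) this.le)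
  have herr : ∀ i, ‖(y i : XX) - jj (x i)‖ ≤ 1 / 4 := by
    intro i
    refine (hQ i).2.trans ?_
    have : ((1:ℝ) / 2) ^ i ≤ 1 := pow_le_one₀ (by norm_num) (by norm_num)
    linarith
  have herr0 : Tendsto (fun i => ‖(y i : XX) - jj (x i)‖) atTop (𝓝 0) := by
    refine squeeze_zero (fun _ => norm_nonneg _) (fun i => (hQ i).2) ?_
    have := (tendsto_pow_atTop_nhds_zero_of_lt_one (by norm_num : (0:ℝ) ≤ 1 / 2)
      (by norm_num)).const_mul (1 / 4)
    rwa [mul_zero] at this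
  have hyn : ∀ i, ‖y i‖ ≤ 401 := by
    intro i
    have h1 := norm_sub_norm_le (y i : XX) (jj (x i))
    have h2 := herr i
    have h3 := (H.ex i).e1
    rw [jj.norm_map] at h1
    have : ‖y i‖ = ‖(y i : XX)‖ := rfl
    linarith
  obtain ⟨φ, hφ⟩ := ulim (hyperfilter ℕ) (fun n => evX (∑ i ∈ range n, b i)) 1
    (fun n x => by rw [one_mul]; exact evX_le (dep_sum_mem H.wb n) x)
  have hφy : ∀ i, 3 / 4 ≤ φ (y i) := by
    intro i
    refine ge_of_tendsto (hφ (y i)).2 ?_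
    filter_upwards [Pre.hyper_ge (i + 1)] with n hn
    have e : evX (∑ i ∈ range n, b i) (y i : XX) = ev (∑ i ∈ range n, b i) (x i) +
        evX (∑ i ∈ range n, b i) ((y i : XX) - jj (x i)) := by
      rw [map_sub, evX_jj]; ring
    have e2 : ev (∑ i ∈ range n, b i) (x i) = 1 := by
      rw [ev_sum, sum_eq_single_of_mem i (mem_range.mpr hn), (hQ i).1]
      intro m _ hm
      refine ev_disj (H.supx i) (H.supb m) ?_
      rcases lt_or_gt_of_ne hm with h' | h'
      · exact Or.inr (H.mono h')
      · exact Or.inl (H.mono h')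
    have e3 := (abs_le.mp (evX_le (dep_sum_mem H.wb n) ((y i : XX) - jj (x i)))).1
    have := herr i
    rw [e, e2]; linarith
  obtain ⟨Ψ, hΨ⟩ := ulim (E := StrongDual ℝ Y) (hyperfilter ℕ) (fun n => NormedSpace.inclusionInDoubleDual ℝ Y (y n)) 401
    (fun n f => by
      rw [NormedSpace.dual_def, ← Real.norm_eq_abs]
      refine (f.le_opNorm _).trans ?_
      rw [mul_comm]
      gcongr
      exact hyn n)
  obtain ⟨u, hu⟩ := hsurj Ψ
  have hu' : ∀ f : Y →L[ℝ] ℝ, Tendsto (fun n => f (y n)) (hyperfilter ℕ) (𝓝 (f u)) := by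
    intro f
    have := (hΨ f).2
    rw [← hu] at this
    simpa [NormedSpace.dual_def] using this
  have hR : StrictMono R := (⟨H.mono, H.supx⟩ : Blk R x).strict fun i hi => by
    have := (hQ i).1; rw [hi, map_zero] at this; norm_num at this
  have hu0 : (u : XX) = 0 := by
    refine eq_zero_of_cX fun n => ?_
    have h1 := hu' ((cX n).comp Y.subtypeL)
    refine tendsto_nhds_unique h1 ?_
    have h2 : Tendsto (fun i => cX n (y i : XX)) atTop (𝓝 0) := by
      refine squeeze_zero_norm' ?_ herr0
      filter_upwards [eventually_gt_atTop n] with i hi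
      have e : cX n (jj (x i)) = 0 := by
        rw [cX_jj]
        by_contra hne
        have := (H.supx i n hne).1
        have := hR.le_apply (x := i)
        omega
      have := cX_le n ((y i : XX) - jj (x i))
      rw [map_sub, e, sub_zero] at this
      exact this
    exact h2.mono_left Nat.hyperfilter_le_atTop
  have h1 := hu' (φ.comp Y.subtypeL)
  have h2 : (3:ℝ) / 4 ≤ (φ.comp Y.subtypeL) u :=
    ge_of_tendsto h1 (Eventually.of_forall fun i => hφy i)
  have h3 : (φ.comp Y.subtypeL) u = φ (u : XX) := rfl
  rw [h3, hu0, map_zero] at h2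
  norm_num at h2

end HJT

namespace HJT
open Finset Filter Topology

/-- Building dependent sequences, with control of the intervals. -/
lemma build2 {β : Type*} {C : ℝ} (Q : ℕ → ℕ → ℕ → V → Fn → β → Prop)
    (hQ : ∀ i j N : ℕ, ∃ x b y N', N ≤ N' ∧ WW j b ∧ Exact C j x ∧ Sup N N' x ∧ Sup N N' b ∧
      Q i N N' x b y) :
    ∃ (R : ℕ → ℕ) (b : ℕ → Fn) (x : ℕ → V) (y : ℕ → β), Dep C R b x ∧
      ∀ i, Q i (R i) (R (i + 1)) (x i) (b i) (y i) := by
  choose X B Y N' hN hW hE hX hB hq using hQ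
  let st : ℕ → List Fn × ℕ := fun i => Nat.rec ([], 0)
    (fun i s => (B i (sg s.1) s.2 :: s.1, N' i (sg s.1) s.2)) i
  have st1 : ∀ i, st (i + 1) = (B i (sg (st i).1) (st i).2 :: (st i).1, N' i (sg (st i).1) (st i).2) :=
    fun i => rfl
  set b : ℕ → Fn := fun i => B i (sg (st i).1) (st i).2 with hb
  have hp : ∀ i, pth b i = (st i).1 := by
    intro i
    induction i with
    | zero => rfl
    | succ i ih => rw [st1]; simp only [pth]; rw [ih]
  have hR : ∀ i, (st (i + 1)).2 = N' i (sg (st i).1) (st i).2 := fun i => rfl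
  refine ⟨fun i => (st i).2, b, fun i => X i (sg (st i).1) (st i).2,
    fun i => Y i (sg (st i).1) (st i).2, ⟨?_, ?_, ?_, ?_, ?_⟩, ?_⟩
  · exact monotone_nat_of_le_succ fun i => by rw [hR]; exact hN _ _ _
  · intro i; rw [hR]; exact hX _ _ _
  · intro i; rw [hR]; exact hB _ _ _
  · intro i; rw [hp]; exact hW _ _ _
  · intro i; rw [hp]; exact hE _ _ _
  · intro i; exact hq _ _ _

/-- RIS are weakly null -/
lemma RIS.weak_null {R : ℕ → ℕ} {d : ℕ → V} {lo hi : ℕ → ℕ} {τ : ℕ → ℝ}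
    (H : RIS R d lo hi τ) (f : XX →L[ℝ] ℝ) : Tendsto (fun i => f (jj (d i))) atTop (𝓝 0) := by
  rw [Metric.tendsto_atTop]
  by_contra hcon
  push Not at hcon
  obtain ⟨ε, hε, hcon⟩ := hcon
  have hfr : ∃ᶠ i in atTop, ε ≤ |f (jj (d i))| := by
    rw [frequently_atTop]
    intro N
    obtain ⟨n, hn, h⟩ := hcon N
    exact ⟨n, hn, by simpa [Real.dist_eq] using h⟩
  obtain ⟨φ, hφ, hφ2⟩ := extraction_of_frequently_atTop hfr
  set a : ℕ → ℝ := fun i => SignType.sign (f (jj (d (φ i)))) with ha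
  have ha1 : ∀ i, |a i| ≤ 1 := by
    intro i
    simp only [ha]
    rcases lt_trichotomy (f (jj (d (φ i)))) 0 with h | h | h
    · rw [sign_neg h]; simp
    · rw [h, sign_zero]; simp
    · rw [sign_pos h]; simp
  have hmul : ∀ i, ε ≤ a i * f (jj (d (φ i))) := by
    intro i
    have := hφ2 i
    simp only [ha]
    rwa [sign_mul_self]
  have H2 := (H.sub hφ).smul ha1
  obtain ⟨N, hN0, hN⟩ := H2.small (ε / (2 * (‖f‖ + 1))) (by positivity)
  have hb : ∀ n : ℕ, ‖∑ i ∈ range n, a i • d (φ i)‖ ≤ ε / (2 * (‖f‖ + 1)) * n + N := by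
    intro n
    refine norm_le_of fun g hg => ?_
    have := hN g hg 0 n
    simpa [Nat.Ico_zero_eq_range] using this
  obtain ⟨n, hn⟩ := exists_nat_gt ((‖f‖ * N) / (ε / 2))
  rw [div_lt_iff₀ (by positivity)] at hn
  have h1 : ε * n ≤ f (jj (∑ i ∈ range n, a i • d (φ i))) := by
    rw [map_sum, map_sum]
    simp only [map_smul, smul_eq_mul]
    have := sum_le_sum (s := range n) (f := fun _ => ε) (fun i _ => hmul i)
    rw [sum_const, card_range, nsmul_eq_mul] at this
    linarith
  have h2 := (le_abs_self _).trans (f.le_opNorm (jj (∑ i ∈ range n, a i • d (φ i))))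
  rw [jj.norm_map] at h2
  have h3 : ‖f‖ * ‖∑ i ∈ range n, a i • d (φ i)‖ ≤ ‖f‖ * (ε / (2 * (‖f‖ + 1)) * n + N) := by
    gcongr; exact hb n
  have h4 : ‖f‖ * (ε / (2 * (‖f‖ + 1)) * n) ≤ ε / 2 * n := by
    have : ‖f‖ * (ε / (2 * (‖f‖ + 1))) ≤ ε / 2 := by
      rw [mul_div_assoc', div_le_div_iff₀ (by positivity) (by norm_num)]
      nlinarith [norm_nonneg f]
    calc _ = ‖f‖ * (ε / (2 * (‖f‖ + 1))) * n := by ring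
      _ ≤ _ := by gcongr
  linarith

lemma tr_small {z : ℕ → XX} (hz : ∀ n, Tendsto (fun k => cX n (z k)) atTop (𝓝 0)) (N : ℕ) {δ : ℝ}
    (hδ : 0 < δ) : ∀ᶠ k in atTop, ‖tr 0 N (z k)‖ < δ := by
  have h : Tendsto (fun k => ∑ n ∈ Ico 0 N, |cX n (z k)| * ‖(Finsupp.single n (1:ℝ) : V)‖)
      atTop (𝓝 0) := by
    have : (0:ℝ) = ∑ n ∈ Ico 0 N, |(0:ℝ)| * ‖(Finsupp.single n (1:ℝ) : V)‖ := by simp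
    rw [this]
    exact tendsto_finsetSum _ fun n _ => ((hz n).abs).mul_const _
  filter_upwards [h.eventually (gt_mem_nhds hδ)] with k hk
  refine lt_of_le_of_lt ?_ hk
  unfold tr
  refine (norm_sum_le _ _).trans (sum_le_sum fun n _ => ?_)
  rw [← Real.norm_eq_abs, ← norm_smul]
  simp

/-- gliding hump -/
lemma hump {z : ℕ → XX} (hz : ∀ n, Tendsto (fun k => cX n (z k)) atTop (𝓝 0))
    (P : ℕ → ℕ → Prop) (hP : ∀ i, ∀ᶠ k in atTop, P i k) (F : ℕ → ℕ) {ρ : ℝ} (hρ : 0 < ρ) :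
    ∃ (R ψ : ℕ → ℕ) (v : ℕ → V), StrictMono ψ ∧ Blk R v ∧ (∀ i, R i ≤ ψ i) ∧
      (∀ i, F (ψ i) ≤ R (i + 1)) ∧ (∀ i, P i (ψ i)) ∧
      ∀ i, ‖z (ψ i) - jj (v i)‖ ≤ ρ / 2 ^ (i + 1) := by
  have step : ∀ i N : ℕ, ∃ (k M : ℕ) (v : V), N ≤ k ∧ k < M ∧ F k ≤ M ∧ Sup N M v ∧ P i k ∧
      ‖z k - jj v‖ ≤ ρ / 2 ^ (i + 1) := by
    intro i N
    have hδ : 0 < ρ / 2 ^ (i + 1) / 2 := by positivity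
    obtain ⟨k, hk1, hk2, hk3⟩ := ((tr_small hz N hδ).and ((hP i).and (eventually_ge_atTop N))).exists
    obtain ⟨M0, hM⟩ := Metric.tendsto_atTop.mp (tr_tendsto (z k)) _ hδ
    set M := max M0 (max (F k) (k + 1)) with hMd
    have hM' := hM M (le_max_left _ _)
    have hkM : k + 1 ≤ M := (le_max_right _ _).trans (le_max_right _ _)
    refine ⟨k, M, tr N M (z k), hk3, hkM, (le_max_left _ _).trans (le_max_right _ _), tr_Sup _ _ _,
      hk2, ?_⟩
    have e : tr 0 M (z k) = tr 0 N (z k) + tr N M (z k) := by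
      ext n; rw [Finsupp.add_apply, tr_apply, tr_apply, tr_apply]
      rcases Nat.lt_or_ge n N with h | h
      · have h1 : n < M := by omega
        have h2 : ¬ N ≤ n := by omega
        simp [h, h1, h2]
      · have h2 : ¬ n < N := by omega
        simp [h, h2]
    rw [dist_eq_norm, norm_sub_rev] at hM'
    have e2 : z k - jj (tr N M (z k)) = (z k - jj (tr 0 M (z k))) + jj (tr 0 N (z k)) := by
      rw [e, map_add]; abel
    rw [e2]
    refine (norm_add_le _ _).trans ?_
    rw [jj.norm_map]
    linarith
  choose k M v h1 h2 h3 h4 h5 h6 using step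
  let R : ℕ → ℕ := fun n => Nat.rec 0 (fun i N => M i N) n
  have hR : ∀ i, R (i + 1) = M i (R i) := fun i => rfl
  refine ⟨R, fun i => k i (R i), fun i => v i (R i), ?_, ⟨?_, ?_⟩, fun i => h1 _ _, fun i => ?_,
    fun i => h5 _ _, fun i => h6 _ _⟩
  · refine strictMono_nat_of_lt_succ fun i => ?_
    have := h1 (i + 1) (R (i + 1))
    have h' := h2 i (R i)
    rw [hR] at this ⊢
    omega
  · refine monotone_nat_of_le_succ fun i => ?_
    rw [hR]; exact (h1 _ _).trans (h2 _ _).le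
  · intro i; rw [hR]; exact h4 _ _
  · rw [hR]; exact h3 _ _

lemma exv_pert {S : XX →L[ℝ] XX} {d v : ℕ → V} {η : ℝ} (hη : 0 ≤ η)
    (h : ∀ i, ‖S (jj (d i)) - jj (v i)‖ ≤ η / 2 ^ (i + 1)) (j p : ℕ) :
    ‖S (jj (exv d j p)) - jj (exv v j p)‖ ≤ η := by
  unfold exv
  have hpos : (0:ℝ) < nn j := by exact_mod_cast nn_pos j
  have hm := mm_pos j
  have hle : (mm j : ℝ) / nn j ≤ 1 := by
    rw [div_le_one hpos]; exact_mod_cast nn_gt j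
  rw [map_smul, map_smul, map_smul, ← smul_sub, norm_smul, Real.norm_of_nonneg (by positivity)]
  have e : S (jj (∑ i ∈ Ico p (p + nn j), d i)) - jj (∑ i ∈ Ico p (p + nn j), v i) =
      ∑ i ∈ Ico p (p + nn j), (1:ℝ) • (S (jj (d i)) - jj (v i)) := by
    simp only [map_sum, one_smul, sum_sub_distrib]
  rw [e]
  have := pert_sum (s := Ico p (p + nn j)) (a := fun _ => 1) (e := fun i => S (jj (d i)) - jj (v i))
    (k := 0) (A := 1) (ρ := η) zero_le_one hη (by simp) (by simp) h
  rw [pow_zero, div_one, mul_one] at this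
  calc _ ≤ 1 * η := mul_le_mul hle this (norm_nonneg _) zero_le_one
    _ = η := one_mul _

lemma avg_bd {f : ℕ → ℝ} {c : ℝ} (j p : ℕ) (h : ∀ i, c ≤ f i) :
    c ≤ (∑ i ∈ Ico p (p + nn j), f i) / nn j := by
  have hpos : (0:ℝ) < nn j := by exact_mod_cast nn_pos j
  rw [le_div_iff₀ hpos]
  have := sum_le_sum (s := Ico p (p + nn j)) (f := fun _ => c) (fun i _ => h i)
  rw [sum_const, Nat.card_Ico, nsmul_eq_mul, show p + nn j - p = nn j by omega] at this
  linarith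

lemma pair_sums {t : ℕ → ℝ} {B : ℝ} (hB : ∀ i, Even i → |t i| ≤ B)
    (h : ∀ i, Even i → t (i + 1) = - t i) (p q : ℕ) : |∑ i ∈ Ico p q, t i| ≤ 2 * B := by
  have hB0 : 0 ≤ B := (abs_nonneg _).trans (hB 0 (by simp))
  have key : ∀ m, ∑ i ∈ range (2 * m), t i = 0 := by
    intro m
    induction m with
    | zero => simp
    | succ m ih =>
      rw [show 2 * (m + 1) = 2 * m + 1 + 1 by ring, sum_range_succ, sum_range_succ, ih,
        h (2 * m) (by simp)]
      ring
  have key2 : ∀ n, |∑ i ∈ range n, t i| ≤ B := by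
    intro n
    rcases Nat.even_or_odd' n with ⟨m, rfl | rfl⟩
    · rw [key, abs_zero]; exact hB0
    · rw [sum_range_succ, key, zero_add]; exact hB _ (by simp)
  rcases le_total q p with h | h
  · rw [Ico_eq_empty_of_le h, sum_empty, abs_zero]; linarith
  · rw [sum_Ico_eq_sub _ h]
    have := abs_sub (∑ i ∈ range q, t i) (∑ i ∈ range p, t i)
    linarith [key2 p, key2 q]

end HJT

namespace HJT
open Finset Filter Topology

lemma core {R : ℕ → ℕ} {d : ℕ → V} {lo hi : ℕ → ℕ} {τ : ℕ → ℝ} (H : RIS R d lo hi τ)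
    {κ δ : ℝ} (hκ : 0 < κ) (hδ : 0 < δ) {S : XX →L[ℝ] XX} {g : ℕ → Fn} (hg : ∀ i, KK (g i))
    (hgs : ∀ i, Sup (R i) (R (i + 1)) (g i)) (hgd : ∀ i, κ / 2 ≤ ev (g i) (d i))
    (hgS : Tendsto (fun i => evX (g i) (S (jj (d i)))) atTop (𝓝 0))
    (hS : ∀ i, δ ≤ ‖S (jj (d i))‖) : False := by
  have hb := H.bl.blk
  have hd0 : ∀ i, d i ≠ 0 := fun i hi => by
    have := hgd i; rw [hi, map_zero] at this; linarith
  have hR := hb.strict hd0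
  set A : ℝ := 1 + 200 / κ with hA
  have hA1 : 1 ≤ A := by rw [hA]; have : 0 < 200 / κ := by positivity
                         linarith
  set η : ℝ := δ / (16 * A) with hη
  have hη0 : 0 < η := by positivity
  have hηA : A * η = δ / 16 := by rw [hη]; field_simp
  have hηδ : η ≤ δ / 16 := by nlinarith
  obtain ⟨R', ψ, v, hψ, hbv, hR1, hR2, hP, hv⟩ := hump (z := fun k => S (jj (d k)))
    (fun n => H.weak_null ((cX n).comp S)) (fun _ k => |evX (g k) (S (jj (d k)))| ≤ η)
    (fun _ => by
      have := hgS.abs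
      rw [abs_zero] at this
      filter_upwards [this.eventually (gt_mem_nhds hη0)] with k hk using hk.le)
    (fun k => R (k + 1)) hη0
  have hw1 : ∀ i, R' i ≤ R (ψ i) := fun i => (hR1 i).trans hR.le_apply
  have H' := H.sub hψ
  have hbd : Blk R' (fun i => d (ψ i)) := ⟨hbv.mono, fun i => (hb.sup (ψ i)).mono (hw1 i) (hR2 i)⟩
  have hgs' : ∀ i, Sup (R' i) (R' (i + 1)) (g (ψ i)) := fun i =>
    (hgs (ψ i)).mono (hw1 i) (hR2 i)
  have hR' := hbd.strict fun i => hd0 _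
  have hv' : ∀ i, ‖S (jj (d (ψ i))) - jj (v i)‖ ≤ η := by
    intro i
    refine (hv i).trans (div_le_self hη0.le ?_)
    exact one_le_pow₀ (by norm_num)
  have hvn : ∀ i, δ / 2 < ‖v i‖ := by
    intro i
    have h1 := norm_sub_norm_le (S (jj (d (ψ i)))) (jj (v i))
    rw [jj.norm_map] at h1
    linarith [hS (ψ i), hv' i]
  choose h hh hhs hhv using fun i => exists_norming' (hbv.sup i) (hvn i)
  have hgv : ∀ i, |ev (g (ψ i)) (v i)| ≤ 2 * η := by
    intro i
    have e : ev (g (ψ i)) (v i) = evX (g (ψ i)) (S (jj (d (ψ i)))) -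
        evX (g (ψ i)) (S (jj (d (ψ i))) - jj (v i)) := by rw [map_sub, evX_jj]; ring
    rw [e]
    have h1 := abs_sub (evX (g (ψ i)) (S (jj (d (ψ i))))) (evX (g (ψ i)) (S (jj (d (ψ i))) - jj (v i)))
    have h2 := evX_le (hg (ψ i)) (S (jj (d (ψ i))) - jj (v i))
    linarith [hP i, hv' i]
  obtain ⟨R2, b, x, y, D, hQ⟩ := build2 (β := V) (C := 100)
    (fun i N N' x b y => Sup N N' y ∧ ‖S (jj x) - jj y‖ ≤ η ∧ |ev b x| ≤ 100 ∧
      (Even i → δ / 2 ≤ ev b y) ∧ (¬ Even i → κ / 2 ≤ ev b x ∧ |ev b y| ≤ 2 * η)) (by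
    intro i j N
    have hN : N ≤ R' N := hR'.le_apply
    have hN' : N ≤ R' (N + nn j) := hN.trans (hR'.monotone (by omega))
    have hE : Exact 100 j (exv (fun i => d (ψ i)) j N) := H'.exact j N
    have hp : ‖S (jj (exv (fun i => d (ψ i)) j N)) - jj (exv v j N)‖ ≤ η := exv_pert hη0.le hv j N
    by_cases hi : Even i
    · have hW := exf_mem hR'.monotone hh hhs j N
      refine ⟨exv (fun i => d (ψ i)) j N, exf h j N, exv v j N, R' (N + nn j), hN', hW,
        hE, (exv_sup hbd j N).mono hN le_rfl, (exf_sup hR'.monotone hhs j N).mono hN le_rfl,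
        (exv_sup hbv j N).mono hN le_rfl, hp, ?_, fun _ => ?_, fun h => absurd hi h⟩
      · exact (ev_le (InK.up j _ hW) _).trans hE.e1
      · rw [exf_exv hbv hhs]
        exact avg_bd j N fun i => (hhv i).le
    · have hW := exf_mem hR'.monotone (fun i => hg (ψ i)) hgs' j N
      refine ⟨exv (fun i => d (ψ i)) j N, exf (fun i => g (ψ i)) j N, exv v j N, R' (N + nn j), hN',
        hW, hE, (exv_sup hbd j N).mono hN le_rfl, (exf_sup hR'.monotone hgs' j N).mono hN le_rfl,
        (exv_sup hbv j N).mono hN le_rfl, hp, ?_, fun h => absurd h hi, fun _ => ⟨?_, ?_⟩⟩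
      · exact (ev_le (InK.up j _ hW) _).trans hE.e1
      · rw [exf_exv hbd hgs']
        exact avg_bd j N fun i => hgd (ψ i)
      · rw [exf_exv hbv hgs', abs_le]
        constructor
        · exact avg_bd j N fun i => (abs_le.mp (hgv i)).1
        · have := avg_bd (f := fun i => - ev (g (ψ i)) (v i)) (c := -(2 * η)) j N
            fun i => by linarith [(abs_le.mp (hgv i)).2]
          rw [sum_neg_distrib, neg_div] at this
          linarith)
  set a : ℕ → ℝ := fun i => if Even i then 1 else
    - ev (b (i - 1)) (x (i - 1)) / ev (b i) (x i) with ha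
  have hodd : ∀ i, Even i → ¬ Even (i + 1) := fun i hi => by simpa [Nat.even_add_one] using hi
  have ha1 : ∀ i, |a i| ≤ A := by
    intro i
    simp only [ha]
    split_ifs with hi
    · simpa using hA1
    · have h1 := ((hQ i).2.2.2.2 hi).1
      have h2 := (hQ (i - 1)).2.2.1
      have hpos : 0 < ev (b i) (x i) := by linarith
      rw [abs_div, abs_neg, abs_of_pos hpos, hA, div_le_iff₀ hpos]
      have h3 : 200 / κ * (κ / 2) = 100 := by field_simp; norm_num
      have h4 : 200 / κ * (κ / 2) ≤ 200 / κ * ev (b i) (x i) := by gcongr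
      linarith
  obtain ⟨N, hN0, hN⟩ := D.small (a := a) (A := A) (B := 2 * 100) ha1 (by
    refine pair_sums ?_ ?_
    · intro i hi
      simp only [ha, if_pos hi, one_mul]
      exact (hQ i).2.2.1
    · intro i hi
      have h1 := ((hQ (i + 1)).2.2.2.2 (hodd i hi)).1
      have hpos : ev (b (i + 1)) (x (i + 1)) ≠ 0 := by linarith
      simp only [ha, if_pos hi, if_neg (hodd i hi), one_mul, Nat.add_sub_cancel]
      field_simp) (δ / (16 * (‖S‖ + 1))) (by positivity)
  have hval : ∀ n i, i < n → |evX (∑ k ∈ range n, b k) (S (jj (x i))) - ev (b i) (y i)| ≤ η := by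
    intro n i hi
    have e1 : ev (∑ k ∈ range n, b k) (y i) = ev (b i) (y i) := by
      rw [ev_sum, sum_eq_single_of_mem i (mem_range.mpr hi)]
      intro m _ hm
      refine ev_disj (hQ i).1 (D.supb m) ?_
      rcases lt_or_gt_of_ne hm with h' | h'
      · exact Or.inr (D.mono h')
      · exact Or.inl (D.mono h')
    rw [← e1, ← evX_jj, ← map_sub]
    exact (evX_le (dep_sum_mem D.wb n) _).trans (hQ i).2.1
  have hlow : ∀ n m, 2 * m ≤ n →
      m * (δ / 4) ≤ ∑ i ∈ range (2 * m), a i * evX (∑ k ∈ range n, b k) (S (jj (x i))) := by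
    intro n m
    induction m with
    | zero => simp
    | succ m ih =>
      intro hn
      have ih := ih (by omega)
      rw [show 2 * (m + 1) = 2 * m + 1 + 1 by ring, sum_range_succ, sum_range_succ]
      have he : Even (2 * m) := by simp
      have h1 := abs_le.mp (hval n (2 * m) (by omega))
      have h2 := abs_le.mp (hval n (2 * m + 1) (by omega))
      have h3 := (hQ (2 * m)).2.2.2.1 he
      have h4 := abs_le.mp ((hQ (2 * m + 1)).2.2.2.2 (hodd _ he)).2
      have h5 : a (2 * m) = 1 := by simp only [ha, if_pos he]
      have h6 : -(A * (3 * η)) ≤ a (2 * m + 1) * evX (∑ k ∈ range n, b k) (S (jj (x (2 * m + 1)))) := by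
        refine (abs_le.mp ?_).1
        rw [abs_mul]
        refine mul_le_mul (ha1 _) ?_ (abs_nonneg _) (by linarith)
        rw [abs_le]; constructor <;> linarith
      rw [h5]
      push_cast
      linarith
  obtain ⟨m, hm⟩ := exists_nat_gt ((‖S‖ * N) / (δ / 8))
  rw [div_lt_iff₀ (by positivity)] at hm
  have h1 := hlow (2 * m) m le_rfl
  have e : ∑ i ∈ range (2 * m), a i * evX (∑ k ∈ range (2 * m), b k) (S (jj (x i))) =
      evX (∑ k ∈ range (2 * m), b k) (S (jj (∑ i ∈ range (2 * m), a i • x i))) := by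
    simp only [map_sum, map_smul, smul_eq_mul]
  rw [e] at h1
  have h2 := (le_abs_self _).trans (evX_le (dep_sum_mem D.wb (2 * m))
    (S (jj (∑ i ∈ range (2 * m), a i • x i))))
  have h3 := S.le_opNorm (jj (∑ i ∈ range (2 * m), a i • x i))
  rw [jj.norm_map] at h3
  have h4 : ‖S‖ * ‖∑ i ∈ range (2 * m), a i • x i‖ ≤ ‖S‖ * (δ / (16 * (‖S‖ + 1)) * (2 * m : ℕ) + N) := by
    gcongr; exact hN (2 * m)
  have h5 : ‖S‖ * (δ / (16 * (‖S‖ + 1)) * (2 * m : ℕ)) ≤ δ / 8 * m := by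
    have : ‖S‖ * (δ / (16 * (‖S‖ + 1))) ≤ δ / 16 := by
      rw [mul_div_assoc', div_le_div_iff₀ (by positivity) (by norm_num)]
      nlinarith [norm_nonneg S]
    push_cast
    calc _ = ‖S‖ * (δ / (16 * (‖S‖ + 1))) * (2 * m) := by ring
      _ ≤ δ / 16 * (2 * m) := by gcongr
      _ = _ := by ring
  linarith

lemma lemL {R : ℕ → ℕ} {d : ℕ → V} {lo hi : ℕ → ℕ} {τ : ℕ → ℝ} (H : RIS R d lo hi τ)
    {κ : ℝ} (hκ : 0 < κ) (hd : ∀ i, κ ≤ ‖d i‖) (T : XX →L[ℝ] XX) :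
    ∃ (c : ℝ) (φ : ℕ → ℕ), StrictMono φ ∧
      Tendsto (fun i => ‖(T - c • ContinuousLinearMap.id ℝ XX) (jj (d (φ i)))‖) atTop (𝓝 0) := by
  have hb := H.bl.blk
  choose g hg hgs hgd using fun i => exists_norming' (c := κ / 2) (hb.sup i)
    (by linarith [hd i] : κ / 2 < ‖d i‖)
  set c : ℕ → ℝ := fun i => evX (g i) (T (jj (d i))) / ev (g i) (d i) with hc
  have hTd : ∀ i, |evX (g i) (T (jj (d i)))| ≤ ‖T‖ * 4 := by
    intro i
    refine (evX_le (hg i) _).trans ((T.le_opNorm _).trans ?_)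
    rw [jj.norm_map]
    gcongr
    exact H.bl.nz i
  have hcb : ∀ i, c i ∈ Set.Icc (-(‖T‖ * 4 / (κ / 2))) (‖T‖ * 4 / (κ / 2)) := by
    intro i
    rw [Set.mem_Icc, ← abs_le]
    simp only [hc]
    rw [abs_div, abs_of_pos (by linarith [hgd i] : 0 < ev (g i) (d i))]
    exact div_le_div₀ (by positivity) (hTd i) (by positivity) (hgd i).le
  obtain ⟨c0, _, φ, hφ, hlim⟩ := isCompact_Icc.tendsto_subseq hcb
  refine ⟨c0, φ, hφ, ?_⟩
  set S := T - c0 • ContinuousLinearMap.id ℝ XX with hS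
  have hgS : Tendsto (fun i => evX (g (φ i)) (S (jj (d (φ i))))) atTop (𝓝 0) := by
    have e : ∀ i, evX (g (φ i)) (S (jj (d (φ i)))) = (c (φ i) - c0) * ev (g (φ i)) (d (φ i)) := by
      intro i
      have hne : ev (g (φ i)) (d (φ i)) ≠ 0 := by linarith [hgd (φ i)]
      have : S (jj (d (φ i))) = T (jj (d (φ i))) - c0 • jj (d (φ i)) := by simp [hS]
      rw [this, map_sub, map_smul, evX_jj, smul_eq_mul, hc]
      field_simp
    have h0 : Tendsto (fun i => |c (φ i) - c0| * 4) atTop (𝓝 0) := by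
      have := ((hlim.sub_const c0).abs).mul_const 4
      simpa using this
    refine squeeze_zero_norm (fun i => ?_) h0
    rw [e, norm_mul, Real.norm_eq_abs, Real.norm_eq_abs]
    gcongr
    exact (ev_le (hg _) _).trans (H.bl.nz _)
  rw [Metric.tendsto_atTop]
  by_contra hcon
  push Not at hcon
  obtain ⟨δ, hδ, hcon⟩ := hcon
  have hfr : ∃ᶠ i in atTop, δ ≤ ‖S (jj (d (φ i)))‖ := by
    rw [frequently_atTop]
    intro N
    obtain ⟨n, hn, h⟩ := hcon N
    exact ⟨n, hn, by simpa [Real.dist_eq] using h⟩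
  obtain ⟨ψ, hψ, hψ2⟩ := extraction_of_frequently_atTop hfr
  have hm := hφ.comp hψ
  refine core (H.sub hm) hκ hδ (S := S) (g := fun i => g (φ (ψ i))) (fun i => hg _)
    (fun i => (hgs (φ (ψ i))).mono le_rfl (hb.mono (hm (Nat.lt_succ_self i))))
    (fun i => (hgd _).le) (hgS.comp hψ.tendsto_atTop) hψ2

lemma small_sub {R : ℕ → ℕ} {d : ℕ → V} (hb : Blk R d) {κ : ℝ} (hκ : 0 < κ)
    (hd : ∀ i, κ ≤ ‖d i‖) {S : XX →L[ℝ] XX} {φ : ℕ → ℕ} (hφ : StrictMono φ)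
    (hS : Tendsto (fun i => ‖S (jj (d (φ i)))‖) atTop (𝓝 0)) {ε : ℝ} (hε : 0 < ε) :
    ∃ Y : Submodule ℝ XX, ¬ FiniteDimensional ℝ Y ∧ ∀ y ∈ Y, ‖S y‖ ≤ ε * ‖y‖ := by
  have hex : ∀ n N : ℕ, ∃ k > N, ‖S (jj (d (φ k)))‖ ≤ κ * (ε / 2 ^ (n + 1)) := by
    intro n N
    have := (hS.eventually (gt_mem_nhds (by positivity : 0 < κ * (ε / 2 ^ (n + 1))))).and
      (eventually_gt_atTop N)
    obtain ⟨k, h1, h2⟩ := this.exists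
    exact ⟨k, h2, h1.le⟩
  obtain ⟨ψ, hψ, hψ2⟩ := extraction_forall_of_frequently
    (P := fun n k => ‖S (jj (d (φ k)))‖ ≤ κ * (ε / 2 ^ (n + 1))) (fun n => by
      rw [frequently_atTop]
      intro N
      obtain ⟨k, h1, h2⟩ := hex n N
      exact ⟨k, h1.le, h2⟩)
  set u : ℕ → V := fun i => ‖d (φ (ψ i))‖⁻¹ • d (φ (ψ i)) with hu
  have hpos : ∀ i, 0 < ‖d i‖ := fun i => hκ.trans_le (hd i)
  have hbu : Blk (R ∘ (φ ∘ ψ)) u := (hb.sub (hφ.comp hψ)).smul _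
  have hu1 : ∀ i, ‖u i‖ = 1 := fun i => by
    rw [hu, norm_smul, norm_inv, norm_norm, inv_mul_cancel₀ (hpos _).ne']
  have hSu : ∀ i, ‖S (jj (u i))‖ ≤ ε / 2 ^ (i + 1) := by
    intro i
    rw [hu, map_smul, map_smul, norm_smul, norm_inv, norm_norm, inv_mul_le_iff₀ (hpos _)]
    refine (hψ2 i).trans ?_
    gcongr
    exact hd _
  refine ⟨(US u 0).map jj.toLinearMap, ?_, ?_⟩
  · intro hfin
    have hli : LinearIndependent ℝ u := by
      rw [linearIndependent_iff']
      intro s a h i hi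
      have h2 : rs ((R ∘ φ ∘ ψ) i) ((R ∘ φ ∘ ψ) (i + 1)) (∑ i ∈ s, a i • u i) = 0 := by
        rw [h, rs_zero]
      rw [rs_sum, sum_eq_single_of_mem i hi, rs_smul, (hbu.sup i).rs_eq le_rfl le_rfl] at h2
      · rcases smul_eq_zero.mp h2 with h3 | h3
        · exact h3
        · have := hu1 i; rw [h3, norm_zero] at this; norm_num at this
      · intro m _ hm
        rw [rs_smul, (hbu.sup m).rs_eq_zero, smul_zero]
        rcases lt_or_gt_of_ne hm with h' | h'
        · exact Or.inl (hbu.mono h')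
        · exact Or.inr (hbu.mono h')
    have h1 := hli.map' jj.toLinearMap (LinearMap.ker_eq_bot.mpr jj.injective)
    let f : ℕ → (US u 0).map jj.toLinearMap := fun i =>
      ⟨jj (u i), Submodule.mem_map_of_mem (US_mem u (Nat.zero_le i))⟩
    have h2 : LinearIndependent ℝ f := LinearIndependent.of_comp (Submodule.subtype _) h1
    have := h2.finite
    exact not_finite ℕ
  · rintro _ ⟨w, hw, rfl⟩
    obtain ⟨s, a, hs, rfl, ha⟩ := US_rep hbu hu1 hw
    have := pert_sum (s := s) (a := a) (e := fun i => S (jj (u i))) (k := 0) (ρ := ε)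
      (norm_nonneg _) hε.le hs ha hSu
    rw [pow_zero, div_one] at this
    have e : S (jj.toLinearMap (∑ i ∈ s, a i • u i)) = ∑ i ∈ s, a i • S (jj (u i)) := by
      simp only [map_sum, map_smul]; rfl
    have e2 : ‖jj.toLinearMap (∑ i ∈ s, a i • u i)‖ = ‖∑ i ∈ s, a i • u i‖ := jj.norm_map _
    rw [e, e2]
    exact this

lemma scal_unique {T : XX →L[ℝ] XX} {l1 l2 : ℝ}
    (h1 : ∀ ε > 0, ∃ Y : Submodule ℝ XX, ¬ FiniteDimensional ℝ Y ∧
      ∀ y ∈ Y, ‖(T - l1 • ContinuousLinearMap.id ℝ XX) y‖ ≤ ε * ‖y‖)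
    (h2 : ∀ ε > 0, ∃ Y : Submodule ℝ XX, ¬ FiniteDimensional ℝ Y ∧
      ∀ y ∈ Y, ‖(T - l2 • ContinuousLinearMap.id ℝ XX) y‖ ≤ ε * ‖y‖) : l1 = l2 := by
  by_contra hne
  have hpos : 0 < |l1 - l2| := abs_pos.mpr (sub_ne_zero.mpr hne)
  set K : ℝ := 2 + ‖T - l2 • ContinuousLinearMap.id ℝ XX‖ with hK
  have hK0 : 0 < K := by positivity
  set ε := |l1 - l2| / (2 * K) with hε
  have hε0 : 0 < ε := by positivity
  obtain ⟨Y, hY, hY2⟩ := h1 ε hε0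
  obtain ⟨Z, hZ, hZ2⟩ := h2 ε hε0
  obtain ⟨y, hy, z, hz, hy1, hz1, hyz⟩ := XX_HI Y Z hY hZ ε hε0
  have a1 := hY2 y hy
  have a2 := hZ2 z hz
  have a3 := (T - l2 • ContinuousLinearMap.id ℝ XX).le_opNorm (y - z)
  have e : (l1 - l2) • y = (T - l2 • ContinuousLinearMap.id ℝ XX) (y - z) +
      (T - l2 • ContinuousLinearMap.id ℝ XX) z - (T - l1 • ContinuousLinearMap.id ℝ XX) y := by
    simp only [map_sub, ContinuousLinearMap.sub_apply, ContinuousLinearMap.smul_apply,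
      ContinuousLinearMap.id_apply, sub_smul]
    abel
  have h3 : |l1 - l2| ≤ K * ε := by
    have : ‖(l1 - l2) • y‖ = |l1 - l2| := by rw [norm_smul, hy1, mul_one, Real.norm_eq_abs]
    rw [← this, e]
    refine (norm_sub_le _ _).trans ?_
    have := norm_add_le ((T - l2 • ContinuousLinearMap.id ℝ XX) (y - z))
      ((T - l2 • ContinuousLinearMap.id ℝ XX) z)
    have h5 : ‖T - l2 • ContinuousLinearMap.id ℝ XX‖ * ‖y - z‖ ≤
      ‖T - l2 • ContinuousLinearMap.id ℝ XX‖ * ε := by gcongr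
    rw [hy1] at a1; rw [hz1] at a2
    rw [hK]; linarith
  have h4 : K * ε = |l1 - l2| / 2 := by rw [hε]; field_simp
  linarith

end HJT

namespace HJT
open Finset Filter Topology

lemma wc_crit {E : Type*} [NormedAddCommGroup E] [NormedSpace ℝ E] (W : E →L[ℝ] E)
    (h : ∀ Φ : (E →L[ℝ] ℝ) →L[ℝ] ℝ, ∃ x, ∀ f : E →L[ℝ] ℝ, Φ (f.comp W) = f x) :
    IsWeaklyCompactOperator W := by
  set K : Set E := {x | ∃ Φ : (E →L[ℝ] ℝ) →L[ℝ] ℝ, (∀ g, |Φ g| ≤ 1 * ‖g‖) ∧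
    ∀ f : E →L[ℝ] ℝ, f x = Φ (f.comp W)} with hK
  have hsub : W '' Metric.closedBall 0 1 ⊆ K := by
    rintro _ ⟨x, hx, rfl⟩
    rw [mem_closedBall_zero_iff] at hx
    refine ⟨NormedSpace.inclusionInDoubleDual ℝ E x, fun g => ?_, fun f => rfl⟩
    have h1 : |g x| ≤ ‖g‖ * ‖x‖ := g.le_opNorm x
    have h2 : ‖g‖ * ‖x‖ ≤ ‖g‖ * 1 := by gcongr
    rw [NormedSpace.dual_def]
    linarith
  have hcont : ∀ f : E →L[ℝ] ℝ, @Continuous E ℝ (weakTopology E) _ f := fun f =>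
    continuous_iff_le_induced.mpr (iInf_le _ f)
  have hcomp : @IsCompact E (weakTopology E) K := by
    rw [@isCompact_iff_ultrafilter_le_nhds E (weakTopology E)]
    intro 𝒰 hU
    have hmem : ∀ᶠ x in (𝒰 : Filter E), x ∈ K := Filter.le_principal_iff.mp hU
    have hc : ∀ x : E, ∃ Φ : (E →L[ℝ] ℝ) →L[ℝ] ℝ, (∀ g, |Φ g| ≤ 1 * ‖g‖) ∧
        (x ∈ K → ∀ f : E →L[ℝ] ℝ, f x = Φ (f.comp W)) := by
      intro x
      by_cases hx : x ∈ K
      · obtain ⟨Φ, h1, h2⟩ := hx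
        exact ⟨Φ, h1, fun _ => h2⟩
      · refine ⟨0, fun g => by simp, fun h => absurd h hx⟩
    choose G hG1 hG2 using hc
    obtain ⟨Φ, hΦ⟩ := ulim 𝒰 G 1 hG1
    obtain ⟨x, hx⟩ := h Φ
    refine ⟨x, ⟨Φ, fun g => (hΦ g).1, fun f => (hx f).symm⟩, ?_⟩
    unfold weakTopology
    rw [nhds_iInf]
    refine le_iInf fun f => ?_
    rw [nhds_induced, ← tendsto_iff_comap]
    have h1 := (hΦ (f.comp W)).2
    rw [hx f] at h1
    refine h1.congr' ?_
    filter_upwards [hmem] with y hy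
    exact (hG2 y hy f).symm
  have ht2 : @T2Space E (weakTopology E) := by
    refine @T2Space.mk E (weakTopology E) ?_
    intro x y hxy
    have : ∃ f : E →L[ℝ] ℝ, f x ≠ f y := by
      obtain ⟨f, hf⟩ := SeparatingDual.exists_ne_zero (R := ℝ) (sub_ne_zero.mpr hxy)
      exact ⟨f, fun h' => hf (by rw [map_sub, h', sub_self])⟩
    obtain ⟨f, hf⟩ := this
    exact @separated_by_continuous E ℝ (weakTopology E) _ _ f (hcont f) x y hf
  have hr1 : @R1Space E (weakTopology E) := by
    letI := weakTopology E
    exact @T2Space.r1Space E (weakTopology E) ht2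
  exact @IsCompact.closure_of_subset E (weakTopology E) hr1 _ _ hcomp hsub

lemma goldstine {E ι : Type*} [NormedAddCommGroup E] [NormedSpace ℝ E] [Fintype ι]
    (Φ : (E →L[ℝ] ℝ) →L[ℝ] ℝ) {M : ℝ} (hM : 0 < M) (hΦ : ‖Φ‖ ≤ M)
    (f : ι → E →L[ℝ] ℝ) {ε : ℝ} (hε : 0 < ε) : ∃ x, ‖x‖ ≤ M ∧ ∀ i, |f i x - Φ (f i)| < ε := by
  classical
  set L : E →L[ℝ] (ι → ℝ) := ContinuousLinearMap.pi f with hL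
  by_cases hy : (fun i => Φ (f i)) ∈ closure (L '' Metric.closedBall 0 M)
  · rw [Metric.mem_closure_iff] at hy
    obtain ⟨_, ⟨x, hx, rfl⟩, hd⟩ := hy ε hε
    rw [mem_closedBall_zero_iff] at hx
    refine ⟨x, hx, fun i => ?_⟩
    have := (dist_le_pi_dist (fun i => Φ (f i)) (L x) i).trans_lt hd
    rwa [dist_comm, Real.dist_eq] at this
  · exfalso
    obtain ⟨g, u, h1, h2⟩ := geometric_hahn_banach_closed_point
      ((convex_closedBall (0:E) M).linear_image L.toLinearMap).closure isClosed_closure hy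
    have h3 : ∀ x : E, ‖x‖ ≤ M → g (L x) < u := fun x hx =>
      h1 _ (subset_closure ⟨x, by rwa [mem_closedBall_zero_iff], rfl⟩)
    have hu : 0 < u := by simpa using h3 0 (by simpa using hM.le)
    have h4 : ∀ x : E, g (L x) ≤ u / M * ‖x‖ := by
      intro x
      rcases eq_or_ne x 0 with rfl | hx
      · simp
      have hx0 := norm_pos_iff.mpr hx
      have := h3 ((M / ‖x‖) • x) (by
        rw [norm_smul, Real.norm_of_nonneg (by positivity), div_mul_cancel₀ _ hx0.ne'])
      rw [map_smul, map_smul, smul_eq_mul, div_mul_eq_mul_div, div_lt_iff₀ hx0] at this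
      rw [div_mul_eq_mul_div, le_div_iff₀ hM]
      linarith
    have h5 : ‖g.comp L‖ ≤ u / M := by
      refine ContinuousLinearMap.opNorm_le_bound _ (by positivity) fun x => ?_
      rw [Real.norm_eq_abs, abs_le]
      constructor
      · have := h4 (-x)
        rw [map_neg, map_neg, norm_neg] at this
        simp only [ContinuousLinearMap.comp_apply]
        linarith
      · exact h4 x
    have hrep : ∀ y : ι → ℝ, g y = ∑ i, y i * g (Pi.single i 1) := by
      intro y
      conv_lhs => rw [pi_eq_sum_univ' y]
      rw [map_sum]
      refine sum_congr rfl fun i _ => ?_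
      rw [map_smul, smul_eq_mul]
    have h6 : g.comp L = ∑ i, g (Pi.single i 1) • f i := by
      ext x
      rw [ContinuousLinearMap.comp_apply, hrep]
      simp [hL, mul_comm]
    have h7 : Φ (g.comp L) = g (fun i => Φ (f i)) := by
      rw [h6, map_sum, hrep]
      refine sum_congr rfl fun i _ => ?_
      rw [map_smul, smul_eq_mul, mul_comm]
    have h8 : Φ (g.comp L) ≤ M * (u / M) :=
      (le_abs_self _).trans ((Φ.le_opNorm _).trans (by gcongr))
    rw [mul_div_cancel₀ _ hM.ne', h7] at h8
    linarith

lemma annih {E : Type*} [NormedAddCommGroup E] [NormedSpace ℝ E]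
    (Ψ : (E →L[ℝ] ℝ) →L[ℝ] ℝ) {θ : ℝ} (hθ : 0 ≤ θ)
    (h : ∀ x, θ < ‖Ψ - NormedSpace.inclusionInDoubleDual ℝ E x‖) (F : Finset E) :
    ∃ ψ : E →L[ℝ] ℝ, ‖ψ‖ ≤ 1 ∧ (∀ x ∈ F, ψ x = 0) ∧ θ ≤ Ψ ψ := by
  by_contra hcon
  push Not at hcon
  set N : Submodule ℝ (E →L[ℝ] ℝ) :=
    ⨅ x : F, LinearMap.ker (NormedSpace.inclusionInDoubleDual ℝ E x).toLinearMap with hN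
  have hmem : ∀ ψ : E →L[ℝ] ℝ, ψ ∈ N ↔ ∀ x ∈ F, ψ x = 0 := by
    intro ψ
    simp [hN, Submodule.mem_iInf, NormedSpace.dual_def]
  have hb : ∀ ψ ∈ N, Ψ ψ ≤ θ * ‖ψ‖ := by
    intro ψ hψ
    rcases eq_or_ne ψ 0 with rfl | h0
    · simp
    have hn := norm_pos_iff.mpr h0
    have := hcon (‖ψ‖⁻¹ • ψ) (by rw [norm_smul, norm_inv, norm_norm, inv_mul_cancel₀ hn.ne'])
      ((hmem _).mp (N.smul_mem _ hψ))
    rw [map_smul, smul_eq_mul, inv_mul_lt_iff₀ hn] at this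
    linarith
  obtain ⟨Θ, hΘ1, hΘ2⟩ := exists_extension_norm_eq N (Ψ.comp N.subtypeL)
  have hΘ : ‖Θ‖ ≤ θ := by
    rw [hΘ2]
    refine ContinuousLinearMap.opNorm_le_bound _ hθ fun ψ => ?_
    rw [Real.norm_eq_abs, abs_le]
    have h1 := hb _ ψ.2
    have h2 := hb _ (N.neg_mem ψ.2)
    rw [map_neg, norm_neg] at h2
    have e : (Ψ.comp N.subtypeL) ψ = Ψ ψ := rfl
    have e2 : ‖ψ‖ = ‖(ψ : E →L[ℝ] ℝ)‖ := rfl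
    rw [e, e2]
    constructor <;> linarith
  have hsp := mem_span_of_iInf_ker_le_ker
    (L := fun x : F => (NormedSpace.inclusionInDoubleDual ℝ E x).toLinearMap)
    (K := (Ψ - Θ).toLinearMap) (by
      intro ψ hψ
      have := hΘ1 ⟨ψ, hψ⟩
      simp only [LinearMap.mem_ker, ContinuousLinearMap.coe_coe, ContinuousLinearMap.sub_apply]
      rw [this]
      simp)
  have hx : ∃ x : E, (NormedSpace.inclusionInDoubleDual ℝ E x).toLinearMap = (Ψ - Θ).toLinearMap := by
    have hle : Submodule.span ℝ (Set.range fun x : F =>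
        (NormedSpace.inclusionInDoubleDual ℝ E x).toLinearMap) ≤
        LinearMap.range ((ContinuousLinearMap.coeLM ℝ).comp
          (NormedSpace.inclusionInDoubleDual ℝ E).toLinearMap) := by
      rw [Submodule.span_le]
      rintro _ ⟨x, rfl⟩
      exact ⟨x, rfl⟩
    obtain ⟨x, hx⟩ := hle hsp
    exact ⟨x, hx⟩
  obtain ⟨x, hx⟩ := hx
  have hx' : NormedSpace.inclusionInDoubleDual ℝ E x = Ψ - Θ :=
    ContinuousLinearMap.coe_injective hx
  have := h x
  have e : Ψ - NormedSpace.inclusionInDoubleDual ℝ E x = Θ := by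
    rw [hx']
    ext f
    simp
  rw [e] at this
  linarith

lemma far_closed {F : Type*} [NormedAddCommGroup F] {S : Set F} (hS : IsClosed S) {a : F}
    (ha : a ∉ S) : ∃ θ : ℝ, 0 < θ ∧ ∀ b ∈ S, θ < ‖a - b‖ := by
  obtain ⟨θ, hθ, hball⟩ := Metric.isOpen_iff.mp hS.isOpen_compl a ha
  refine ⟨θ / 2, by positivity, fun b hb => ?_⟩
  by_contra hc
  push Not at hc
  have hin : b ∈ Metric.ball a θ := by
    rw [Metric.mem_ball, dist_comm, dist_eq_norm]
    linarith
  exact hball hin hb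

lemma sep_seq {E : Type*} [NormedAddCommGroup E] [NormedSpace ℝ E] [CompleteSpace E]
    (W : E →L[ℝ] E) (Φ : (E →L[ℝ] ℝ) →L[ℝ] ℝ)
    (h : ¬ ∃ x, ∀ f : E →L[ℝ] ℝ, Φ (f.comp W) = f x) :
    ∃ (M θ : ℝ) (x : ℕ → E) (ψ : ℕ → E →L[ℝ] ℝ), 0 < M ∧ 0 < θ ∧ (∀ n, ‖x n‖ ≤ M) ∧
      (∀ n, ‖ψ n‖ ≤ 1) ∧ (∀ m n, m < n → ψ n (W (x m)) = 0) ∧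
      ∀ m n, n ≤ m → θ ≤ ψ n (W (x m)) := by
  classical
  set Ψ : (E →L[ℝ] ℝ) →L[ℝ] ℝ := Φ.comp ((ContinuousLinearMap.compL ℝ E E ℝ).flip W) with hΨ
  have hΨa : ∀ f, Ψ f = Φ (f.comp W) := fun f => rfl
  set J := NormedSpace.inclusionInDoubleDual ℝ E with hJ
  have hiso : Isometry J := (NormedSpace.inclusionInDoubleDualLi (E := E) ℝ).isometry
  have hcl : IsClosed (Set.range J) := hiso.isClosedEmbedding.isClosed_range
  have hnot : Ψ ∉ Set.range J := by
    rintro ⟨x, hx⟩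
    refine h ⟨x, fun f => ?_⟩
    rw [← hΨa, ← hx]
    rfl
  obtain ⟨θ, hθ, hball⟩ := far_closed hcl hnot
  have hdist : ∀ x, θ / 2 < ‖Ψ - J x‖ := by
    intro x
    have : θ < ‖Ψ - J x‖ := hball (J x) ⟨x, rfl⟩
    linarith
  set M := ‖Φ‖ + 1 with hM
  have hM0 : 0 < M := by positivity
  obtain ⟨s, hs1, hs2⟩ := exists_seq_of_forall_finset_exists
    (fun a : E × (E →L[ℝ] ℝ) => ‖a.1‖ ≤ M ∧ ‖a.2‖ ≤ 1 ∧ θ / 2 ≤ Ψ a.2 ∧ θ / 4 ≤ a.2 (W a.1))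
    (fun a b => b.2 (W a.1) = 0 ∧ θ / 4 ≤ a.2 (W b.1)) (by
      intro s hs
      obtain ⟨ψ, h1, h2, h3⟩ := annih Ψ (by positivity) hdist (s.image fun a => W a.1)
      obtain ⟨x, hx1, hx2⟩ := goldstine Φ hM0 (by linarith) (ι := Option s)
        (fun o => o.elim (ψ.comp W) (fun a => a.1.2.comp W)) (by positivity : 0 < θ / 4)
      refine ⟨(x, ψ), ⟨hx1, h1, h3, ?_⟩, fun a ha => ⟨h2 _ (mem_image_of_mem _ ha), ?_⟩⟩
      · have := abs_lt.mp (hx2 none)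
        simp only [Option.elim, ContinuousLinearMap.comp_apply] at this
        rw [← hΨa] at this
        simp only
        linarith [this.1]
      · have := abs_lt.mp (hx2 (some ⟨a, ha⟩))
        simp only [Option.elim, ContinuousLinearMap.comp_apply] at this
        rw [← hΨa] at this
        simp only
        linarith [this.1, (hs a ha).2.2.1])
  refine ⟨M, θ / 4, fun n => (s n).1, fun n => (s n).2, hM0, by positivity, fun n => (hs1 n).1,
    fun n => (hs1 n).2.1, fun m n hmn => (hs2 m n hmn).1, fun m n hmn => ?_⟩
  rcases hmn.eq_or_lt with rfl | hlt
  · exact (hs1 _).2.2.2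
  · exact (hs2 n m hlt).2

end HJT

namespace HJT
open Finset Filter Topology

lemma avg_fun_le (g : V →ₗ[ℝ] ℝ) {z : ℕ → V} {p n : ℕ} (hn : 1 ≤ n) {c : ℝ}
    (h : ∀ i, p ≤ i → i < p + n → g (z i) ≤ c) : g (avg z p n) ≤ c := by
  have hn' : (0:ℝ) < n := by exact_mod_cast hn
  unfold avg
  rw [map_smul, map_sum, smul_eq_mul, div_mul_eq_mul_div, one_mul, div_le_iff₀ hn']
  have : ∑ i ∈ Ico p (p + n), g (z i) ≤ ∑ i ∈ Ico p (p + n), c :=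
    sum_le_sum fun i hi => h i (mem_Ico.mp hi).1 (mem_Ico.mp hi).2
  rw [sum_const, Nat.card_Ico, nsmul_eq_mul, show p + n - p = n by omega] at this
  linarith

lemma coord_sub {x : ℕ → XX} {M : ℝ} (hx : ∀ n, ‖x n‖ ≤ M) :
    ∃ (φ : ℕ → ℕ) (y : XX), StrictMono φ ∧
      ∀ n, Tendsto (fun k => cX n (x (φ k) - y)) atTop (𝓝 0) := by
  have hc : IsCompact (Set.univ.pi fun _ : ℕ => Set.Icc (-M) M) :=
    isCompact_univ_pi fun _ => isCompact_Icc
  obtain ⟨ξ, _, φ, hφ, hlim⟩ := hc.tendsto_subseq (x := fun k n => cX n (x k)) (by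
    intro k n _
    exact abs_le.mp ((cX_le n (x k)).trans (hx k)))
  have hlim' : ∀ n, Tendsto (fun k => cX n (x (φ k))) atTop (𝓝 (ξ n)) := tendsto_pi_nhds.mp hlim
  obtain ⟨y, hy⟩ := bdd_complete ξ M (by
    intro n
    rw [← jj.norm_map]
    have h1 : Tendsto (fun k => jj (tr 0 n (x (φ k)))) atTop
        (𝓝 (jj (∑ m ∈ range n, Finsupp.single m (ξ m) : V))) := by
      have e : ∀ a : ℕ → ℝ, jj (∑ m ∈ range n, Finsupp.single m (a m) : V) =
          ∑ m ∈ range n, a m • jj (Finsupp.single m 1) := by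
        intro a
        rw [map_sum]
        refine sum_congr rfl fun m _ => ?_
        rw [← map_smul]
        congr 1
        rw [Finsupp.smul_single, smul_eq_mul, mul_one]
      unfold tr
      rw [e]
      simp only [Nat.Ico_zero_eq_range]
      have e' := fun k => e (fun m => cX m (x (φ k)))
      simp only [e']
      exact tendsto_finset_sum _ fun m _ => (hlim' m).smul_const _
    refine le_of_tendsto h1.norm (Eventually.of_forall fun k => ?_)
    rw [jj.norm_map]
    exact (norm_tr_le _ _ _).trans (hx _))
  refine ⟨φ, y, hφ, fun n => ?_⟩
  have := (hlim' n).sub_const (ξ n)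
  rw [sub_self] at this
  refine this.congr fun k => ?_
  rw [map_sub, hy]

lemma big_ris (W : XX →L[ℝ] XX) (Φ : (XX →L[ℝ] ℝ) →L[ℝ] ℝ)
    (h : ¬ ∃ x, ∀ f : XX →L[ℝ] ℝ, Φ (f.comp W) = f x) :
    ∃ (R : ℕ → ℕ) (d : ℕ → V) (lo hi : ℕ → ℕ) (τ : ℕ → ℝ) (δ : ℝ), 0 < δ ∧
      RIS R d lo hi τ ∧ ∀ i, δ ≤ ‖W (jj (d i))‖ := by
  obtain ⟨M, θ, x, ψ, hM, hθ, hx, hψ, h0, h1⟩ := sep_seq W Φ h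
  obtain ⟨φ, y, hφ, hlim⟩ := coord_sub hx
  have hWp : 0 < ‖W‖ + 1 := by positivity
  set η := min 1 (θ / (8 * (‖W‖ + 1))) with hη
  have hη0 : 0 < η := lt_min one_pos (by positivity)
  have hη1 : η ≤ 1 := min_le_left _ _
  have hη2 : ‖W‖ * η ≤ θ / 8 := by
    have : η ≤ θ / (8 * (‖W‖ + 1)) := min_le_right _ _
    rw [le_div_iff₀ (by positivity)] at this
    nlinarith [norm_nonneg W]
  obtain ⟨R, χ, u, hχ, hb, _, _, _, hu⟩ := hump hlim (fun _ _ => True)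
    (fun _ => Eventually.of_forall fun _ => trivial) (fun n => n) hη0
  have hu' : ∀ i, ‖x (φ (χ i)) - y - jj (u i)‖ ≤ η := fun i =>
    (hu i).trans (div_le_self hη0.le (one_le_pow₀ one_le_two))
  set C := M + ‖y‖ + 1 with hC
  have hC0 : 0 < C := by positivity
  have hun : ∀ i, ‖u i‖ ≤ C := by
    intro i
    rw [← jj.norm_map]
    have e : jj (u i) = x (φ (χ i)) - y - (x (φ (χ i)) - y - jj (u i)) := by abel
    rw [e]
    have a1 := norm_sub_le (x (φ (χ i)) - y) (x (φ (χ i)) - y - jj (u i))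
    have a2 := norm_sub_le (x (φ (χ i))) y
    linarith [hx (φ (χ i)), hu' i]
  obtain ⟨p, n, lo, hi, hn, hp, hpre⟩ := avg_pre (R := R) (z := fun i => C⁻¹ • u i) (hb.smul _) (by
    intro i
    rw [norm_smul, norm_inv, Real.norm_of_nonneg hC0.le, inv_mul_le_iff₀ hC0, mul_one]
    exact hun i)
  obtain ⟨p', q', hpq, _, H⟩ := hpre.ris
  refine ⟨_, _, _, _, _, C⁻¹ * (θ / 2), by positivity, H, fun i => ?_⟩
  have hpm : Monotone p := monotone_nat_of_le_succ fun i => by rw [hp]; omega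
  set P := p (p' i)
  set Q := p (q' i)
  have hPQ : P + n (p' i) ≤ Q := by
    have : p (p' i + 1) ≤ p (q' i) := hpm (hpq i)
    rwa [hp] at this
  set f : XX →L[ℝ] ℝ := (ψ (φ (χ Q))).comp W with hf
  set g : V →ₗ[ℝ] ℝ := f.toLinearMap.comp jj.toLinearMap with hg
  have hga : ∀ v, g v = f (jj v) := fun v => rfl
  have hψle : ∀ w, |ψ (φ (χ Q)) w| ≤ ‖w‖ := fun w => by
    have a1 := (ψ (φ (χ Q))).le_opNorm w
    have a2 : ‖ψ (φ (χ Q))‖ * ‖w‖ ≤ 1 * ‖w‖ := by gcongr; exact hψ _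
    rw [Real.norm_eq_abs] at a1
    linarith
  have herr : ∀ j, |f (x (φ (χ j))) - f y - f (jj (u j))| ≤ θ / 8 := by
    intro j
    rw [← map_sub, ← map_sub]
    refine (hψle _).trans ((W.le_opNorm _).trans (le_trans ?_ hη2))
    gcongr
    exact hu' j
  have hA : g (avg (fun i => C⁻¹ • u i) P (n (p' i))) ≤ C⁻¹ * (-f y + θ / 8) := by
    refine avg_fun_le g (hn _) fun j _ hj => ?_
    rw [map_smul, smul_eq_mul, hga]
    gcongr
    have := abs_le.mp (herr j)
    have h00 : f (x (φ (χ j))) = 0 := h0 _ _ (hφ (hχ (by omega)))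
    linarith [this.1, this.2]
  have hB : (-g) (avg (fun i => C⁻¹ • u i) Q (n (q' i))) ≤ C⁻¹ * (f y + θ / 8 - θ) := by
    refine avg_fun_le (-g) (hn _) fun j hj _ => ?_
    rw [map_smul, smul_eq_mul, LinearMap.neg_apply, hga]
    gcongr
    have := abs_le.mp (herr j)
    have h11 : θ ≤ f (x (φ (χ j))) := h1 _ _ (hφ.monotone (hχ.monotone hj))
    linarith [this.1, this.2]
  rw [LinearMap.neg_apply] at hB
  have key : C⁻¹ * (θ / 2) ≤ -(g (avg (fun i => C⁻¹ • u i) P (n (p' i)) -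
      avg (fun i => C⁻¹ • u i) Q (n (q' i)))) := by
    rw [map_sub]
    have hCi : 0 < C⁻¹ := by positivity
    nlinarith
  refine key.trans ((neg_le_abs _).trans ?_)
  exact hψle _

lemma main_wc (T : XX →L[ℝ] XX) : ∃ (lam : ℝ) (W : XX →L[ℝ] XX),
    IsWeaklyCompactOperator W ∧ T = lam • ContinuousLinearMap.id ℝ XX + W := by
  have htop : ¬ FiniteDimensional ℝ (⊤ : Submodule ℝ XX) := fun hf =>
    XX_infdim (Module.Finite.equiv (Submodule.topEquiv (R := ℝ) (M := XX)))
  obtain ⟨R, v, hb, hv, _⟩ := block_in htop one_pos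
  obtain ⟨R', d, lo, hi, τ, H, _, hd⟩ := ris_in hb hv
  obtain ⟨c, φ, hφ, hT⟩ := lemL H (by norm_num : (0:ℝ) < 1 / 2) hd T
  set W := T - c • ContinuousLinearMap.id ℝ XX with hW
  refine ⟨c, W, wc_crit W fun Φ => ?_, by rw [hW]; abel⟩
  by_contra hcon
  obtain ⟨R2, d2, lo2, hi2, τ2, δ, hδ, H2, hd2⟩ := big_ris W Φ hcon
  have hWp : 0 < ‖W‖ + 1 := by positivity
  have hd2' : ∀ i, δ / (‖W‖ + 1) ≤ ‖d2 i‖ := by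
    intro i
    rw [div_le_iff₀ hWp]
    have := (hd2 i).trans (W.le_opNorm _)
    rw [jj.norm_map] at this
    nlinarith [norm_nonneg (d2 i)]
  have hκ : 0 < δ / (‖W‖ + 1) := by positivity
  obtain ⟨c2, φ2, hφ2, hT2⟩ := lemL H2 hκ hd2' W
  have hc : c2 = 0 := scal_unique (T := W)
    (fun ε hε => small_sub H2.bl.blk hκ hd2' hφ2 hT2 hε)
    (fun ε hε => by
      rw [zero_smul, sub_zero]
      exact small_sub H.bl.blk (by norm_num : (0:ℝ) < 1 / 2) hd hφ hT hε)
  rw [hc, zero_smul, sub_zero] at hT2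
  have := ge_of_tendsto' hT2 (fun i => hd2 (φ2 i))
  linarith

end HJT

/-- There exists an infinite-dimensional separable real Banach space `P`
which is hereditarily indecomposable, has no infinite-dimensional reflexive closed
subspace, and on which every bounded linear operator is a scalar multiple of the
identity plus a weakly compact operator. -/
theorem statement0 :
    ∃ P : BanachSpacePkg,
      (¬ FiniteDimensional ℝ P.carrier) ∧ SeparableSpace P.carrier ∧
      IsHI P.carrier ∧ HasNoReflexiveSubspace P.carrier ∧
      ∀ T : P.carrier →L[ℝ] P.carrier,
        ∃ (lam : ℝ) (W : P.carrier →L[ℝ] P.carrier),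
          IsWeaklyCompactOperator W ∧
          T = lam • ContinuousLinearMap.id ℝ P.carrier + W := by
  refine ⟨⟨HJT.XX⟩, HJT.XX_infdim, inferInstanceAs (SeparableSpace HJT.XX), ?_, ?_, HJT.main_wc⟩
  · intro Y Z hY hZ ε hε
    exact HJT.XX_HI Y Z hY.2 hZ.2 ε hε
  · intro Y hY
    exact HJT.XX_nonreflexive Y hY.2
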